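/- Let 𝒜 be a homogeneous constant-coefficient differential operator of order k > n on ℝ^n. Then 𝒜 is elliptic if and only if for every u ∈ BV^𝒜_loc(ℝ^n), D^{k−n−1}u ∈ t^{n+1,∞}(x) for ℒ^n-almost every x ∈ ℝ^n; in particular, in that case every u ∈ BV^𝒜_loc is k times classically differentiable almost everywhere. -/

import Mathlib

open MeasureTheory Metric Filter
open scoped ENNReal RealInnerProductSpace Topology

noncomputable section

/-- Euclidean space `ℝ^n`. -/
abbrev Euc (n : ℕ) : Type := EuclideanSpace ℝ (Fin n)

/-- The `i`-th standard basis vector of `ℝ^n`. -/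
def stdVec (n : ℕ) (i : Fin n) : Euc n := EuclideanSpace.single i (1 : ℝ)

/-- Coefficients `A_I : V →ₗ W` (indexed by `I : Fin k → Fin n`) of a homogeneous linear
constant-coefficient differential operator `𝒜 u = ∑_I A_I ∂_I u` of order `k` on `ℝ^n`. -/
abbrev CoeffOp (n k : ℕ) (V W : Type*) [NormedAddCommGroup V] [InnerProductSpace ℝ V]
    [NormedAddCommGroup W] [InnerProductSpace ℝ W] : Type _ :=
  (Fin k → Fin n) → (V →ₗ[ℝ] W)

variable {V W F : Type*}
  [NormedAddCommGroup V] [InnerProductSpace ℝ V] [FiniteDimensional ℝ V]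
  [NormedAddCommGroup W] [InnerProductSpace ℝ W] [FiniteDimensional ℝ W]

/-- The coefficients represent a linear map on symmetric tensors `V ⊙^k ℝ^n`. -/
def IsSymmetricOp (n k : ℕ) (A : CoeffOp n k V W) : Prop :=
  ∀ (I : Fin k → Fin n) (σ : Equiv.Perm (Fin k)), A (I ∘ σ) = A I

/-- The symbol `𝒜[ξ] v = A (v ⊗^k ξ) = ∑_I (∏ i, ξ_{I i}) A_I v`. -/
def symbolMap (n k : ℕ) (A : CoeffOp n k V W) (ξ : Euc n) : V →ₗ[ℝ] W :=
  ∑ I : Fin k → Fin n, (∏ i, ξ (I i)) • A I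

/-- Ellipticity: the symbol is injective for all `ξ ≠ 0`. -/
def IsElliptic (n k : ℕ) (A : CoeffOp n k V W) : Prop :=
  ∀ ξ : Euc n, ξ ≠ 0 → Function.Injective (symbolMap n k A ξ)

/-- Van Schaftingen's cancellation condition: `⋂_{ξ ∈ 𝕊^{n-1}} im 𝒜[ξ] = {0}`. -/
def IsCanceling (n k : ℕ) (A : CoeffOp n k V W) : Prop :=
  (⋂ ξ ∈ sphere (0 : Euc n) 1, (LinearMap.range (symbolMap n k A ξ) : Set W)) = {0}

/-- Inverse of an endomorphism (junk value when not invertible), via matrix inversion. -/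
def linInv (f : V →ₗ[ℝ] V) : V →ₗ[ℝ] V :=
  letI b := Module.finBasis ℝ V
  Matrix.toLin b b ((LinearMap.toMatrix b b f)⁻¹)

/-- `𝒜†[ξ] = (𝒜*[ξ] 𝒜[ξ])⁻¹ 𝒜*[ξ]`. -/
def Adagger (n k : ℕ) (A : CoeffOp n k V W) (ξ : Euc n) : W →ₗ[ℝ] V :=
  linInv (LinearMap.adjoint (symbolMap n k A ξ) ∘ₗ symbolMap n k A ξ) ∘ₗ
    LinearMap.adjoint (symbolMap n k A ξ)

/-- Condition (WC): for every `w ∈ ⋂_{ξ ∈ 𝕊^{n-1}} im 𝒜[ξ]`,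
`∫_{𝕊^{n-1}} 𝒜†[ξ] w ⊗^{k-n} ξ dℋ^{n-1}(ξ) = 0`, written componentwise in the
tensor coordinates indexed by `J : Fin (k-n) → Fin n`. -/
def IsWeaklyCanceling (n k : ℕ) (A : CoeffOp n k V W) : Prop :=
  ∀ w : W, (∀ ξ ∈ sphere (0 : Euc n) 1, w ∈ LinearMap.range (symbolMap n k A ξ)) →
    ∀ J : Fin (k - n) → Fin n,
      (∫ ξ in sphere (0 : Euc n) 1,
        (∏ i, ξ (J i)) • (Adagger n k A ξ w) ∂(μH[(n : ℝ) - 1])) = 0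

section TestFun

variable [NormedAddCommGroup F] [NormedSpace ℝ F]

/-- Compactly supported smooth test function. -/
def IsTestFun (n : ℕ) (φ : Euc n → F) : Prop :=
  ContDiff ℝ (⊤ : ℕ∞) φ ∧ HasCompactSupport φ

/-- Iterated directional derivative `∂_{I 0} ⋯ ∂_{I (m-1)} φ (x)`. -/
def dirDeriv (n m : ℕ) (I : Fin m → Fin n) (φ : Euc n → F) (x : Euc n) : F :=
  iteratedFDeriv ℝ m φ x (fun i => stdVec n (I i))

/-- Smooth functions of degree-`≤ j` polynomial type. -/
def IsPolyDeg (n : ℕ) (j : ℕ) (P : Euc n → F) : Prop :=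
  ContDiff ℝ (⊤ : ℕ∞) P ∧ ∀ x, iteratedFDeriv ℝ (j + 1) P x = 0

end TestFun

/-- Pointwise application of the operator `𝒜` to a smooth map. -/
def Aapply (n k : ℕ) (A : CoeffOp n k V W) (u : Euc n → V) (x : Euc n) : W :=
  ∑ I : Fin k → Fin n, A I (dirDeriv n k I u x)

/-- `𝒜 u = f σ` (a `W`-valued measure with total-variation measure `σ` and polar density `f`)
in the sense of distributions. -/
def HasDistribA (n k : ℕ) (A : CoeffOp n k V W) (u : Euc n → V) (σ : Measure (Euc n))
    (f : Euc n → W) : Prop :=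
  ∀ φ : Euc n → W, IsTestFun n φ →
    ((-1 : ℝ) ^ k) * (∑ I : Fin k → Fin n,
        ∫ x, ⟪u x, LinearMap.adjoint (A I) (dirDeriv n k I φ x)⟫) =
      ∫ x, ⟪f x, φ x⟫ ∂σ

/-- `u ∈ BV^𝒜_loc(ℝ^n)`: `u` is locally integrable and `𝒜 u` is a `W`-valued Radon measure,
given by its polar decomposition `f σ` with `σ` locally finite and `‖f‖ = 1` σ-a.e. -/
def MemBVAloc (n k : ℕ) (A : CoeffOp n k V W) (u : Euc n → V) : Prop :=
  LocallyIntegrable u volume ∧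
    ∃ (σ : Measure (Euc n)) (f : Euc n → W), IsLocallyFiniteMeasure σ ∧
      LocallyIntegrable f σ ∧ (∀ᵐ x ∂σ, ‖f x‖ = 1) ∧ HasDistribA n k A u σ f

/-- `v` is the family of weak derivatives of order `m` of `u` (componentwise, indexed by
`I : Fin m → Fin n`). -/
def IsWeakDerivFamily (n m : ℕ) (u : Euc n → V) (v : (Fin m → Fin n) → Euc n → V) : Prop :=
  (∀ I, LocallyIntegrable (v I) volume) ∧
    ∀ (I : Fin m → Fin n) (φ : Euc n → ℝ), IsTestFun n φ →
      ∫ x, (dirDeriv n m I φ x) • u x = ((-1 : ℝ) ^ m) • ∫ x, φ x • v I x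

/-- `Q r = o(r^a)` as `r ↓ 0`. -/
def SmallO (Q : ℝ → ℝ≥0∞) (a : ℝ) : Prop :=
  Tendsto (fun r => Q r / ENNReal.ofReal (r ^ a)) (𝓝[>] (0 : ℝ)) (𝓝 0)

section Spaces

variable [NormedAddCommGroup F] [NormedSpace ℝ F]

/-- `f ∈ t^{j,p}(x)`: there is a polynomial `P` of degree at most `j` with
`(⨍_{B_r(x)} |f - P|^p)^{1/p} = o(r^j)` as `r ↓ 0`. -/
def MemT (n : ℕ) (j : ℕ) (p : ℝ) (f : Euc n → F) (x : Euc n) : Prop :=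
  ∃ P : Euc n → F, IsPolyDeg n j P ∧
    SmallO (fun r => ((volume (ball x r))⁻¹ *
      ∫⁻ y in ball x r, (‖f y - P y‖₊ : ℝ≥0∞) ^ p) ^ (1 / p)) (j : ℝ)

/-- `f ∈ t^{j,∞}(x)`: there is a polynomial `P` of degree at most `j` with
`‖f - P‖_{L^∞(B_r(x))} = o(r^j)` as `r ↓ 0`. -/
def MemTInf (n : ℕ) (j : ℕ) (f : Euc n → F) (x : Euc n) : Prop :=
  ∃ P : Euc n → F, IsPolyDeg n j P ∧
    SmallO (fun r => essSup (fun y => (‖f y - P y‖₊ : ℝ≥0∞))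
      (volume.restrict (ball x r))) (j : ℝ)

/-- The Lorentz `L^{p,q}` quasi-norm (for `p, q < ∞`). -/
def lorentzNorm {α : Type*} [MeasurableSpace α] (p q : ℝ) (μ : Measure α) (f : α → F) : ℝ≥0∞ :=
  ENNReal.ofReal p ^ (1 / q) *
    (∫⁻ t in Set.Ioi (0 : ℝ),
      (ENNReal.ofReal t * (μ {x | t < ‖f x‖}) ^ (1 / p)) ^ q * (ENNReal.ofReal t)⁻¹) ^ (1 / q)

/-- `f` is `L^{p,q}`-differentiable of order `j` at `x`:
`‖f - P‖_{L^{p,q}(B_r(x))} = o(r^{j + n/p})` for a polynomial `P` of degree at most `j`. -/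
def MemTLorentz (n : ℕ) (j : ℕ) (p q : ℝ) (f : Euc n → F) (x : Euc n) : Prop :=
  ∃ P : Euc n → F, IsPolyDeg n j P ∧
    SmallO (fun r => lorentzNorm p q (volume.restrict (ball x r)) (fun y => f y - P y))
      ((j : ℝ) + n / p)

/-- `f ∈ L^p_loc`. -/
def LocLp (n : ℕ) (p : ℝ) (f : Euc n → F) : Prop :=
  ∀ K : Set (Euc n), IsCompact K → ∫⁻ x in K, (‖f x‖₊ : ℝ≥0∞) ^ p < ⊤

end Spaces

end

noncomputable section

open Asymptotics
open scoped NNReal SchwartzMap Pointwise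

section Polynomials

universe v

variable {E : Type} {F : Type v} [NormedAddCommGroup E] [NormedSpace ℝ E]
  [NormedAddCommGroup F] [NormedSpace ℝ F]

theorem iteratedFDeriv_eq_zero_of_hasFiniteFPowerSeriesOnBall (m : ℕ) :
    ∀ {G : Type v} [NormedAddCommGroup G] [NormedSpace ℝ G] {f : E → G}
      {p : FormalMultilinearSeries ℝ E G} {x : E},
      HasFiniteFPowerSeriesOnBall f p x m ⊤ → ∀ y, iteratedFDeriv ℝ m f y = 0 := by
  induction m with
  | zero =>
    intro G _ _ f p x h y
    ext v
    simpa using h.eq_zero_of_bound_zero y (by simp)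
  | succ m ih =>
    intro G _ _ f p x h y
    rw [iteratedFDeriv_succ_eq_comp_right, Function.comp_apply]
    have h0 : iteratedFDeriv ℝ m (fun y => fderiv ℝ f y) y = 0 := ih h.fderiv y
    rw [h0]
    exact (continuousMultilinearCurryRightEquiv' ℝ m E G).symm.map_zero

/-- The polynomial `y ↦ ∑_{l ≤ m} M_l (y - x, …, y - x)`. -/
theorem polynomial_contDiff_and_iteratedFDeriv_eq_zero (m : ℕ)
    (M : ∀ l : ℕ, ContinuousMultilinearMap ℝ (fun _ : Fin l => E) F) (x : E) :
    ContDiff ℝ (⊤ : ℕ∞) (fun y => ∑ l ∈ Finset.range (m + 1), M l (fun _ => y - x)) ∧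
      ∀ y, iteratedFDeriv ℝ (m + 1)
        (fun y => ∑ l ∈ Finset.range (m + 1), M l (fun _ => y - x)) y = 0 := by
  constructor
  · refine ContDiff.sum fun l _ => ?_
    exact (M l).contDiff.comp (contDiff_pi.2 fun _ => contDiff_id.sub contDiff_const)
  · refine iteratedFDeriv_eq_zero_of_hasFiniteFPowerSeriesOnBall (m + 1)
      (p := fun l => if l < m + 1 then M l else 0) (x := x) ?_
    refine HasFiniteFPowerSeriesOnBall.mk' (fun l hl => by simp [not_lt.2 hl]) (by simp) ?_
    intro y _
    simp only [add_sub_cancel_left]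
    refine Finset.sum_congr rfl fun l hl => ?_
    rw [if_pos (Finset.mem_range.1 hl)]

end Polynomials

section HasTaylor

variable {n : ℕ} {F : Type*} [NormedAddCommGroup F] [NormedSpace ℝ F]

/-- Peano differentiability of order `k` at `x`. -/
def HasTaylor (k : ℕ) (f : Euc n → F) (x : Euc n) : Prop :=
  ∃ P : Euc n → F, IsPolyDeg n k P ∧ (fun y => f y - P y) =o[𝓝 x] fun y => ‖y - x‖ ^ k

theorem IsPolyDeg.add {k : ℕ} {P Q : Euc n → F} (hP : IsPolyDeg n k P) (hQ : IsPolyDeg n k Q) :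
    IsPolyDeg n k (fun y => P y + Q y) := by
  refine ⟨hP.1.add hQ.1, fun x => ?_⟩
  rw [fun_iteratedFDeriv_add_apply (hP.1.of_le (mod_cast le_top)).contDiffAt
    (hQ.1.of_le (mod_cast le_top)).contDiffAt, hP.2, hQ.2, add_zero]

theorem isPolyDeg_const (k : ℕ) (c : F) : IsPolyDeg n k (fun _ => c) :=
  ⟨contDiff_const, fun x => by simp [iteratedFDeriv_const_of_ne (Nat.succ_ne_zero k)]⟩

theorem IsPolyDeg.smul_const {k : ℕ} {P : Euc n → ℝ} (hP : IsPolyDeg n k P) (c : F) :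
    IsPolyDeg n k (fun y => P y • c) := by
  refine ⟨hP.1.smul contDiff_const, fun x => ?_⟩
  have := ContinuousLinearMap.iteratedFDeriv_comp_left (ContinuousLinearMap.toSpanSingleton ℝ c)
    (hP.1.contDiffAt (x := x)) (i := k + 1) (mod_cast le_top)
  rw [hP.2] at this
  refine this.trans ?_
  ext v
  exact zero_smul ℝ c

theorem HasTaylor.add {k : ℕ} {f g : Euc n → F} {x : Euc n} (hf : HasTaylor k f x)
    (hg : HasTaylor k g x) : HasTaylor k (fun y => f y + g y) x := by
  obtain ⟨P, hP, hP'⟩ := hf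
  obtain ⟨Q, hQ, hQ'⟩ := hg
  refine ⟨_, hP.add hQ, ?_⟩
  refine (hP'.add hQ').congr_left fun y => ?_
  exact (add_sub_add_comm (f y) (g y) (P y) (Q y)).symm

theorem HasTaylor.const (k : ℕ) (c : F) (x : Euc n) : HasTaylor k (fun _ => c) x :=
  ⟨_, isPolyDeg_const k c, by simp only [sub_self]; exact isLittleO_zero _ _⟩

theorem HasTaylor.sum {ι : Type*} {k : ℕ} (s : Finset ι) {f : ι → Euc n → F} {x : Euc n}
    (hf : ∀ i ∈ s, HasTaylor k (f i) x) : HasTaylor k (fun y => ∑ i ∈ s, f i y) x := by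
  classical
  induction s using Finset.induction_on with
  | empty => simpa using HasTaylor.const k (0 : F) x
  | insert a s ha ih =>
    simp only [Finset.sum_insert ha]
    exact (hf a (Finset.mem_insert_self _ _)).add
      (ih fun i hi => hf i (Finset.mem_insert_of_mem hi))

theorem HasTaylor.smul_const {k : ℕ} {f : Euc n → ℝ} {x : Euc n} (hf : HasTaylor k f x) (c : F) :
    HasTaylor k (fun y => f y • c) x := by
  obtain ⟨P, hP, hP'⟩ := hf
  refine ⟨_, hP.smul_const c, ?_⟩
  have h2 : (fun y => (f y - P y) • c) =o[𝓝 x] fun y => ‖y - x‖ ^ k := by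
    rw [isLittleO_iff] at hP' ⊢
    intro ε hε
    filter_upwards [hP' (show 0 < ε / (‖c‖ + 1) by positivity)] with y hy
    rw [norm_smul]
    calc _ ≤ (ε / (‖c‖ + 1) * ‖‖y - x‖ ^ k‖) * (‖c‖ + 1) := by gcongr; linarith
      _ = _ := by field_simp
  refine h2.congr_left fun y => ?_
  rw [sub_smul]

theorem HasTaylor.congr_of_eventuallyEq {k : ℕ} {f g : Euc n → F} {x : Euc n}
    (hf : HasTaylor k f x) (h : g =ᶠ[𝓝 x] f) : HasTaylor k g x := by
  obtain ⟨P, hP, hP'⟩ := hf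
  refine ⟨P, hP, hP'.congr' ?_ (Filter.EventuallyEq.refl _ _)⟩
  filter_upwards [h] with y hy
  rw [hy]

theorem HasTaylor.memTInf {k : ℕ} {f g : Euc n → F} {x : Euc n} (hf : HasTaylor k f x)
    (h : g =ᵐ[volume] f) : MemTInf n k g x := by
  obtain ⟨P, hP, hP'⟩ := hf
  refine ⟨P, hP, ?_⟩
  unfold SmallO
  rw [ENNReal.tendsto_nhds_zero]
  intro ε hε
  obtain ⟨e, he0, heε⟩ : ∃ e : ℝ≥0, 0 < e ∧ (e : ℝ≥0∞) ≤ ε := by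
    rcases eq_or_ne ε ⊤ with rfl | hne
    · exact ⟨1, one_pos, le_top⟩
    · exact ⟨ε.toNNReal, ENNReal.toNNReal_pos hε.ne' hne, ENNReal.coe_toNNReal_le_self⟩
  have h1 := (isLittleO_iff.1 hP') (NNReal.coe_pos.2 he0)
  obtain ⟨δ, hδ, hball⟩ := Metric.eventually_nhds_iff.1 h1
  filter_upwards [Ioo_mem_nhdsGT hδ] with r hr
  refine ENNReal.div_le_of_le_mul ?_
  refine le_trans ?_ (mul_le_mul_left heε _)
  refine essSup_le_of_ae_le _ ?_
  filter_upwards [ae_restrict_mem measurableSet_ball, ae_restrict_of_ae h] with y hy hgy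
  have h3 := hball (lt_trans (mem_ball.1 hy) hr.2)
  rw [hgy]
  have h4 : ‖f y - P y‖ ≤ e * r ^ k := by
    refine h3.trans ?_
    rw [Real.norm_of_nonneg (by positivity)]
    have : ‖y - x‖ ≤ r := by rw [← dist_eq_norm]; exact (mem_ball.1 hy).le
    gcongr
  have hr0 : 0 ≤ r := hr.1.le
  rw [Real.rpow_natCast, ← ENNReal.ofReal_coe_nnreal (p := e),
    ← ENNReal.ofReal_mul (by positivity), ← enorm_eq_nnnorm, ← ofReal_norm]
  exact ENNReal.ofReal_le_ofReal h4

theorem norm_taylor_remainder_le [CompleteSpace F] {f : Euc n → F} (hf : ContDiff ℝ (⊤ : ℕ∞) f)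
    (k : ℕ) {x y : Euc n} {B : ℝ}
    (hB : ∀ z, ‖z - x‖ ≤ ‖y - x‖ → ‖iteratedFDeriv ℝ (k + 1) f z‖ ≤ B) :
    ‖f y - ∑ l ∈ Finset.range (k + 1), (l.factorial : ℝ)⁻¹ •
      iteratedFDeriv ℝ l f x (fun _ => y - x)‖ ≤ B * ‖y - x‖ ^ (k + 1) := by
  have h := map_add_eq_sum_add_integral_iteratedFDeriv (f := f) (x := x) (y := y - x) (n := k)
    (fun t _ => (hf.of_le (by exact_mod_cast le_top)).contDiffAt)
  rw [add_sub_cancel] at h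
  rw [h, add_sub_cancel_left, norm_smul]
  have hB0 : 0 ≤ B := (norm_nonneg _).trans (hB x (by simp))
  have h1 : ‖∫ t in (0 : ℝ)..1, (1 - t) ^ k •
      iteratedFDeriv ℝ (k + 1) f (x + t • (y - x)) (fun _ => y - x)‖
      ≤ (B * ‖y - x‖ ^ (k + 1)) * |1 - 0| := by
    refine intervalIntegral.norm_integral_le_of_norm_le_const fun t ht => ?_
    rw [Set.uIoc_of_le zero_le_one] at ht
    rw [norm_smul, Real.norm_of_nonneg (pow_nonneg (by linarith [ht.2]) _)]
    have h2 : (1 - t) ^ k ≤ 1 := pow_le_one₀ (by linarith [ht.2]) (by linarith [ht.1])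
    have h3 := (iteratedFDeriv ℝ (k + 1) f (x + t • (y - x))).le_opNorm (fun _ => y - x)
    simp only [Finset.prod_const, Finset.card_univ, Fintype.card_fin] at h3
    have h4 := hB (x + t • (y - x)) (by
      rw [add_sub_cancel_left, norm_smul, Real.norm_of_nonneg ht.1.le]
      exact mul_le_of_le_one_left (norm_nonneg _) ht.2)
    calc _ ≤ 1 * (B * ‖y - x‖ ^ (k + 1)) := by
          gcongr
          exact h3.trans (by gcongr)
      _ = _ := one_mul _
  have h5 : ‖((k.factorial : ℝ))⁻¹‖ ≤ 1 := by
    rw [norm_inv, Real.norm_natCast]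
    exact inv_le_one_of_one_le₀ (by exact_mod_cast Nat.factorial_pos k)
  calc _ ≤ 1 * ((B * ‖y - x‖ ^ (k + 1)) * |1 - 0|) := by gcongr
    _ = _ := by simp

theorem ContDiff.hasTaylor [CompleteSpace F] {f : Euc n → F} (hf : ContDiff ℝ (⊤ : ℕ∞) f) (k : ℕ)
    (x : Euc n) : HasTaylor k f x := by
  refine ⟨_, polynomial_contDiff_and_iteratedFDeriv_eq_zero k
    (fun l => (l.factorial : ℝ)⁻¹ • iteratedFDeriv ℝ l f x) x, ?_⟩
  have hcont : Continuous fun z => ‖iteratedFDeriv ℝ (k + 1) f z‖ :=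
    (hf.continuous_iteratedFDeriv (by exact_mod_cast le_top)).norm
  obtain ⟨B, hB⟩ := (isCompact_closedBall x 1).bddAbove_image hcont.continuousOn
  have hO : (fun y => f y - ∑ l ∈ Finset.range (k + 1),
      ((l.factorial : ℝ)⁻¹ • iteratedFDeriv ℝ l f x) (fun _ => y - x)) =O[𝓝 x]
      fun y => ‖y - x‖ ^ (k + 1) := by
    refine IsBigO.of_bound B ?_
    filter_upwards [closedBall_mem_nhds x one_pos] with y hy
    rw [norm_pow, norm_norm]
    refine norm_taylor_remainder_le hf k fun z hz => hB ⟨z, ?_, rfl⟩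
    rw [mem_closedBall, dist_eq_norm] at hy ⊢
    exact hz.trans hy
  refine hO.trans_isLittleO ?_
  have : (fun y => ‖y - x‖ ^ (k + 1)) = fun y : Euc n => ‖y - x‖ ^ k * ‖y - x‖ := by
    ext y; ring
  rw [this]
  have h0 : (fun y : Euc n => ‖y - x‖) =o[𝓝 x] fun _ => (1 : ℝ) := by
    rw [isLittleO_one_iff]
    have : Continuous fun y : Euc n => ‖y - x‖ := by fun_prop
    simpa using this.tendsto x
  simpa using (isBigO_refl (fun y : Euc n => ‖y - x‖ ^ k) (𝓝 x)).mul_isLittleO h0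

end HasTaylor

section DyadicTaylor

theorem tendsto_dyadic_average {e : ℕ → ℝ} (he : Tendsto e atTop (𝓝 0)) :
    Tendsto (fun J => (∑ i ∈ Finset.range J, e i * 2 ^ i) / 2 ^ J) atTop (𝓝 0) := by
  have h1 : (fun i => e i * 2 ^ i) =o[atTop] fun i : ℕ => (2 : ℝ) ^ i := by
    simpa using ((isLittleO_one_iff ℝ).2 he).mul_isBigO (isBigO_refl (fun i : ℕ => (2 : ℝ) ^ i) _)
  have hs : ∀ J, ∑ i ∈ Finset.range J, (2 : ℝ) ^ i = 2 ^ J - 1 := fun J => by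
    rw [geom_sum_eq (by norm_num)]; norm_num
  have h2 := h1.sum_range (fun i => by positivity) (by
    simp only [hs]
    exact tendsto_atTop_add_const_right _ _ (tendsto_pow_atTop_atTop_of_one_lt one_lt_two))
  refine (h2.trans_le (k := fun J : ℕ => (2 : ℝ) ^ J) fun J => ?_).tendsto_div_nhds_zero
  rw [hs, Real.norm_of_nonneg (sub_nonneg.2 (one_le_pow₀ one_le_two)),
    Real.norm_of_nonneg (by positivity)]
  linarith

theorem exists_antitone_ge_tendsto_zero {e : ℕ → ℝ} (he : Tendsto e atTop (𝓝 0)) :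
    ∃ E : ℕ → ℝ, Antitone E ∧ (∀ i, 0 ≤ E i) ∧ (∀ i, e i ≤ E i) ∧ Tendsto E atTop (𝓝 0) := by
  obtain ⟨B, hB⟩ := he.norm.bddAbove_range
  have hbdd : ∀ J, BddAbove (Set.range fun i => ‖e (J + i)‖) := fun J =>
    ⟨B, by rintro _ ⟨i, rfl⟩; exact hB ⟨J + i, rfl⟩⟩
  have hle : ∀ J i, J ≤ i → ‖e i‖ ≤ ⨆ i, ‖e (J + i)‖ := fun J i hi => by
    obtain ⟨d, rfl⟩ := Nat.exists_eq_add_of_le hi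
    exact le_ciSup (hbdd J) d
  refine ⟨fun J => ⨆ i, ‖e (J + i)‖, fun J J' h => ciSup_le fun i => hle _ _ (by omega),
    fun J => (norm_nonneg _).trans (hle J J le_rfl),
    fun J => (Real.le_norm_self _).trans (hle J J le_rfl), ?_⟩
  rw [Metric.tendsto_atTop] at he ⊢
  intro ε hε
  obtain ⟨N, hN⟩ := he (ε / 2) (half_pos hε)
  refine ⟨N, fun J hJ => ?_⟩
  rw [Real.dist_eq, sub_zero, abs_of_nonneg ((norm_nonneg _).trans (hle J J le_rfl))]
  refine lt_of_le_of_lt (ciSup_le fun i => ?_) (half_lt_self hε)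
  have := (hN (J + i) (by omega)).le
  rwa [dist_zero_right] at this

variable {n : ℕ} {F : Type*} [NormedAddCommGroup F] [NormedSpace ℝ F] [CompleteSpace F]

omit [NormedSpace ℝ F] in
theorem summable_and_tsum_le_of_le_geometric {a : ℕ → F} {C : ℝ}
    (h : ∀ s, ‖a s‖ ≤ C * (1 / 2) ^ s) : Summable a ∧ ‖∑' s, a s‖ ≤ 2 * C := by
  have hs : HasSum (fun s : ℕ => C * (1 / 2 : ℝ) ^ s) (C * 2) := hasSum_geometric_two.mul_left C
  refine ⟨Summable.of_norm_bounded hs.summable h, ?_⟩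
  rw [mul_comm]
  exact tsum_of_norm_bounded hs h

theorem hasTaylor_of_dyadic_bounds {k : ℕ} (hnk : n < k) {f : Euc n → F} {g : ℕ → Euc n → F}
    {x : Euc n} {e : ℕ → ℝ} (hanti : Antitone e) (he0 : ∀ i, 0 ≤ e i)
    (he : Tendsto e atTop (𝓝 0)) (hg : ∀ i, ContDiff ℝ (⊤ : ℕ∞) (g i))
    (ha : ∀ i y, ‖y - x‖ ≤ (1 / 2) ^ i → ∀ j ≤ k + 1,
      ‖iteratedFDeriv ℝ j (g i) y‖ ≤ e i * 2 ^ (i * j) / 2 ^ (i * k))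
    (hb : ∀ J i y, J ≤ i → ‖y - x‖ ≤ (1 / 2) ^ J →
      ‖g i y‖ ≤ e J * 2 ^ (i * n) / (2 ^ (i * k) * 2 ^ (J * n)))
    {M : ContinuousMultilinearMap ℝ (fun _ : Fin k => Euc n) F}
    (hc : Tendsto (fun J => ∑ i ∈ Finset.range J, iteratedFDeriv ℝ k (g i) x) atTop (𝓝 M))
    (hf : ∀ y, ‖y - x‖ ≤ 1 → f y = ∑' i, g i y) : HasTaylor k f x := by
  set D : ∀ l : ℕ, ContinuousMultilinearMap ℝ (fun _ : Fin l => Euc n) F := fun l =>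
    if h : l = k then h ▸ M else ∑' i, iteratedFDeriv ℝ l (g i) x with hD
  have hDk : D k = M := by simp [hD]
  have hDl : ∀ l < k, D l = ∑' i, iteratedFDeriv ℝ l (g i) x := fun l hl => by
    simp [hD, hl.ne]
  have htail : ∀ l < k, ∀ J, Summable (fun s => iteratedFDeriv ℝ l (g (J + s)) x) ∧
      ‖∑' s, iteratedFDeriv ℝ l (g (J + s)) x‖ ≤ 2 * (e J * (1 / 2) ^ (J * (k - l))) := by
    intro l hl J
    refine summable_and_tsum_le_of_le_geometric fun s => ?_
    refine (ha (J + s) x (by simp) l (by omega)).trans ?_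
    obtain ⟨d, rfl⟩ : ∃ d, k = l + (d + 1) := ⟨k - l - 1, by omega⟩
    have h1 : e (J + s) ≤ e J := hanti (by omega)
    have h2 : e (J + s) * 2 ^ ((J + s) * l) / 2 ^ ((J + s) * (l + (d + 1))) =
        e (J + s) * ((1 / 2) ^ (J * (d + 1)) * (1 / 2) ^ s * (1 / 2) ^ (s * d)) := by
      simp only [one_div, inv_pow]
      field_simp
      ring
    rw [h2]
    have h3 : (1 / 2 : ℝ) ^ (s * d) ≤ 1 := pow_le_one₀ (by norm_num) (by norm_num)
    have h4 : l + (d + 1) - l = d + 1 := by omega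
    rw [h4]
    calc _ ≤ e J * ((1 / 2) ^ (J * (d + 1)) * (1 / 2) ^ s * 1) := by
          gcongr
          exact he0 J
      _ = _ := by ring
  have htail0 : ∀ y J, ‖y - x‖ ≤ (1 / 2) ^ J → Summable (fun s => g (J + s) y) ∧
      ‖∑' s, g (J + s) y‖ ≤ 2 * (e J * (1 / 2) ^ (J * k)) := by
    intro y J hy
    refine summable_and_tsum_le_of_le_geometric fun s => ?_
    refine (hb J (J + s) y (by omega) hy).trans ?_
    obtain ⟨d, rfl⟩ : ∃ d, k = n + (d + 1) := ⟨k - n - 1, by omega⟩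
    have h2 : e J * 2 ^ ((J + s) * n) / (2 ^ ((J + s) * (n + (d + 1))) * 2 ^ (J * n)) =
        e J * ((1 / 2) ^ (J * (n + (d + 1))) * (1 / 2) ^ s * (1 / 2) ^ (s * d)) := by
      simp only [one_div, inv_pow]
      field_simp
      ring
    rw [h2]
    have h3 : (1 / 2 : ℝ) ^ (s * d) ≤ 1 := pow_le_one₀ (by norm_num) (by norm_num)
    calc _ ≤ e J * ((1 / 2) ^ (J * (n + (d + 1))) * (1 / 2) ^ s * 1) := by
          gcongr
          exact he0 J
      _ = _ := by ring
  set P : Euc n → F := fun y => ∑ l ∈ Finset.range (k + 1),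
    ((l.factorial : ℝ)⁻¹ • D l) (fun _ => y - x) with hP
  set η : ℕ → ℝ := fun J => (∑ i ∈ Finset.range J, e i * 2 ^ i) / 2 ^ J + 2 * e J * 2 ^ k +
    k * (2 * e J * 2 ^ k) + ‖M - ∑ i ∈ Finset.range J, iteratedFDeriv ℝ k (g i) x‖ with hη
  have hη0 : Tendsto η atTop (𝓝 0) := by
    have h4 : Tendsto (fun J => ‖M - ∑ i ∈ Finset.range J, iteratedFDeriv ℝ k (g i) x‖)
        atTop (𝓝 0) := by
      simpa using (hc.const_sub M).norm
    have := (((tendsto_dyadic_average he).add ((he.const_mul 2).mul_const (2 ^ k))).add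
      (((he.const_mul 2).mul_const (2 ^ k)).const_mul (k : ℝ))).add h4
    simpa [hη] using this
  have hfact : ∀ l : ℕ, ‖((l.factorial : ℝ))⁻¹‖ ≤ 1 := fun l => by
    rw [norm_inv, Real.norm_natCast]
    exact inv_le_one_of_one_le₀ (by exact_mod_cast Nat.factorial_pos l)
  have hop : ∀ (l : ℕ) (T : ContinuousMultilinearMap ℝ (fun _ : Fin l => Euc n) F) (h : Euc n),
      ‖((l.factorial : ℝ))⁻¹ • T (fun _ => h)‖ ≤ ‖T‖ * ‖h‖ ^ l := fun l T h => by
    rw [norm_smul]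
    have h3 := T.le_opNorm (fun _ => h)
    simp only [Finset.prod_const, Finset.card_univ, Fintype.card_fin] at h3
    calc _ ≤ 1 * (‖T‖ * ‖h‖ ^ l) := by
          gcongr
          exact hfact l
      _ = _ := one_mul _
  have key : ∀ J y, (1 / 2) ^ (J + 1) < ‖y - x‖ → ‖y - x‖ ≤ (1 / 2) ^ J →
      ‖f y - P y‖ ≤ η J * ‖y - x‖ ^ k := by
    intro J y hy1 hy2
    set h := y - x with hh
    have hJh : (1 / 2 : ℝ) ^ J ≤ 2 * ‖h‖ := by
      rw [pow_succ] at hy1; linarith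
    have hfy : f y = ∑ i ∈ Finset.range J, g i y + ∑' s, g (J + s) y := by
      rw [hf y (hy2.trans (pow_le_one₀ (by norm_num) (by norm_num)))]
      have h1 := (htail0 y J hy2).1
      have h2 : Summable fun i => g i y := by
        rw [← summable_nat_add_iff J]
        simpa only [add_comm] using h1
      rw [← h2.sum_add_tsum_nat_add J]
      simp only [add_comm J]
    have hPy : P y = ∑ l ∈ Finset.range k, (∑ i ∈ Finset.range J,
        ((l.factorial : ℝ))⁻¹ • iteratedFDeriv ℝ l (g i) x (fun _ => h) +
          ((l.factorial : ℝ))⁻¹ • (∑' s, iteratedFDeriv ℝ l (g (J + s)) x) (fun _ => h)) +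
        (∑ i ∈ Finset.range J, ((k.factorial : ℝ))⁻¹ • iteratedFDeriv ℝ k (g i) x (fun _ => h) +
          ((k.factorial : ℝ))⁻¹ • (M - ∑ i ∈ Finset.range J, iteratedFDeriv ℝ k (g i) x)
            (fun _ => h)) := by
      rw [hP]
      simp only
      rw [Finset.sum_range_succ]
      congr 1
      · refine Finset.sum_congr rfl fun l hl => ?_
        have hl' := Finset.mem_range.1 hl
        have h1 := (htail l hl' J).1
        have h2 : Summable fun i => iteratedFDeriv ℝ l (g i) x := by
          rw [← summable_nat_add_iff J]
          simpa only [add_comm] using h1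
        rw [hDl l hl', ← h2.sum_add_tsum_nat_add J]
        simp only [add_comm J, smul_apply,
          add_apply, sum_apply, smul_add,
          Finset.smul_sum]
        rfl
      · rw [hDk]
        simp only [smul_apply,
          sub_apply, sum_apply, smul_sub,
          Finset.smul_sum]
        rw [add_sub_cancel]
    have hsplit : f y - P y = ∑ i ∈ Finset.range J, (g i y - ∑ l ∈ Finset.range (k + 1),
        ((l.factorial : ℝ))⁻¹ • iteratedFDeriv ℝ l (g i) x (fun _ => h)) + ∑' s, g (J + s) y -
        (∑ l ∈ Finset.range k,
          ((l.factorial : ℝ))⁻¹ • (∑' s, iteratedFDeriv ℝ l (g (J + s)) x) (fun _ => h)) -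
        ((k.factorial : ℝ))⁻¹ • (M - ∑ i ∈ Finset.range J, iteratedFDeriv ℝ k (g i) x)
            (fun _ => h) := by
      rw [hfy, hPy, Finset.sum_add_distrib, Finset.sum_sub_distrib]
      simp only [Finset.sum_range_succ _ k, Finset.sum_add_distrib]
      rw [Finset.sum_comm (s := Finset.range k)]
      abel
    have b1 : ‖∑ i ∈ Finset.range J, (g i y - ∑ l ∈ Finset.range (k + 1),
        ((l.factorial : ℝ))⁻¹ • iteratedFDeriv ℝ l (g i) x (fun _ => h))‖ ≤
        (∑ i ∈ Finset.range J, e i * 2 ^ i) / 2 ^ J * ‖h‖ ^ k := by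
      refine (norm_sum_le _ _).trans ?_
      rw [Finset.sum_div, Finset.sum_mul]
      refine Finset.sum_le_sum fun i hi => ?_
      have hi' := Finset.mem_range.1 hi
      refine (norm_taylor_remainder_le (hg i) k (B := e i * 2 ^ i) fun z hz => ?_).trans ?_
      · refine (ha i z (hz.trans (hy2.trans ?_)) (k + 1) le_rfl).trans (le_of_eq ?_)
        · exact pow_le_pow_of_le_one (by norm_num) (by norm_num) hi'.le
        · field_simp
          ring
      · have h5 : ‖h‖ ≤ 1 / 2 ^ J := by simpa using hy2
        calc e i * 2 ^ i * ‖h‖ ^ (k + 1) = e i * 2 ^ i * ‖h‖ * ‖h‖ ^ k := by ring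
          _ ≤ e i * 2 ^ i * (1 / 2 ^ J) * ‖h‖ ^ k := by
            have := he0 i
            gcongr
          _ = _ := by ring
    have b2 : ‖∑' s, g (J + s) y‖ ≤ 2 * e J * 2 ^ k * ‖h‖ ^ k := by
      refine (htail0 y J hy2).2.trans ?_
      rw [pow_mul]
      calc 2 * (e J * ((1 / 2) ^ J) ^ k) ≤ 2 * (e J * (2 * ‖h‖) ^ k) := by
            have := he0 J
            gcongr
        _ = _ := by rw [mul_pow]; ring
    have b3 : ‖∑ l ∈ Finset.range k,
          ((l.factorial : ℝ))⁻¹ • (∑' s, iteratedFDeriv ℝ l (g (J + s)) x) (fun _ => h)‖ ≤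
        k * (2 * e J * 2 ^ k) * ‖h‖ ^ k := by
      refine (norm_sum_le _ _).trans ?_
      refine (Finset.sum_le_sum (g := fun _ => 2 * e J * 2 ^ k * ‖h‖ ^ k) fun l hl => ?_).trans
        (le_of_eq ?_)
      · have hl' := Finset.mem_range.1 hl
        refine (hop l _ h).trans ?_
        calc _ ≤ 2 * (e J * (1 / 2) ^ (J * (k - l))) * ‖h‖ ^ l := by
              gcongr
              exact (htail l hl' J).2
          _ ≤ 2 * (e J * (2 * ‖h‖) ^ (k - l)) * ‖h‖ ^ l := by
              rw [pow_mul]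
              have := he0 J
              gcongr
          _ = 2 * e J * 2 ^ (k - l) * ‖h‖ ^ (k - l + l) := by rw [mul_pow]; ring
          _ ≤ 2 * e J * 2 ^ k * ‖h‖ ^ (k - l + l) := by
              have := he0 J
              gcongr
              · exact one_le_two
              · omega
          _ = _ := by rw [Nat.sub_add_cancel hl'.le]
      · simp
        ring
    have b4 := hop k (M - ∑ i ∈ Finset.range J, iteratedFDeriv ℝ k (g i) x) h
    rw [hsplit]
    refine (norm_sub_le _ _).trans ?_
    refine (add_le_add ((norm_sub_le _ _).trans (add_le_add ((norm_add_le _ _).trans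
      (add_le_add b1 b2)) b3)) b4).trans (le_of_eq ?_)
    simp only [hη]
    ring
  refine ⟨P, polynomial_contDiff_and_iteratedFDeriv_eq_zero k
    (fun l => (l.factorial : ℝ)⁻¹ • D l) x, ?_⟩
  rw [isLittleO_iff]
  intro c hc0
  obtain ⟨J0, hJ0⟩ := (hη0.eventually (ge_mem_nhds hc0)).exists_forall_of_atTop
  filter_upwards [ball_mem_nhds x (show (0 : ℝ) < (1 / 2) ^ J0 by positivity)] with y hy
  rw [norm_pow, norm_norm]
  rw [mem_ball, dist_eq_norm] at hy
  rcases eq_or_ne y x with rfl | hyx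
  · have hP0 : P y = f y := by
      rw [hP, hf y (by simp)]
      simp only [sub_self]
      rw [Finset.sum_range_succ', Finset.sum_eq_zero]
      · have h1 := (htail 0 (by omega) 0).1
        simp only [zero_add] at h1
        simp only [Nat.factorial_zero, Nat.cast_one, inv_one, one_smul, hDl 0 (by omega)]
        rw [ContinuousMultilinearMap.tsum_eval h1]
        simp
      · intro l _
        exact ContinuousMultilinearMap.map_coord_zero _ (0 : Fin (l + 1)) rfl
    rw [hP0, sub_self, norm_zero]
    positivity
  · have hpos : 0 < ‖y - x‖ := norm_pos_iff.2 (sub_ne_zero.2 hyx)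
    obtain ⟨J, hJ1, hJ2⟩ := exists_nat_pow_near_of_lt_one hpos
      (hy.le.trans (pow_le_one₀ (by norm_num) (by norm_num))) (show (0 : ℝ) < 1 / 2 by norm_num)
      (by norm_num)
    have hJ : J0 ≤ J := by
      by_contra hcon
      have : (1 / 2 : ℝ) ^ J0 ≤ (1 / 2) ^ (J + 1) :=
        pow_le_pow_of_le_one (by norm_num) (by norm_num) (by omega)
      linarith
    refine (key J y hJ1 hJ2).trans ?_
    gcongr
    exact hJ0 J hJ

end DyadicTaylor

section KernelAverage

variable {n : ℕ}

/-- The kernel `2^{in} (1 + 2^i |x - z|)^{-n-1}`. -/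
def dyadicKernel (n i : ℕ) (x z : Euc n) : ℝ :=
  2 ^ (i * n) / (1 + 2 ^ i * ‖x - z‖) ^ (n + 1)

theorem continuous_dyadicKernel (i : ℕ) (x : Euc n) : Continuous (dyadicKernel n i x) := by
  unfold dyadicKernel
  refine Continuous.div (by fun_prop) (by fun_prop) fun z => ?_
  positivity

theorem dyadicKernel_le_of_near {J i : ℕ} (hJ : J ≤ i) {x y : Euc n} (hy : ‖y - x‖ ≤ (1 / 2) ^ J)
    (z : Euc n) : 1 / (1 + 2 ^ i * ‖y - z‖) ^ (n + 1) ≤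
      2 ^ (n + 1) / 2 ^ (J * n) * dyadicKernel n J x z := by
  unfold dyadicKernel
  have h1 : (1 + 2 ^ J * ‖x - z‖) / 2 ≤ 1 + 2 ^ i * ‖y - z‖ := by
    have h2 : ‖x - z‖ ≤ ‖y - x‖ + ‖y - z‖ := by
      have := norm_sub_le (y - z) (y - x)
      rw [sub_sub_sub_cancel_left] at this
      linarith
    have h3 : (2 : ℝ) ^ J * ‖y - z‖ ≤ 2 ^ i * ‖y - z‖ := by
      gcongr
      exact one_le_two
    have h4 : (2 : ℝ) ^ J * ‖x - z‖ ≤ 1 + 2 ^ J * ‖y - z‖ := by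
      calc _ ≤ (2 : ℝ) ^ J * ((1 / 2) ^ J + ‖y - z‖) := by
            gcongr
            linarith
        _ = _ := by rw [mul_add, ← mul_pow]; norm_num
    have h5 : 0 ≤ (2 : ℝ) ^ J * ‖y - z‖ := by positivity
    linarith
  calc _ ≤ 1 / ((1 + 2 ^ J * ‖x - z‖) / 2) ^ (n + 1) := by gcongr
    _ = _ := by
      rw [div_pow]
      field_simp

theorem dyadicKernel_le_tsum (i : ℕ) (x z : Euc n) :
    ENNReal.ofReal (dyadicKernel n i x z) ≤
      ∑' s : ℕ, (ball x (2 ^ s / 2 ^ i)).indicator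
        (fun _ => ENNReal.ofReal (2 ^ (n + 1) * 2 ^ (i * n) * (1 / 2) ^ (s * (n + 1)))) z := by
  have hex : ∃ s : ℕ, 2 ^ i * ‖x - z‖ < 2 ^ s :=
    pow_unbounded_of_one_lt _ one_lt_two
  classical
  set s := Nat.find hex with hs
  have hs1 : 2 ^ i * ‖x - z‖ < 2 ^ s := Nat.find_spec hex
  refine le_trans ?_ (ENNReal.le_tsum s)
  have hmem : z ∈ ball x (2 ^ s / 2 ^ i) := by
    rw [mem_ball, dist_comm, dist_eq_norm, lt_div_iff₀ (by positivity), mul_comm]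
    exact hs1
  rw [Set.indicator_of_mem hmem]
  refine ENNReal.ofReal_le_ofReal ?_
  unfold dyadicKernel
  have h2 : (2 : ℝ) ^ s / 2 ≤ 1 + 2 ^ i * ‖x - z‖ := by
    rcases Nat.eq_zero_or_pos s with h0 | h0
    · rw [h0]
      have : 0 ≤ 2 ^ i * ‖x - z‖ := by positivity
      norm_num
      linarith
    · have := Nat.find_min hex (m := s - 1) (by omega)
      rw [not_lt] at this
      have h3 : (2 : ℝ) ^ s = 2 ^ (s - 1) * 2 := by
        rw [← pow_succ, Nat.sub_add_cancel h0]
      rw [h3]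
      linarith
  calc _ ≤ (2 : ℝ) ^ (i * n) / (2 ^ s / 2) ^ (n + 1) := by gcongr
    _ = _ := by
      rw [div_pow, one_div, inv_pow, pow_mul 2 s]
      field_simp

theorem lintegral_dyadicKernel_le (τ : Measure (Euc n)) (x : Euc n) {ω : ℝ → ℝ} {M : ℝ}
    (hω0 : ∀ r, 0 < r → 0 ≤ ω r) (hωM : ∀ r, 0 < r → ω r ≤ M)
    (hτ : ∀ r, 0 < r → τ (ball x r) ≤ ENNReal.ofReal (ω r * r ^ n)) (i : ℕ) :
    ∫⁻ z, ENNReal.ofReal (dyadicKernel n i x z) ∂τ ≤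
      ENNReal.ofReal (∑' s : ℕ, 2 ^ (n + 1) * (ω (2 ^ s / 2 ^ i) * (1 / 2) ^ s)) := by
  have hpos : ∀ s : ℕ, (0 : ℝ) < 2 ^ s / 2 ^ i := fun s => by positivity
  refine (lintegral_mono (dyadicKernel_le_tsum i x)).trans ?_
  rw [lintegral_tsum fun s => (measurable_const.indicator measurableSet_ball).aemeasurable,
    ENNReal.ofReal_tsum_of_nonneg]
  · refine ENNReal.tsum_le_tsum fun s => ?_
    rw [lintegral_indicator_const measurableSet_ball]
    refine (mul_le_mul_right (hτ _ (hpos s)) _).trans ?_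
    rw [← ENNReal.ofReal_mul (by positivity)]
    refine le_of_eq (congrArg _ ?_)
    simp only [one_div, inv_pow, div_pow, ← pow_mul]
    generalize ω (2 ^ s / 2 ^ i) = w
    field_simp
    ring
  · intro s
    have := hω0 _ (hpos s)
    positivity
  · refine Summable.mul_left _ ?_
    refine Summable.of_nonneg_of_le (fun s => ?_) (fun s => ?_)
      (summable_geometric_two.mul_left M)
    · have := hω0 _ (hpos s)
      positivity
    · have := hωM _ (hpos s)
      gcongr

theorem exists_dyadicKernel_bound (τ : Measure (Euc n)) (x : Euc n)
    (h0 : Tendsto (fun r => τ (ball x r) / ENNReal.ofReal (r ^ n)) (𝓝[>] (0 : ℝ)) (𝓝 0)) {M : ℝ}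
    (hM : ∀ r, 1 ≤ r → τ (ball x r) ≤ ENNReal.ofReal (M * r ^ n)) :
    ∃ e : ℕ → ℝ, Antitone e ∧ (∀ i, 0 ≤ e i) ∧ Tendsto e atTop (𝓝 0) ∧
      ∀ i, ∫⁻ z, ENNReal.ofReal (dyadicKernel n i x z) ∂τ ≤ ENNReal.ofReal (e i) := by
  set ω : ℝ → ℝ := fun r => (τ (ball x r) / ENNReal.ofReal (r ^ n)).toReal with hω
  have hω0 : ∀ r, 0 ≤ ω r := fun r => ENNReal.toReal_nonneg
  have hfin : ∀ r, τ (ball x r) ≠ ⊤ := fun r => by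
    refine ne_top_of_le_ne_top ?_ ((measure_mono (ball_subset_ball (le_max_left r 1))).trans
      (hM _ (le_max_right r 1)))
    exact ENNReal.ofReal_ne_top
  have hτ : ∀ r, 0 < r → τ (ball x r) ≤ ENNReal.ofReal (ω r * r ^ n) := fun r hr => by
    have h1 : ENNReal.ofReal (r ^ n) ≠ 0 := by
      rw [Ne, ENNReal.ofReal_eq_zero, not_le]; positivity
    rw [ENNReal.ofReal_mul (hω0 r), hω, ENNReal.ofReal_toReal,
      ENNReal.div_mul_cancel h1 ENNReal.ofReal_ne_top]
    exact ENNReal.div_ne_top (hfin r) h1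
  have hωlim : Tendsto ω (𝓝[>] (0 : ℝ)) (𝓝 0) := by
    exact (ENNReal.tendsto_toReal ENNReal.zero_ne_top).comp h0
  obtain ⟨M', hM'⟩ : ∃ M', ∀ r, 0 < r → ω r ≤ M' := by
    obtain ⟨δ, hδ, hball⟩ := mem_nhdsGT_iff_exists_Ioc_subset.1
      (hωlim.eventually (ge_mem_nhds one_pos))
    have hδ0 : 0 < δ := hδ
    refine ⟨max 1 (max (max M 0) (max M 0 / δ ^ n)), fun r hr => ?_⟩
    rcases le_or_gt r δ with h1 | h1
    · exact (hball ⟨hr, h1⟩).trans (le_max_left _ _)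
    refine le_trans ?_ (le_max_right _ _)
    have hkey : ∀ C, 0 ≤ C → τ (ball x r) ≤ ENNReal.ofReal (C * r ^ n) → ω r ≤ C := by
      intro C hC hle
      refine ENNReal.toReal_le_of_le_ofReal hC ?_
      refine ENNReal.div_le_of_le_mul ?_
      rwa [← ENNReal.ofReal_mul hC]
    rcases le_or_gt 1 r with h2 | h2
    · refine le_trans (hkey (max M 0) (le_max_right _ _) ((hM r h2).trans ?_)) (le_max_left _ _)
      refine ENNReal.ofReal_le_ofReal ?_
      gcongr
      exact le_max_left _ _
    · refine le_trans (hkey _ (by positivity) ?_) (le_max_right _ _)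
      refine ((measure_mono (ball_subset_ball h2.le)).trans (hM 1 le_rfl)).trans ?_
      refine ENNReal.ofReal_le_ofReal ?_
      have h3 : 1 ≤ r ^ n / δ ^ n := by
        rw [one_le_div (by positivity)]
        gcongr
      calc M * 1 ^ n ≤ max M 0 * 1 := by simp
        _ ≤ max M 0 * (r ^ n / δ ^ n) := by gcongr
        _ = _ := by ring
  have hlim : Tendsto (fun i : ℕ => ∑' s : ℕ, 2 ^ (n + 1) * (ω (2 ^ s / 2 ^ i) * (1 / 2) ^ s))
      atTop (𝓝 0) := by
    have := tendsto_tsum_of_dominated_convergence (𝓕 := atTop)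
      (f := fun (i s : ℕ) => 2 ^ (n + 1) * (ω (2 ^ s / 2 ^ i) * (1 / 2) ^ s))
      (g := fun _ : ℕ => (0 : ℝ)) (bound := fun s => 2 ^ (n + 1) * (M' * (1 / 2) ^ s))
      ((summable_geometric_two.mul_left M').mul_left _) (fun s => ?_) (Eventually.of_forall
        fun i s => ?_)
    · simpa using this
    · have h1 : Tendsto (fun i : ℕ => (2 : ℝ) ^ s / 2 ^ i) atTop (𝓝[>] 0) := by
        refine tendsto_nhdsWithin_iff.2 ⟨?_, Eventually.of_forall fun i => ?_⟩
        · exact tendsto_const_nhds.div_atTop (tendsto_pow_atTop_atTop_of_one_lt one_lt_two)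
        · exact Set.mem_Ioi.2 (by positivity)
      simpa using ((hωlim.comp h1).mul_const ((1 / 2 : ℝ) ^ s)).const_mul (2 ^ (n + 1))
    · have h2 := hω0 (2 ^ s / 2 ^ i)
      have h3 := hM' (2 ^ s / 2 ^ i) (by positivity)
      rw [Real.norm_of_nonneg (by positivity)]
      gcongr
  obtain ⟨e, he1, he2, he3, he4⟩ := exists_antitone_ge_tendsto_zero hlim
  exact ⟨e, he1, he2, he4, fun i => (lintegral_dyadicKernel_le τ x (fun r _ => hω0 r) hM' hτ i).trans
    (ENNReal.ofReal_le_ofReal (he3 i))⟩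

end KernelAverage

section Kernels

variable {n : ℕ}

/-- The rescaled kernel `2^{i(n-k)} κ(2^i x)`. -/
def scaledKernel (k i : ℕ) (κ : 𝓢(Euc n, ℝ)) (x : Euc n) : ℝ :=
  2 ^ (i * n) / 2 ^ (i * k) * κ ((2 : ℝ) ^ i • x)

theorem contDiff_scaledKernel (k i : ℕ) (κ : 𝓢(Euc n, ℝ)) :
    ContDiff ℝ (⊤ : ℕ∞) (scaledKernel k i κ) :=
  contDiff_const.mul ((κ.smooth _).comp (contDiff_const_smul _))

theorem iteratedFDeriv_comp_smul_left {F : Type*} [NormedAddCommGroup F] [NormedSpace ℝ F]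
    {f : Euc n → F} (hf : ContDiff ℝ (⊤ : ℕ∞) f) (c : ℝ) (j : ℕ) (x : Euc n) :
    iteratedFDeriv ℝ j (fun y => f (c • y)) x = c ^ j • iteratedFDeriv ℝ j f (c • x) := by
  have h := (c • ContinuousLinearMap.id ℝ (Euc n)).iteratedFDeriv_comp_right hf x (i := j)
    (mod_cast le_top)
  have h2 : f ∘ (c • ContinuousLinearMap.id ℝ (Euc n)) = fun y => f (c • y) := rfl
  rw [h2] at h
  rw [h]
  ext v
  simp [ContinuousMultilinearMap.map_smul_univ]

theorem iteratedFDeriv_scaledKernel (k i : ℕ) (κ : 𝓢(Euc n, ℝ)) (j : ℕ) (x : Euc n) :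
    iteratedFDeriv ℝ j (scaledKernel k i κ) x =
      (2 ^ (i * n) * 2 ^ (i * j) / 2 ^ (i * k) : ℝ) •
        iteratedFDeriv ℝ j κ ((2 : ℝ) ^ i • x) := by
  have h1 : scaledKernel k i κ = fun y => (2 ^ (i * n) / 2 ^ (i * k) : ℝ) •
      (fun y => κ ((2 : ℝ) ^ i • y)) y := rfl
  have h2 : ContDiffAt ℝ j (fun y => κ ((2 : ℝ) ^ i • y)) x :=
    ((κ.smooth _).comp (contDiff_const_smul _)).contDiffAt
  rw [h1, iteratedFDeriv_const_smul_apply' h2, iteratedFDeriv_comp_smul_left (κ.smooth _), smul_smul,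
    ← pow_mul]
  congr 1
  ring

theorem exists_schwartz_bound {F : Type*} [NormedAddCommGroup F] [NormedSpace ℝ F]
    (κ : 𝓢(Euc n, F)) (j N : ℕ) : ∃ C : ℝ, 0 ≤ C ∧
    ∀ x, ‖iteratedFDeriv ℝ j κ x‖ ≤ C / (1 + ‖x‖) ^ N := by
  refine ⟨2 ^ N * (Finset.Iic (N, j)).sup (fun m => SchwartzMap.seminorm ℝ m.1 m.2) κ,
    by positivity, fun x => ?_⟩
  have := SchwartzMap.one_add_le_sup_seminorm_apply (𝕜 := ℝ) (m := (N, j)) le_rfl le_rfl κ x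
  rw [le_div_iff₀ (by positivity), mul_comm]
  exact this

theorem exists_scaledKernel_bound (k : ℕ) (κ : 𝓢(Euc n, ℝ)) (j N : ℕ) : ∃ C : ℝ, 0 ≤ C ∧
    ∀ i x, ‖iteratedFDeriv ℝ j (scaledKernel k i κ) x‖ ≤
      C * (2 ^ (i * n) * 2 ^ (i * j) / 2 ^ (i * k)) / (1 + 2 ^ i * ‖x‖) ^ N := by
  obtain ⟨C, hC, h⟩ := exists_schwartz_bound κ j N
  refine ⟨C, hC, fun i x => ?_⟩
  rw [iteratedFDeriv_scaledKernel, norm_smul, Real.norm_of_nonneg (by positivity)]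
  have h1 := h ((2 : ℝ) ^ i • x)
  rw [norm_smul, Real.norm_of_nonneg (by positivity)] at h1
  calc _ ≤ (2 ^ (i * n) * 2 ^ (i * j) / 2 ^ (i * k) : ℝ) * (C / (1 + 2 ^ i * ‖x‖) ^ N) := by gcongr
    _ = _ := by ring

theorem exists_iteratedFDeriv_bound {χ : Euc n → ℝ} (hχ : IsTestFun n χ) (j : ℕ) : ∃ C : ℝ, 0 ≤ C ∧
    ∀ a ≤ j, ∀ x, ‖iteratedFDeriv ℝ a χ x‖ ≤ C := by
  have h : ∀ a : ℕ, ∃ C, ∀ x, ‖iteratedFDeriv ℝ a χ x‖ ≤ C := fun a =>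
    (hχ.2.iteratedFDeriv (𝕜 := ℝ) a).exists_bound_of_continuous
      (hχ.1.continuous_iteratedFDeriv (mod_cast le_top))
  choose C hC using h
  refine ⟨∑ a ∈ Finset.range (j + 1), |C a|, by positivity, fun a ha x => ?_⟩
  refine (hC a x).trans ((le_abs_self _).trans ?_)
  exact Finset.single_le_sum (f := fun a => |C a|) (fun _ _ => abs_nonneg _)
    (Finset.mem_range.2 (by omega))

theorem norm_iteratedFDeriv_mul_le_of_bound {f g : Euc n → ℝ} (hf : ContDiff ℝ (⊤ : ℕ∞) f)
    (hg : ContDiff ℝ (⊤ : ℕ∞) g) (j : ℕ) (x : Euc n) {A B : ℝ} (hA : 0 ≤ A)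
    (h1 : ∀ a ≤ j, ‖iteratedFDeriv ℝ a f x‖ ≤ A) (h2 : ∀ a ≤ j, ‖iteratedFDeriv ℝ a g x‖ ≤ B) :
    ‖iteratedFDeriv ℝ j (fun y => f y * g y) x‖ ≤ 2 ^ j * A * B := by
  refine (norm_iteratedFDeriv_mul_le hf hg x (n := j) (mod_cast le_top)).trans ?_
  calc _ ≤ ∑ i ∈ Finset.range (j + 1), (j.choose i : ℝ) * A * B := by
        refine Finset.sum_le_sum fun a ha => ?_
        have := Finset.mem_range.1 ha
        gcongr
        · exact h1 a (by omega)
        · exact h2 _ (by omega)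
    _ = _ := by
        rw [← Finset.sum_mul, ← Finset.sum_mul]
        congr 2
        exact_mod_cast Nat.sum_range_choose j

theorem exists_cutoff_scaledKernel_bound (k : ℕ) (κ : 𝓢(Euc n, ℝ)) {χ : Euc n → ℝ}
    (hχ : IsTestFun n χ) (j N : ℕ) : ∃ C : ℝ, 0 ≤ C ∧
    ∀ i x, ‖iteratedFDeriv ℝ j (fun y => χ y * scaledKernel k i κ y) x‖ ≤
      C * (2 ^ (i * n) * 2 ^ (i * j) / 2 ^ (i * k)) / (1 + 2 ^ i * ‖x‖) ^ N := by
  obtain ⟨A, hA0, hA⟩ := exists_iteratedFDeriv_bound hχ j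
  choose C hC0 hC using fun a => exists_scaledKernel_bound k κ a N
  refine ⟨2 ^ j * A * ∑ a ∈ Finset.range (j + 1), C a,
    mul_nonneg (by positivity) (Finset.sum_nonneg fun (a : ℕ) _ => hC0 a), fun i x => ?_⟩
  refine (norm_iteratedFDeriv_mul_le_of_bound hχ.1 (contDiff_scaledKernel k i κ) j x hA0
    (fun a ha => hA a ha x) (B := (∑ a ∈ Finset.range (j + 1), C a) *
      (2 ^ (i * n) * 2 ^ (i * j) / 2 ^ (i * k)) / (1 + 2 ^ i * ‖x‖) ^ N) fun a ha => ?_).trans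
    (le_of_eq (by ring))
  refine (hC a i x).trans ?_
  have h1 : C a ≤ ∑ a ∈ Finset.range (j + 1), C a :=
    Finset.single_le_sum (f := C) (fun a _ => hC0 a) (Finset.mem_range.2 (by omega))
  have h0 := hC0 a
  have h5 := h0.trans h1
  gcongr
  exact one_le_two

theorem exists_cutoff_compl_scaledKernel_bound (k : ℕ) (κ : 𝓢(Euc n, ℝ)) {χ : Euc n → ℝ}
    (hχ : IsTestFun n χ) (hχ1 : ∀ x, ‖x‖ < 1 / 2 → χ x = 1) (j : ℕ) : ∃ C : ℝ, 0 ≤ C ∧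
    ∀ i x, ‖iteratedFDeriv ℝ j (fun y => (1 - χ y) * scaledKernel k i κ y) x‖ ≤
      C * (1 / 2) ^ i := by
  obtain ⟨A, hA0, hA⟩ := exists_iteratedFDeriv_bound hχ j
  choose C hC0 hC using fun a => exists_scaledKernel_bound k κ a (n + j + 1)
  have hsm : ContDiff ℝ (⊤ : ℕ∞) (fun y => 1 - χ y) := contDiff_const.sub hχ.1
  have hA' : ∀ a ≤ j, ∀ x, ‖iteratedFDeriv ℝ a (fun y => 1 - χ y) x‖ ≤ 1 + A := by
    intro a ha x
    rw [fun_iteratedFDeriv_sub_apply contDiff_const.contDiffAt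
      (hχ.1.of_le (mod_cast le_top)).contDiffAt]
    refine (norm_sub_le _ _).trans (add_le_add ?_ (hA a ha x))
    rcases Nat.eq_zero_or_pos a with rfl | h0
    · simp
    · rw [iteratedFDeriv_const_of_ne h0.ne']; simp
  refine ⟨2 ^ j * (1 + A) * ((∑ a ∈ Finset.range (j + 1), C a) * 2 ^ (n + j + 1)),
    mul_nonneg (by positivity) (mul_nonneg (Finset.sum_nonneg fun a _ => hC0 a) (by positivity)), fun i x => ?_⟩
  rcases lt_or_ge ‖x‖ (1 / 2) with hx | hx
  · have hz : (fun y => (1 - χ y) * scaledKernel k i κ y) =ᶠ[𝓝 x] fun _ => 0 := by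
      have : {y : Euc n | ‖y‖ < 1 / 2} ∈ 𝓝 x :=
        (isOpen_lt continuous_norm continuous_const).mem_nhds hx
      filter_upwards [this] with y hy
      rw [hχ1 y hy, sub_self, zero_mul]
    rw [(hz.iteratedFDeriv ℝ j).eq_of_nhds]
    have := Finset.sum_nonneg fun a (_ : a ∈ Finset.range (j + 1)) => hC0 a
    simp only [iteratedFDeriv_fun_zero, Pi.zero_apply, norm_zero]
    positivity
  refine (norm_iteratedFDeriv_mul_le_of_bound hsm (contDiff_scaledKernel k i κ) j x
    (by positivity) (fun a ha => hA' a ha x) (B := (∑ a ∈ Finset.range (j + 1), C a) *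
      2 ^ (n + j + 1) * (1 / 2) ^ i) fun a ha => ?_).trans
    (le_of_eq (by ring))
  refine (hC a i x).trans ?_
  have h1 : C a ≤ ∑ a ∈ Finset.range (j + 1), C a :=
    Finset.single_le_sum (f := C) (fun a _ => hC0 a) (Finset.mem_range.2 (by omega))
  have h0 := hC0 a
  have h2 : (2 : ℝ) ^ i / 2 ≤ 1 + 2 ^ i * ‖x‖ := by
    have : (2 : ℝ) ^ i * (1 / 2) ≤ 2 ^ i * ‖x‖ := by gcongr
    linarith
  have h3 : (2 ^ (i * n) * 2 ^ (i * a) / 2 ^ (i * k) : ℝ) ≤ 2 ^ (i * n) * 2 ^ (i * j) := by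
    refine (div_le_self (by positivity) (one_le_pow₀ one_le_two)).trans ?_
    gcongr
    exact one_le_two
  have h4 := h0.trans h1
  calc _ ≤ (∑ a ∈ Finset.range (j + 1), C a) * (2 ^ (i * n) * 2 ^ (i * j)) /
        ((2 : ℝ) ^ i / 2) ^ (n + j + 1) := by gcongr
    _ = _ := by
      rw [div_pow, pow_mul 2 i n, pow_mul 2 i j]
      simp only [one_div, inv_pow]
      field_simp
      ring

end Kernels

section TestFunctions

variable {n : ℕ} {F : Type*} [NormedAddCommGroup F] [NormedSpace ℝ F]

theorem IsTestFun.iteratedFDeriv {g : Euc n → F} (hg : IsTestFun n g) (j : ℕ) :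
    IsTestFun n (iteratedFDeriv ℝ j g) :=
  ⟨hg.1.iteratedFDeriv_right (mod_cast le_top), hg.2.iteratedFDeriv j⟩

theorem ContDiff.dirDeriv {g : Euc n → F} (hg : ContDiff ℝ (⊤ : ℕ∞) g) {m : ℕ}
    (I : Fin m → Fin n) : ContDiff ℝ (⊤ : ℕ∞) (dirDeriv n m I g) :=
  (ContinuousMultilinearMap.apply ℝ (fun _ : Fin m => Euc n) F
    (fun i => stdVec n (I i))).contDiff.comp (hg.iteratedFDeriv_right (mod_cast le_top))

theorem IsTestFun.dirDeriv {g : Euc n → F} (hg : IsTestFun n g) {m : ℕ} (I : Fin m → Fin n) :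
    IsTestFun n (dirDeriv n m I g) :=
  ⟨ContDiff.dirDeriv hg.1 I, (hg.2.iteratedFDeriv m).comp_left
    (g := fun T : ContinuousMultilinearMap ℝ (fun _ : Fin m => Euc n) F =>
      T (fun i => stdVec n (I i))) rfl⟩

theorem norm_stdVec (i : Fin n) : ‖stdVec n i‖ = 1 := by
  simp [stdVec]

theorem norm_dirDeriv_le {g : Euc n → F} {m : ℕ} (I : Fin m → Fin n) (x : Euc n) :
    ‖_root_.dirDeriv n m I g x‖ ≤ ‖iteratedFDeriv ℝ m g x‖ := by
  refine ((iteratedFDeriv ℝ m g x).le_opNorm _).trans ?_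
  simp [norm_stdVec]

end TestFunctions

section MeasureConvolution

variable {n : ℕ} {F : Type*} [NormedAddCommGroup F] [NormedSpace ℝ F]

/-- The convolution of the measure `ρ μ` with `g`. -/
def mconv (μ : Measure (Euc n)) (ρ : Euc n → ℝ) (g : Euc n → F) (y : Euc n) : F :=
  ∫ z, ρ z • g (y - z) ∂μ

theorem mconv_integrable {μ : Measure (Euc n)} {ρ : Euc n → ℝ} (hρ : LocallyIntegrable ρ μ)
    {g : Euc n → F} (hg : Continuous g) (hgs : HasCompactSupport g) (y : Euc n) :
    Integrable (fun z => ρ z • g (y - z)) μ :=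
  hgs.convolutionExists_right (ContinuousLinearMap.lsmul ℝ ℝ) hρ hg y

theorem contDiff_mconv {μ : Measure (Euc n)} {ρ : Euc n → ℝ} (hρ : LocallyIntegrable ρ μ)
    {g : Euc n → F} (hg : IsTestFun n g) : ContDiff ℝ (⊤ : ℕ∞) (mconv μ ρ g) :=
  hg.2.contDiff_convolution_right (ContinuousLinearMap.lsmul ℝ ℝ) hρ hg.1

theorem hasFDerivAt_mconv {μ : Measure (Euc n)} {ρ : Euc n → ℝ} (hρ : LocallyIntegrable ρ μ)
    {g : Euc n → F} (hg : ContDiff ℝ 1 g) (hgs : HasCompactSupport g) (y : Euc n) :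
    HasFDerivAt (mconv μ ρ g) (mconv μ ρ (fderiv ℝ g) y) y := by
  have hg' : Continuous (fderiv ℝ g) := hg.continuous_fderiv one_ne_zero
  have h3 : ∀ x t, HasFDerivAt (fun x => g (x - t)) (fderiv ℝ g (x - t)) x := fun x t ↦ by
    simpa using!
      (hg.differentiable one_ne_zero).differentiableAt.hasFDerivAt.comp x
        ((hasFDerivAt_id x).sub (hasFDerivAt_const t x))
  obtain ⟨C, hC⟩ := (hgs.fderiv ℝ).exists_bound_of_continuous hg'
  set K : Set (Euc n) := -tsupport (fderiv ℝ g) + closedBall y 1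
  have hK : IsCompact K := (hgs.fderiv ℝ).isCompact.neg.add (isCompact_closedBall y 1)
  refine hasFDerivAt_integral_of_dominated_of_fderiv_le (ball_mem_nhds y zero_lt_one)
    (F' := fun x t => ρ t • fderiv ℝ g (x - t))
    (bound := K.indicator fun t => ‖ρ t‖ * C) ?_ (mconv_integrable hρ hg.continuous hgs y)
    (mconv_integrable hρ hg' (hgs.fderiv ℝ) y).aestronglyMeasurable ?_ ?_ ?_
  · exact Eventually.of_forall fun x =>
      (mconv_integrable hρ hg.continuous hgs x).aestronglyMeasurable
  · refine Eventually.of_forall fun t x hx => ?_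
    by_cases ht : t ∈ K
    · rw [Set.indicator_of_mem ht, norm_smul]
      gcongr
      exact hC _
    · have h0 : fderiv ℝ g (x - t) = 0 := by
        refine image_eq_zero_of_notMem_tsupport fun hmem => ht ?_
        exact ⟨-(x - t), Set.neg_mem_neg.2 hmem, x, ball_subset_closedBall hx, by simp⟩
      rw [Set.indicator_of_notMem ht, h0, smul_zero, norm_zero]
  · rw [integrable_indicator_iff hK.measurableSet]
    exact (hρ.integrableOn_isCompact hK).norm.mul_const _
  · exact Eventually.of_forall fun t x _ => (h3 x t).const_smul (ρ t)

theorem iteratedFDeriv_mconv [CompleteSpace F] {μ : Measure (Euc n)} {ρ : Euc n → ℝ}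
    (hρ : LocallyIntegrable ρ μ)
    {g : Euc n → F} (hg : IsTestFun n g) (j : ℕ) :
    iteratedFDeriv ℝ j (mconv μ ρ g) = mconv μ ρ (iteratedFDeriv ℝ j g) := by
  induction j with
  | zero =>
    ext y v
    rw [iteratedFDeriv_zero_apply, mconv, mconv, ← ContinuousMultilinearMap.apply_apply (𝕜 := ℝ),
      ← ContinuousLinearMap.integral_comp_comm]
    · simp
    · exact mconv_integrable hρ (hg.iteratedFDeriv 0).1.continuous (hg.iteratedFDeriv 0).2 y
  | succ j ih =>
    have hj := hg.iteratedFDeriv j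
    ext1 y
    rw [iteratedFDeriv_succ_eq_comp_left, Function.comp_apply, ih]
    rw [(hasFDerivAt_mconv hρ (hj.1.of_le (mod_cast le_top)) hj.2 y).fderiv, mconv, mconv]
    simp only [iteratedFDeriv_succ_eq_comp_left, Function.comp_apply]
    have h4 := ContinuousLinearEquiv.integral_comp_comm (μ := μ) (𝕜 := ℝ)
      ((continuousMultilinearCurryLeftEquiv ℝ (fun _ : Fin (j + 1) => Euc n)
        F).symm.toContinuousLinearEquiv) fun z => ρ z • fderiv ℝ (iteratedFDeriv ℝ j g) (y - z)
    refine Eq.trans h4.symm (integral_congr_ae (Eventually.of_forall fun z => ?_))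
    simp only [map_smul]
    rfl

theorem dirDeriv_mconv [CompleteSpace F] {μ : Measure (Euc n)} {ρ : Euc n → ℝ}
    (hρ : LocallyIntegrable ρ μ) {g : Euc n → F} (hg : IsTestFun n g) {m : ℕ} (I : Fin m → Fin n) :
    dirDeriv n m I (mconv μ ρ g) = mconv μ ρ (dirDeriv n m I g) := by
  ext1 y
  rw [dirDeriv, iteratedFDeriv_mconv hρ hg, mconv, mconv,
    ← ContinuousMultilinearMap.apply_apply (𝕜 := ℝ), ← ContinuousLinearMap.integral_comp_comm]
  · simp [dirDeriv]
  · exact mconv_integrable hρ (hg.iteratedFDeriv m).1.continuous (hg.iteratedFDeriv m).2 y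

theorem enorm_mconv_le {μ : Measure (Euc n)} {ρ : Euc n → ℝ} (hρ : AEStronglyMeasurable ρ μ)
    (g : Euc n → F) (y : Euc n) :
    ‖mconv μ ρ g y‖ₑ ≤ ∫⁻ z, ‖g (y - z)‖ₑ ∂(μ.withDensity fun z => ‖ρ z‖ₑ) := by
  rw [lintegral_withDensity_eq_lintegral_mul_non_measurable₀ _ hρ.enorm
    (Eventually.of_forall fun z => enorm_lt_top)]
  refine (enorm_integral_le_lintegral_enorm _).trans (le_of_eq ?_)
  simp [enorm_smul]

end MeasureConvolution

section IteratedDerivatives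

variable {n : ℕ} {F : Type*} [NormedAddCommGroup F] [NormedSpace ℝ F]

theorem norm_iteratedFDeriv_iteratedFDeriv (g : Euc n → F) (j m : ℕ) (x : Euc n) :
    ‖iteratedFDeriv ℝ j (iteratedFDeriv ℝ m g) x‖ = ‖iteratedFDeriv ℝ (m + j) g x‖ := by
  induction m generalizing j with
  | zero =>
    rw [iteratedFDeriv_zero_eq_comp, LinearIsometryEquiv.norm_iteratedFDeriv_comp_left, zero_add]
  | succ m ih =>
    have h1 := LinearIsometryEquiv.norm_iteratedFDeriv_comp_left (𝕜 := ℝ)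
      (continuousMultilinearCurryLeftEquiv ℝ (fun _ : Fin (m + 1) => Euc n) F).symm
      (fderiv ℝ (iteratedFDeriv ℝ m g)) x j
    rw [iteratedFDeriv_succ_eq_comp_left]
    refine h1.trans ?_
    rw [norm_iteratedFDeriv_fderiv, ih, add_right_comm, add_assoc]

theorem norm_iteratedFDeriv_dirDeriv_le {g : Euc n → F} (hg : ContDiff ℝ (⊤ : ℕ∞) g) (j : ℕ)
    {m : ℕ} (I : Fin m → Fin n) (x : Euc n) :
    ‖iteratedFDeriv ℝ j (dirDeriv n m I g) x‖ ≤ ‖iteratedFDeriv ℝ (m + j) g x‖ := by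
  rw [← norm_iteratedFDeriv_iteratedFDeriv]
  have h1 : ContDiffAt ℝ j (iteratedFDeriv ℝ m g) x :=
    (hg.iteratedFDeriv_right (m := j) (mod_cast le_top)).contDiffAt
  have h2 := ContinuousLinearMap.norm_iteratedFDeriv_comp_left
    (ContinuousMultilinearMap.apply ℝ (fun _ : Fin m => Euc n) F (fun i => stdVec n (I i))) h1 le_rfl
  refine h2.trans (mul_le_of_le_one_left (norm_nonneg _) ?_)
  refine ContinuousLinearMap.opNorm_le_bound _ zero_le_one fun T => ?_
  refine (T.le_opNorm _).trans ?_
  simp [norm_stdVec]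

theorem dirDeriv_zero (g : Euc n → F) (I : Fin 0 → Fin n) : dirDeriv n 0 I g = g := by
  ext x; simp [dirDeriv]

theorem dirDeriv_succ {g : Euc n → F} (hg : ContDiff ℝ (⊤ : ℕ∞) g) {m : ℕ}
    (I : Fin (m + 1) → Fin n) :
    dirDeriv n (m + 1) I g =
      fun x => fderiv ℝ (dirDeriv n m (fun i => I i.succ) g) x (stdVec n (I 0)) := by
  ext x
  have h1 : DifferentiableAt ℝ (iteratedFDeriv ℝ m g) x :=
    ((hg.iteratedFDeriv_right (m := 1) (mod_cast le_top)).differentiable one_ne_zero) x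
  have h2 := ((ContinuousMultilinearMap.apply ℝ (fun _ : Fin m => Euc n) F
    (fun i => stdVec n (I i.succ))).hasFDerivAt.comp x h1.hasFDerivAt).fderiv
  rw [show (dirDeriv n m (fun i => I i.succ) g) = (ContinuousMultilinearMap.apply ℝ (fun _ : Fin m => Euc n) F
    (fun i => stdVec n (I i.succ))) ∘ (iteratedFDeriv ℝ m g) from rfl, h2]
  rfl

/-- A composition of directional derivatives is a directional derivative. -/
theorem exists_dirDeriv_dirDeriv_eq {m : ℕ} (I : Fin m → Fin n) {j : ℕ} (J : Fin j → Fin n) :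
    ∃ L : Fin (m + j) → Fin n, ∀ g : Euc n → F, ContDiff ℝ (⊤ : ℕ∞) g →
      dirDeriv n j J (dirDeriv n m I g) = dirDeriv n (m + j) L g := by
  induction j with
  | zero => exact ⟨I, fun g _ => dirDeriv_zero _ _⟩
  | succ j ih =>
    obtain ⟨L, hL⟩ := ih fun i => J i.succ
    refine ⟨Fin.cons (J 0) L, fun g hg => ?_⟩
    rw [dirDeriv_succ (ContDiff.dirDeriv hg I), hL g hg]
    exact (dirDeriv_succ hg (m := m + j) (Fin.cons (J 0) L : Fin (m + j + 1) → Fin n)).symm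

end IteratedDerivatives

section Decay

variable {n : ℕ}

theorem exists_dirDeriv_cutoff_bound (k : ℕ) (κ : 𝓢(Euc n, ℝ)) {χ : Euc n → ℝ}
    (hχ : IsTestFun n χ) {m : ℕ} (I : Fin m → Fin n) (hm : m ≤ k) (N j₀ : ℕ) :
    ∃ C : ℝ, 0 ≤ C ∧ ∀ j ≤ j₀, ∀ i x,
      ‖iteratedFDeriv ℝ j (dirDeriv n m I fun y => χ y * scaledKernel k i κ y) x‖ ≤
        C * (2 ^ (i * n) * 2 ^ (i * j) / 2 ^ (i * (k - m))) / (1 + 2 ^ i * ‖x‖) ^ N := by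
  choose C hC0 hC using fun j => exists_cutoff_scaledKernel_bound k κ hχ (m + j) N
  refine ⟨∑ j ∈ Finset.range (j₀ + 1), C j, Finset.sum_nonneg fun j _ => hC0 j,
    fun j hj i x => ?_⟩
  refine (norm_iteratedFDeriv_dirDeriv_le (hχ.1.mul (contDiff_scaledKernel k i κ)) j I x).trans
    ((hC j i x).trans ?_)
  have h1 : C j ≤ ∑ a ∈ Finset.range (j₀ + 1), C a :=
    Finset.single_le_sum (f := C) (fun a _ => hC0 a) (Finset.mem_range.2 (by omega))
  have h2 : (2 : ℝ) ^ (i * (m + j)) / 2 ^ (i * k) = 2 ^ (i * j) / 2 ^ (i * (k - m)) := by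
    rw [div_eq_div_iff (by positivity) (by positivity), ← pow_add, ← pow_add]
    congr 1
    obtain ⟨d, rfl⟩ := Nat.exists_eq_add_of_le hm
    rw [Nat.add_sub_cancel_left]; ring
  rw [mul_div_assoc (2 ^ (i * n)), h2, ← mul_div_assoc]
  gcongr

theorem isTestFun_cutoff_scaledKernel (k i : ℕ) (κ : 𝓢(Euc n, ℝ)) {χ : Euc n → ℝ}
    (hχ : IsTestFun n χ) : IsTestFun n (fun y => χ y * scaledKernel k i κ y) :=
  ⟨hχ.1.mul (contDiff_scaledKernel k i κ), hχ.2.mul_right⟩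

theorem tsupport_dirDeriv_subset {F : Type*} [NormedAddCommGroup F] [NormedSpace ℝ F]
    (g : Euc n → F) {m : ℕ} (I : Fin m → Fin n) :
    tsupport (dirDeriv n m I g) ⊆ tsupport g := by
  refine (closure_mono fun x hx => ?_).trans (tsupport_iteratedFDeriv_subset (𝕜 := ℝ) (f := g) m)
  contrapose! hx
  simp only [Function.notMem_support] at hx ⊢
  simp [dirDeriv, hx]

/-- Decay of the dyadic pieces of a potential at a point where the measure has zero density. -/
theorem exists_mconv_decay {μ : Measure (Euc n)} {ρ : Euc n → ℝ} (hρ : LocallyIntegrable ρ μ)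
    {k : ℕ} (κ : 𝓢(Euc n, ℝ)) {χ : Euc n → ℝ} (hχ : IsTestFun n χ)
    (hχs : tsupport χ ⊆ closedBall 0 1) {m : ℕ} (I : Fin m → Fin n) (hm : m ≤ k) (j₀ : ℕ)
    {x : Euc n} (h0 : Tendsto (fun r => (μ.withDensity fun z => ‖ρ z‖ₑ) (ball x r) /
      ENNReal.ofReal (r ^ n)) (𝓝[>] (0 : ℝ)) (𝓝 0)) :
    ∃ e : ℕ → ℝ, Antitone e ∧ (∀ i, 0 ≤ e i) ∧ Tendsto e atTop (𝓝 0) ∧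
      ∀ j ≤ j₀, ∀ J i, J ≤ i → ∀ y, ‖y - x‖ ≤ (1 / 2) ^ J →
        ‖iteratedFDeriv ℝ j (mconv μ ρ (dirDeriv n m I fun y => χ y * scaledKernel k i κ y)) y‖ ≤
          e J * (2 ^ (i * n) * 2 ^ (i * j) / (2 ^ (i * (k - m)) * 2 ^ (J * n))) := by
  obtain ⟨C, hC0, hC⟩ := exists_dirDeriv_cutoff_bound k κ hχ I hm (n + 1) j₀
  set τ := μ.withDensity fun z => ‖ρ z‖ₑ with hτ
  have hτfin : τ (ball x 3) ≠ ⊤ := by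
    rw [hτ, withDensity_apply _ measurableSet_ball]
    exact ((hρ.integrableOn_isCompact (isCompact_closedBall x 3)).mono_set
      ball_subset_closedBall).2.ne
  set τ' := τ.restrict (ball x 3) with hτ'
  obtain ⟨e, hanti, he0, he, hbound⟩ := exists_dyadicKernel_bound τ' x
    (tendsto_of_tendsto_of_tendsto_of_le_of_le tendsto_const_nhds h0 (fun _ => zero_le)
      fun r => ENNReal.div_le_div_right (Measure.restrict_apply_le _ _) _)
    (M := (τ (ball x 3)).toReal) fun r hr => by
      rw [ENNReal.le_ofReal_iff_toReal_le (ne_top_of_le_ne_top hτfin ?_) (by positivity)]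
      · refine le_trans (ENNReal.toReal_mono hτfin ?_)
          (le_mul_of_one_le_right ENNReal.toReal_nonneg (one_le_pow₀ hr))
        rw [hτ', Measure.restrict_apply measurableSet_ball]
        exact measure_mono Set.inter_subset_right
      · rw [hτ', Measure.restrict_apply measurableSet_ball]
        exact measure_mono Set.inter_subset_right
  refine ⟨fun i => C * 2 ^ (n + 1) * e i, fun a b hab => ?_, fun i => ?_, ?_, ?_⟩
  · have := hanti hab
    dsimp only
    gcongr
  · have := he0 i
    positivity
  · simpa using he.const_mul (C * 2 ^ (n + 1))
  intro j hj J i hJ y hy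
  have hg := (isTestFun_cutoff_scaledKernel k i κ hχ).dirDeriv I
  set g := dirDeriv n m I fun y => χ y * scaledKernel k i κ y with hgdef
  have hgs : tsupport g ⊆ closedBall 0 1 :=
    (tsupport_dirDeriv_subset _ I).trans ((tsupport_mul_subset_left).trans hχs)
  have hj0 := he0 J
  rw [iteratedFDeriv_mconv hρ hg, ← ENNReal.ofReal_le_ofReal_iff (by positivity), ofReal_norm]
  refine (enorm_mconv_le hρ.aestronglyMeasurable _ y).trans ?_
  have hy1 : ‖y - x‖ ≤ 1 := hy.trans (pow_le_one₀ (by norm_num) (by norm_num))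
  have hsupp : ∀ z ∉ ball x 3, ‖iteratedFDeriv ℝ j g (y - z)‖ₑ = 0 := fun z hz => by
    rw [enorm_eq_zero]
    refine image_eq_zero_of_notMem_tsupport fun hmem => hz ?_
    have h3 := hgs (tsupport_iteratedFDeriv_subset j hmem)
    rw [mem_closedBall_zero_iff] at h3
    rw [mem_ball, dist_eq_norm]
    have : z - x = (y - x) - (y - z) := by abel
    rw [this]
    linarith [norm_sub_le (y - x) (y - z)]
  rw [← setLIntegral_eq_of_support_subset (s := ball x 3) (fun z hz => by
    by_contra h; exact hz (hsupp z h)), ← hτ']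
  set D : ℝ := C * (2 ^ (i * n) * 2 ^ (i * j) / 2 ^ (i * (k - m))) with hD
  have hD0 : 0 ≤ D := by positivity
  calc ∫⁻ z, ‖iteratedFDeriv ℝ j g (y - z)‖ₑ ∂τ'
      ≤ ∫⁻ z, ENNReal.ofReal (D * (2 ^ (n + 1) / 2 ^ (J * n))) *
          ENNReal.ofReal (dyadicKernel n J x z) ∂τ' := by
        refine lintegral_mono fun z => ?_
        rw [← ENNReal.ofReal_mul (by positivity), ← ofReal_norm]
        refine ENNReal.ofReal_le_ofReal ((hC j hj i (y - z)).trans ?_)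
        rw [← hD, div_eq_mul_one_div D, mul_assoc D]
        exact mul_le_mul_of_nonneg_left (dyadicKernel_le_of_near hJ hy z) hD0
    _ = ENNReal.ofReal (D * (2 ^ (n + 1) / 2 ^ (J * n))) *
          ∫⁻ z, ENNReal.ofReal (dyadicKernel n J x z) ∂τ' := by
        rw [lintegral_const_mul' _ _ ENNReal.ofReal_ne_top]
    _ ≤ ENNReal.ofReal (D * (2 ^ (n + 1) / 2 ^ (J * n))) * ENNReal.ofReal (e J) := by
        gcongr
        exact hbound J
    _ = _ := by
        rw [← ENNReal.ofReal_mul (by positivity)]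
        congr 1
        rw [hD]
        field_simp

end Decay

section Core

variable {n : ℕ}

theorem natCast_le_smooth (d : ℕ) : (d : WithTop ℕ∞) ≤ ((⊤ : ℕ∞) : WithTop ℕ∞) := by
  exact_mod_cast (le_top : (d : ℕ∞) ≤ ⊤)

theorem eq_sum_stdVec (v : Euc n) : v = ∑ j, v j • stdVec n j := by
  simpa [stdVec] using ((EuclideanSpace.basisFun (Fin n) ℝ).sum_repr v).symm

theorem continuousMultilinearMap_eq_sum {k : ℕ}
    (T : ContinuousMultilinearMap ℝ (fun _ : Fin k => Euc n) ℝ) :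
    T = ∑ J : Fin k → Fin n, T (fun i => stdVec n (J i)) •
      (ContinuousMultilinearMap.mkPiAlgebra ℝ (Fin k) ℝ).compContinuousLinearMap
        fun i => (EuclideanSpace.proj (J i) : Euc n →L[ℝ] ℝ) := by
  ext v
  conv_lhs => rw [show v = fun i => ∑ j, v i j • stdVec n j from funext fun i => eq_sum_stdVec _]
  rw [T.map_sum]
  simp [T.map_smul_univ, mul_comm]

theorem exists_tendsto_of_components {k : ℕ}
    {T : ℕ → ContinuousMultilinearMap ℝ (fun _ : Fin k => Euc n) ℝ}
    (h : ∀ J : Fin k → Fin n, ∃ c, Tendsto (fun N => T N fun i => stdVec n (J i)) atTop (𝓝 c)) :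
    ∃ M, Tendsto T atTop (𝓝 M) := by
  choose c hc using h
  have h1 := tendsto_finsetSum Finset.univ fun J _ => (hc J).smul_const
    ((ContinuousMultilinearMap.mkPiAlgebra ℝ (Fin k) ℝ).compContinuousLinearMap
      fun i => (EuclideanSpace.proj (J i) : Euc n →L[ℝ] ℝ))
  exact ⟨_, h1.congr fun N => (continuousMultilinearMap_eq_sum (T N)).symm⟩

theorem mconv_const (w : ℝ) (g : Euc n → ℝ) (y : Euc n) :
    mconv volume (fun _ => w) g y = w * ∫ z, g z := by
  rw [mconv]
  simp only [smul_eq_mul]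
  rw [integral_const_mul, integral_sub_left_eq_self]

theorem mconv_add_left {μ : Measure (Euc n)} {ρ₁ ρ₂ : Euc n → ℝ} (h₁ : LocallyIntegrable ρ₁ μ)
    (h₂ : LocallyIntegrable ρ₂ μ) {g : Euc n → ℝ} (hg : IsTestFun n g) (y : Euc n) :
    mconv μ (fun z => ρ₁ z + ρ₂ z) g y = mconv μ ρ₁ g y + mconv μ ρ₂ g y := by
  simp only [mconv, add_smul]
  exact integral_add (mconv_integrable h₁ hg.1.continuous hg.2 y)
    (mconv_integrable h₂ hg.1.continuous hg.2 y)

/-- Pointwise Taylor expansion of a sum of dyadic potentials of a measure `ρ μ + h dx` at a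
Lebesgue point. -/
theorem hasTaylor_tsum_mconv {k m : ℕ} (hm : m ≤ k) (hnk : n < k - m)
    {μ : Measure (Euc n)} {ρ : Euc n → ℝ} (hρ : LocallyIntegrable ρ μ)
    {h : Euc n → ℝ} (hh : LocallyIntegrable h volume) (w : ℝ)
    (κ : 𝓢(Euc n, ℝ)) {χ : Euc n → ℝ} (hχ : IsTestFun n χ) (hχs : tsupport χ ⊆ closedBall 0 1)
    (I : Fin m → Fin n) {x : Euc n}
    (h1 : Tendsto (fun r => (μ.withDensity fun z => ‖ρ z‖ₑ) (ball x r) /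
      ENNReal.ofReal (r ^ n)) (𝓝[>] (0 : ℝ)) (𝓝 0))
    (h2 : Tendsto (fun r => (volume.withDensity fun z => ‖h z - w‖ₑ) (ball x r) /
      ENNReal.ofReal (r ^ n)) (𝓝[>] (0 : ℝ)) (𝓝 0))
    {f : ℕ → Euc n → ℝ}
    (hf : ∀ i y, f i y =
      mconv μ ρ (dirDeriv n m I fun y => χ y * scaledKernel k i κ y) y +
      mconv volume h (dirDeriv n m I fun y => χ y * scaledKernel k i κ y) y)
    (hc : ∀ J : Fin (k - m) → Fin n, ∃ c, Tendsto (fun N => ∑ i ∈ Finset.range N,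
      dirDeriv n (k - m) J (f i) x) atTop (𝓝 c)) :
    HasTaylor (k - m) (fun y => ∑' i, f i y) x := by
  have hhw : LocallyIntegrable (fun z => h z - w) volume :=
    hh.sub (locallyIntegrable_const w)
  set G : ℕ → Euc n → ℝ := fun i => dirDeriv n m I fun y => χ y * scaledKernel k i κ y with hG
  have hGt : ∀ i, IsTestFun n (G i) := fun i =>
    (isTestFun_cutoff_scaledKernel k i κ hχ).dirDeriv I
  obtain ⟨e₁, ha₁, hn₁, ht₁, hb₁⟩ := exists_mconv_decay hρ κ hχ hχs I hm (k - m + 1) h1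
  obtain ⟨e₂, ha₂, hn₂, ht₂, hb₂⟩ := exists_mconv_decay hhw κ hχ hχs I hm (k - m + 1) h2
  set e : ℕ → ℝ := fun i => e₁ i + e₂ i with he
  have he0 : ∀ i, 0 ≤ e i := fun i => add_nonneg (hn₁ i) (hn₂ i)
  set p : ℕ → Euc n → ℝ := fun i y => mconv μ ρ (G i) y + mconv volume (fun z => h z - w) (G i) y
    with hp
  have hs₁ : ∀ i, ContDiff ℝ (⊤ : ℕ∞) (mconv μ ρ (G i)) := fun i => contDiff_mconv hρ (hGt i)
  have hs₂ : ∀ i, ContDiff ℝ (⊤ : ℕ∞) (mconv volume (fun z => h z - w) (G i)) := fun i =>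
    contDiff_mconv hhw (hGt i)
  have hps : ∀ i, ContDiff ℝ (⊤ : ℕ∞) (p i) := fun i => (hs₁ i).add (hs₂ i)
  have hpb : ∀ j ≤ k - m + 1, ∀ J i, J ≤ i → ∀ y, ‖y - x‖ ≤ (1 / 2) ^ J →
      ‖iteratedFDeriv ℝ j (p i) y‖ ≤
        e J * (2 ^ (i * n) * 2 ^ (i * j) / (2 ^ (i * (k - m)) * 2 ^ (J * n))) := by
    intro j hj J i hJ y hy
    rw [hp, fun_iteratedFDeriv_add_apply ((hs₁ i).of_le (mod_cast le_top)).contDiffAt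
      ((hs₂ i).of_le (mod_cast le_top)).contDiffAt, he, add_mul]
    exact (norm_add_le _ _).trans (add_le_add (hb₁ j hj J i hJ y hy) (hb₂ j hj J i hJ y hy))
  have hfp : ∀ i y, f i y = p i y + w * ∫ z, G i z := fun i y => by
    have := mconv_add_left hhw (locallyIntegrable_const w) (hGt i) y
    simp only [sub_add_cancel] at this
    have h3 := hf i y
    rw [this, mconv_const, ← add_assoc] at h3
    exact h3
  -- the constants are summable
  have hcs : Summable fun i => w * ∫ z, G i z := by
    obtain ⟨C, hC0, hC⟩ := exists_dirDeriv_cutoff_bound k κ hχ I hm 0 0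
    refine Summable.mul_left _ ?_
    refine Summable.of_norm_bounded (g := fun i : ℕ =>
      C * (volume (closedBall (0 : Euc n) 1)).toReal * (1 / 2) ^ i)
      (summable_geometric_two.mul_left _) fun i => ?_
    have hsupp : ∀ z ∉ closedBall (0 : Euc n) 1, G i z = 0 := fun z hz => by
      refine image_eq_zero_of_notMem_tsupport fun hmem => hz ?_
      exact hχs (tsupport_mul_subset_left (tsupport_dirDeriv_subset _ I hmem))
    rw [← setIntegral_eq_integral_of_forall_compl_eq_zero hsupp]
    have hb : ∀ z ∈ closedBall (0 : Euc n) 1, ‖G i z‖ ≤ C * (1 / 2) ^ i := fun z _ => by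
      have h3 := hC 0 le_rfl i z
      rw [norm_iteratedFDeriv_zero] at h3
      refine h3.trans ?_
      simp only [mul_zero, pow_zero, mul_one, div_one]
      refine mul_le_mul_of_nonneg_left ?_ hC0
      rw [div_pow, one_pow, div_le_div_iff₀ (by positivity) (by positivity), ← pow_add, one_mul]
      refine pow_le_pow_right₀ one_le_two ?_
      nlinarith
    refine (norm_setIntegral_le_of_norm_le_const measure_closedBall_lt_top hb).trans
      (le_of_eq ?_)
    rw [Measure.real]; ring
  have hpsum : ∀ y, ‖y - x‖ ≤ 1 → Summable fun i => p i y := fun y hy => by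
    refine Summable.of_norm_bounded (g := fun i : ℕ => e 0 * (1 / 2) ^ i)
      (summable_geometric_two.mul_left _) fun i => ?_
    have h3 := hpb 0 (Nat.zero_le _) 0 i (Nat.zero_le _) y (by simpa using hy)
    rw [norm_iteratedFDeriv_zero] at h3
    refine h3.trans (mul_le_mul_of_nonneg_left ?_ (he0 0))
    simp only [mul_zero, pow_zero, mul_one, zero_mul]
    rw [div_pow, one_pow, div_le_div_iff₀ (by positivity) (by positivity), ← pow_add, one_mul]
    refine pow_le_pow_right₀ one_le_two ?_
    nlinarith
  have hdir : ∀ J i, dirDeriv n (k - m) J (f i) x = dirDeriv n (k - m) J (p i) x := fun J i => by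
    rw [show f i = fun y => p i y + w * ∫ z, G i z from funext (hfp i), dirDeriv, dirDeriv,
      fun_iteratedFDeriv_add_apply
        ((hps i).of_le (natCast_le_smooth (k - m))).contDiffAt
        contDiff_const.contDiffAt, iteratedFDeriv_const_of_ne (by omega)]
    simp
  obtain ⟨M, hM⟩ := exists_tendsto_of_components (k := k - m)
    (T := fun N => ∑ i ∈ Finset.range N, iteratedFDeriv ℝ (k - m) (p i) x) fun J => by
      obtain ⟨c, hc⟩ := hc J
      refine ⟨c, hc.congr fun N => ?_⟩
      rw [_root_.sum_apply]
      exact Finset.sum_congr rfl fun i _ => hdir J i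
  have key : HasTaylor (k - m) (fun y => ∑' i, p i y) x := by
    refine hasTaylor_of_dyadic_bounds hnk (g := p) (e := e) (fun a b hab => ?_) he0
      (by simpa using ht₁.add ht₂) hps (fun i y hy j hj => ?_) (fun J i y hJ hy => ?_) hM
      fun y _ => rfl
    · exact add_le_add (ha₁ hab) (ha₂ hab)
    · refine (hpb j hj i i le_rfl y hy).trans (le_of_eq ?_)
      field_simp
    · have h3 := hpb 0 (Nat.zero_le _) J i hJ y hy
      rw [norm_iteratedFDeriv_zero] at h3
      refine h3.trans (le_of_eq ?_)
      simp only [mul_zero, pow_zero, mul_one]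
      ring
  refine (key.add (HasTaylor.const (k - m) (∑' i, w * ∫ z, G i z) x)).congr_of_eventuallyEq ?_
  filter_upwards [closedBall_mem_nhds x one_pos] with y hy
  rw [mem_closedBall, dist_eq_norm] at hy
  rw [← (hpsum y hy).tsum_add hcs]
  exact tsum_congr fun i => hfp i y

end Core

section LebesguePoints

variable {n : ℕ}

theorem tendsto_measure_ball_div_pow {τ : Measure (Euc n)} {x : Euc n}
    (h : Tendsto (fun r => τ (closedBall x r) / volume (closedBall x r)) (𝓝[>] (0 : ℝ)) (𝓝 0)) :
    Tendsto (fun r => τ (ball x r) / ENNReal.ofReal (r ^ n)) (𝓝[>] (0 : ℝ)) (𝓝 0) := by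
  set c := volume (ball (0 : Euc n) 1) with hc
  have hc0 : c ≠ 0 := (measure_ball_pos volume _ one_pos).ne'
  have hct : c ≠ ⊤ := measure_ball_lt_top.ne
  have h1 := ENNReal.Tendsto.const_mul (a := c) h (Or.inr hct)
  rw [mul_zero] at h1
  refine tendsto_of_tendsto_of_tendsto_of_le_of_le' tendsto_const_nhds h1
    (Eventually.of_forall fun _ => zero_le) ?_
  filter_upwards [self_mem_nhdsWithin] with r (hr : 0 < r)
  rw [Measure.addHaar_closedBall volume x hr.le, ← hc, finrank_euclideanSpace_fin]
  have h2 : c * (τ (closedBall x r) / (ENNReal.ofReal (r ^ n) * c)) =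
      τ (closedBall x r) / ENNReal.ofReal (r ^ n) := by
    rw [mul_comm (ENNReal.ofReal _) c, ← mul_div_assoc, ENNReal.mul_div_mul_left _ _ hc0 hct]
  rw [h2]
  exact ENNReal.div_le_div_right (measure_mono ball_subset_closedBall) _

theorem ae_tendsto_measure_ball_of_mutuallySingular {τ : Measure (Euc n)}
    [IsLocallyFiniteMeasure τ] (hτ : τ ⟂ₘ volume) :
    ∀ᵐ x ∂(volume : Measure (Euc n)),
      Tendsto (fun r => τ (ball x r) / ENNReal.ofReal (r ^ n)) (𝓝[>] (0 : ℝ)) (𝓝 0) := by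
  filter_upwards [Besicovitch.ae_tendsto_rnDeriv τ volume, hτ.rnDeriv_ae_eq_zero] with x hx h0
  rw [h0] at hx
  exact tendsto_measure_ball_div_pow hx

theorem ae_tendsto_lebesguePoint {F : Type*} [NormedAddCommGroup F] {h : Euc n → F} (hh : LocallyIntegrable h volume) :
    ∀ᵐ x ∂(volume : Measure (Euc n)),
      Tendsto (fun r => (volume.withDensity fun z => ‖h z - h x‖ₑ) (ball x r) /
        ENNReal.ofReal (r ^ n)) (𝓝[>] (0 : ℝ)) (𝓝 0) := by
  filter_upwards [(Besicovitch.vitaliFamily (volume : Measure (Euc n))).ae_tendsto_lintegral_enorm_sub_div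
    hh] with x hx
  refine tendsto_measure_ball_div_pow ((hx.comp (Besicovitch.tendsto_filterAt volume x)).congr
    fun r => ?_)
  rw [Function.comp_apply, withDensity_apply _ measurableSet_closedBall]

/-- The density of the absolutely continuous part of `ρ σ`. -/
def acDensity (σ : Measure (Euc n)) (ρ : Euc n → ℝ) (z : Euc n) : ℝ :=
  (σ.rnDeriv volume z).toReal * ρ z

variable {σ : Measure (Euc n)} [IsFiniteMeasure σ] {ρ : Euc n → ℝ}

theorem integrable_of_abs_le_one (μ : Measure (Euc n)) [IsFiniteMeasure μ] (hρ : Measurable ρ)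
    (hρ1 : ∀ z, |ρ z| ≤ 1) : Integrable ρ μ :=
  Integrable.of_bound hρ.aestronglyMeasurable 1 (Eventually.of_forall hρ1)

theorem integrable_acDensity (hρ : Measurable ρ) (hρ1 : ∀ z, |ρ z| ≤ 1) :
    Integrable (acDensity σ ρ) volume := by
  have hfin := IsFiniteMeasure.mk (μ := volume.withDensity (σ.rnDeriv volume))
    ((Measure.withDensity_rnDeriv_le σ volume _).trans_lt (measure_lt_top σ _))
  exact (integrable_withDensity_iff_integrable_smul' (Measure.measurable_rnDeriv σ volume)
    (Measure.rnDeriv_lt_top σ volume)).1 (integrable_of_abs_le_one _ hρ hρ1)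

theorem mconv_eq_singularPart_add (hρ : Measurable ρ) (hρ1 : ∀ z, |ρ z| ≤ 1) {g : Euc n → ℝ}
    (hg : Continuous g) {C : ℝ} (hgC : ∀ x, |g x| ≤ C) (y : Euc n) :
    mconv σ ρ g y = mconv (σ.singularPart volume) ρ g y + mconv volume (acDensity σ ρ) g y := by
  have hfin := IsFiniteMeasure.mk (μ := volume.withDensity (σ.rnDeriv volume))
    ((Measure.withDensity_rnDeriv_le σ volume _).trans_lt (measure_lt_top σ _))
  have hint : ∀ (μ : Measure (Euc n)) [IsFiniteMeasure μ],
      Integrable (fun z => ρ z • g (y - z)) μ := fun μ _ =>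
    (integrable_of_abs_le_one μ hρ hρ1).mul_bdd (c := C)
      (by fun_prop) (Eventually.of_forall fun z => hgC _)
  conv_lhs => rw [mconv, σ.haveLebesgueDecomposition_add volume]
  rw [integral_add_measure (hint _) (hint _), mconv, mconv,
    integral_withDensity_eq_integral_toReal_smul (Measure.measurable_rnDeriv σ volume)
      (Measure.rnDeriv_lt_top σ volume)]
  simp only [acDensity, smul_eq_mul, mul_assoc]

/-- At almost every point, the dyadic potential of a finite measure has a Taylor expansion as
soon as the series of its top order derivatives converges. -/
theorem ae_hasTaylor_tsum_mconv (hρ : Measurable ρ) (hρ1 : ∀ z, |ρ z| ≤ 1)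
    {k m : ℕ} (hm : m ≤ k) (hnk : n < k - m)
    (κ : 𝓢(Euc n, ℝ)) {χ : Euc n → ℝ} (hχ : IsTestFun n χ) (hχs : tsupport χ ⊆ closedBall 0 1)
    (I : Fin m → Fin n)
    (hc : ∀ᵐ x ∂(volume : Measure (Euc n)), ∀ J : Fin k → Fin n,
      ∃ c, Tendsto (fun N => ∑ i ∈ Finset.range N,
        mconv σ ρ (dirDeriv n k J fun y => χ y * scaledKernel k i κ y) x) atTop (𝓝 c)) :
    ∀ᵐ x ∂(volume : Measure (Euc n)), HasTaylor (k - m)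
      (fun y => ∑' i, mconv σ ρ (dirDeriv n m I fun y => χ y * scaledKernel k i κ y) y) x := by
  have hint : LocallyIntegrable ρ σ := (integrable_of_abs_le_one σ hρ hρ1).locallyIntegrable
  have hs : Integrable ρ (σ.singularPart volume) := integrable_of_abs_le_one _ hρ hρ1
  have := isFiniteMeasure_withDensity hs.2.ne
  have hsing : ((σ.singularPart volume).withDensity fun z => ‖ρ z‖ₑ) ⟂ₘ volume :=
    (Measure.mutuallySingular_singularPart σ volume).mono_ac
      (withDensity_absolutelyContinuous _ _) Measure.AbsolutelyContinuous.rfl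
  have hac := (integrable_acDensity (σ := σ) hρ hρ1).locallyIntegrable
  filter_upwards [hc, ae_tendsto_measure_ball_of_mutuallySingular hsing,
    ae_tendsto_lebesguePoint hac] with x hx h1 h2
  refine hasTaylor_tsum_mconv hm hnk hs.locallyIntegrable hac (acDensity σ ρ x) κ hχ hχs I h1 h2
    (fun i y => ?_) fun J => ?_
  · have hg := (isTestFun_cutoff_scaledKernel k i κ hχ).dirDeriv I
    obtain ⟨C, hC⟩ := hg.2.exists_bound_of_continuous hg.1.continuous
    exact mconv_eq_singularPart_add hρ hρ1 hg.1.continuous hC y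
  · obtain ⟨L, hL⟩ := exists_dirDeriv_dirDeriv_eq (F := ℝ) I J
    have hmk : m + (k - m) = k := by omega
    obtain ⟨L', hL'⟩ : ∃ L' : Fin k → Fin n, ∀ g : Euc n → ℝ, ContDiff ℝ (⊤ : ℕ∞) g →
        dirDeriv n (k - m) J (dirDeriv n m I g) = dirDeriv n k L' g := by
      generalize k - m = d at *
      subst hmk
      exact ⟨L, hL⟩
    obtain ⟨c, hc⟩ := hx L'
    refine ⟨c, hc.congr fun N => Finset.sum_congr rfl fun i _ => ?_⟩
    have hg := isTestFun_cutoff_scaledKernel k i κ hχ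
    rw [dirDeriv_mconv hint (hg.dirDeriv I), hL' _ hg.1]

end LebesguePoints

section GrowthSet

variable {n : ℕ}

/-- Points around which `σ` grows at most like `L r^n`. -/
def growthSet (σ : Measure (Euc n)) (L : ℕ) : Set (Euc n) :=
  {x | ∀ r : ℝ, 0 < r → σ (closedBall x r) ≤ ENNReal.ofReal (L * r ^ n)}

theorem isClosed_growthSet (σ : Measure (Euc n)) (L : ℕ) : IsClosed (growthSet σ L) := by
  refine isClosed_of_closure_subset fun x hx r hr => ?_
  have h1 : Tendsto (fun ε : ℝ => ENNReal.ofReal (L * (r + ε) ^ n)) (𝓝[>] 0)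
      (𝓝 (ENNReal.ofReal (L * r ^ n))) := by
    have : Continuous fun ε : ℝ => ENNReal.ofReal (L * (r + ε) ^ n) :=
      ENNReal.continuous_ofReal.comp (by fun_prop)
    simpa using (this.tendsto 0).mono_left nhdsWithin_le_nhds
  refine ge_of_tendsto h1 ?_
  filter_upwards [self_mem_nhdsWithin] with ε (hε : 0 < ε)
  obtain ⟨y, hy, hxy⟩ := Metric.mem_closure_iff.1 hx ε hε
  exact (measure_mono (closedBall_subset_closedBall' (by linarith))).trans
    (hy (r + ε) (by linarith))

theorem ae_exists_mem_growthSet (σ : Measure (Euc n)) [IsFiniteMeasure σ] :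
    ∀ᵐ x ∂(volume : Measure (Euc n)), ∃ L, x ∈ growthSet σ L := by
  filter_upwards [Besicovitch.ae_tendsto_rnDeriv σ volume, σ.rnDeriv_lt_top volume] with x hx hfin
  set c := volume (ball (0 : Euc n) 1) with hc
  have hct : c ≠ ⊤ := measure_ball_lt_top.ne
  have hc0 : c ≠ 0 := (measure_ball_pos volume _ one_pos).ne'
  obtain ⟨b, hb, hbt⟩ := exists_between hfin
  have h1 := hx.eventually (gt_mem_nhds hb)
  obtain ⟨R, hR, hRb⟩ := mem_nhdsGT_iff_exists_Ioo_subset.1 h1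
  have hR : 0 < R := hR
  obtain ⟨L, hL⟩ := exists_nat_ge (max (b.toReal * c.toReal) ((σ Set.univ).toReal / R ^ n))
  refine ⟨L, fun r hr => ?_⟩
  rcases lt_or_ge r R with h | h
  · have h2 : σ (closedBall x r) / volume (closedBall x r) < b := hRb ⟨hr, h⟩
    rw [Measure.addHaar_closedBall volume x hr.le, ← hc, finrank_euclideanSpace_fin] at h2
    have h0 : ENNReal.ofReal (r ^ n) ≠ 0 := by
      rw [Ne, ENNReal.ofReal_eq_zero, not_le]; positivity
    rw [ENNReal.div_lt_iff (Or.inl (mul_ne_zero h0 hc0))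
      (Or.inl (ENNReal.mul_ne_top ENNReal.ofReal_ne_top hct))] at h2
    refine h2.le.trans ?_
    rw [← ENNReal.ofReal_toReal hbt.ne, ← ENNReal.ofReal_toReal hct,
      ← ENNReal.ofReal_mul (by positivity), ← ENNReal.ofReal_mul ENNReal.toReal_nonneg]
    refine ENNReal.ofReal_le_ofReal ?_
    calc _ = b.toReal * c.toReal * r ^ n := by ring
      _ ≤ L * r ^ n := by
        gcongr
        exact (le_max_left _ _).trans hL
  · refine (measure_mono (Set.subset_univ _)).trans ?_
    rw [← ENNReal.ofReal_toReal (measure_ne_top σ Set.univ)]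
    refine ENNReal.ofReal_le_ofReal ?_
    calc _ = (σ Set.univ).toReal / R ^ n * R ^ n := by field_simp
      _ ≤ L * r ^ n := by
        gcongr
        exact (le_max_right _ _).trans hL

theorem measure_le_of_subset_growthSet (σ : Measure (Euc n)) [IsFiniteMeasure σ] (L : ℕ) :
    ∃ C : ℝ≥0, ∀ s ⊆ growthSet σ L, σ s ≤ C * volume s := by
  set c := volume (ball (0 : Euc n) 1) with hc
  have hct : c ≠ ⊤ := measure_ball_lt_top.ne
  have hc0 : c ≠ 0 := (measure_ball_pos volume _ one_pos).ne'
  refine ⟨L * c.toNNReal⁻¹, fun s hs => ?_⟩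
  have h1 := (Besicovitch.vitaliFamily σ).measure_le_of_frequently_le (ρ := σ)
    ((L * c.toNNReal⁻¹ : ℝ≥0) • (volume : Measure (Euc n))) Measure.AbsolutelyContinuous.rfl s
    fun x hx => ?_
  · exact h1
  · refine (Besicovitch.tendsto_filterAt σ x).frequently (Eventually.frequently ?_)
    filter_upwards [self_mem_nhdsWithin] with r (hr : 0 < r)
    refine (hs hx r hr).trans (le_of_eq ?_)
    rw [Measure.smul_apply, Measure.addHaar_closedBall volume x hr.le, ← hc,
      finrank_euclideanSpace_fin, ENNReal.smul_def, smul_eq_mul, ENNReal.coe_mul,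
      ENNReal.coe_inv (by simp [ENNReal.toNNReal_eq_zero_iff, hc0, hct]),
      ENNReal.coe_toNNReal hct, ENNReal.ofReal_mul (by positivity), mul_assoc,
      mul_comm (ENNReal.ofReal _) c, ← mul_assoc c⁻¹, ENNReal.inv_mul_cancel hc0 hct, one_mul]
    simp

theorem memLp_two_of_integrable_of_bound {g : Euc n → ℝ} (hg : Integrable g volume) {B : ℝ}
    (hB : ∀ᵐ x ∂(volume : Measure (Euc n)), |g x| ≤ B) : MemLp g 2 volume := by
  rw [memLp_two_iff_integrable_sq hg.aestronglyMeasurable]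
  simp only [sq]
  exact hg.mul_bdd hg.aestronglyMeasurable hB

/-- The restriction of `σ` to a growth set has a square integrable density. -/
theorem exists_memLp_two_density (σ : Measure (Euc n)) [IsFiniteMeasure σ] (L : ℕ)
    {ρ : Euc n → ℝ} (hρ : Measurable ρ) (hρ1 : ∀ z, |ρ z| ≤ 1) :
    ∃ h : Euc n → ℝ, Integrable h volume ∧ MemLp h 2 volume ∧
      ∀ g : Euc n → ℝ, Continuous g → ∀ C : ℝ, (∀ x, |g x| ≤ C) → ∀ y,
        mconv (σ.restrict (growthSet σ L)) ρ g y = mconv volume h g y := by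
  set ν := σ.restrict (growthSet σ L) with hν
  obtain ⟨C, hC⟩ := measure_le_of_subset_growthSet σ L
  have hle : ν ≤ C • volume := Measure.le_iff.2 fun s hs => by
    rw [hν, Measure.restrict_apply hs]
    exact (hC _ Set.inter_subset_right).trans (by
      rw [Measure.smul_apply, ENNReal.smul_def, smul_eq_mul]
      exact mul_le_mul_right (measure_mono Set.inter_subset_left) _)
  have hac : ν ≪ volume :=
    (Measure.absolutelyContinuous_of_le hle).trans (Measure.smul_absolutelyContinuous)
  have hi := integrable_acDensity (σ := ν) hρ hρ1
  have hb : ∀ᵐ x ∂(volume : Measure (Euc n)), ν.rnDeriv volume x ≤ C := by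
    refine ae_le_of_forall_setLIntegral_le_of_sigmaFinite (Measure.measurable_rnDeriv _ _)
      fun s hs _ => ?_
    rw [Measure.setLIntegral_rnDeriv hac, setLIntegral_const]
    exact hle s
  refine ⟨acDensity ν ρ, hi, memLp_two_of_integrable_of_bound hi (B := C) ?_,
    fun g hg D hD y => ?_⟩
  · filter_upwards [hb] with x hx
    rw [acDensity, abs_mul, ENNReal.abs_toReal]
    calc _ ≤ (C : ℝ) * 1 := mul_le_mul (ENNReal.toReal_le_coe_of_le_coe hx) (hρ1 x)
          (abs_nonneg _) C.2
      _ = C := mul_one _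
  · rw [mconv_eq_singularPart_add hρ hρ1 hg hD y, (ν.singularPart_eq_zero volume).2 hac]
    simp [mconv]

end GrowthSet

section KernelSums

variable {n : ℕ}

theorem sum_dyadic_kernel_le (N : ℕ) {t : ℝ} (ht : 0 < t) :
    ∑ i ∈ Finset.range N, (2 : ℝ) ^ (i * (n + 1)) / (1 + 2 ^ i * t) ^ (n + 2) ≤
      2 / t ^ (n + 1) := by
  have h1 : ∀ i : ℕ, (2 : ℝ) ^ (i * (n + 1)) / (1 + 2 ^ i * t) ^ (n + 2) ≤
      (2 / (1 + 2 ^ i * t) - 2 / (1 + 2 ^ (i + 1) * t)) / t ^ (n + 1) := by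
    intro i
    rw [pow_mul, pow_succ (2 : ℝ) i]
    set s := (2 : ℝ) ^ i with hs
    have hs0 : 0 < s := by positivity
    rw [le_div_iff₀ (by positivity)]
    calc s ^ (n + 1) / (1 + s * t) ^ (n + 2) * t ^ (n + 1)
        = (s * t / (1 + s * t)) ^ n * (s * t / (1 + s * t) ^ 2) := by
          rw [div_pow, div_mul_div_comm, ← pow_add]
          ring
      _ ≤ 1 * (s * t / (1 + s * t) ^ 2) := by
          gcongr
          refine pow_le_one₀ (by positivity) ?_
          rw [div_le_one (by positivity)]
          linarith
      _ ≤ _ := by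
          have h3 : 2 / (1 + s * t) - 2 / (1 + s * 2 * t) =
              2 * (s * t) / ((1 + s * t) * (1 + s * 2 * t)) := by
            field_simp; ring
          rw [h3, one_mul, div_le_div_iff₀ (by positivity) (by positivity)]
          have : 0 < s * t := by positivity
          nlinarith [mul_pos this this, mul_pos (mul_pos this this) this]
  refine (Finset.sum_le_sum fun i _ => h1 i).trans ?_
  rw [← Finset.sum_div, Finset.sum_range_sub']
  gcongr
  have h2 : (0 : ℝ) ≤ 2 / (1 + 2 ^ N * t) := by positivity
  have h3 : 2 / (1 + 2 ^ 0 * t) ≤ 2 := by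
    rw [div_le_iff₀ (by positivity)]
    nlinarith
  linarith

theorem exists_lintegral_tail_le (n : ℕ) : ∃ C : ℝ, 0 ≤ C ∧ ∀ (z : Euc n) (d : ℝ), 0 < d →
    ∀ s : Set (Euc n), MeasurableSet s → (∀ x ∈ s, d ≤ ‖x - z‖) →
      ∫⁻ x in s, ENNReal.ofReal (1 / ‖x - z‖ ^ (n + 1)) ≤ ENNReal.ofReal (C / d) := by
  have hint : Integrable (fun y : Euc n => (1 + ‖y‖) ^ (-((n : ℝ) + 1))) volume :=
    integrable_one_add_norm (by simp)
  set K := ∫ y : Euc n, (1 + ‖y‖) ^ (-((n : ℝ) + 1)) with hK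
  have hK0 : 0 ≤ K := integral_nonneg fun y => by positivity
  refine ⟨2 ^ (n + 1) * K, by positivity, fun z d hd s hs hsd => ?_⟩
  have hf : Integrable (fun x : Euc n => (1 + ‖d⁻¹ • (x - z)‖) ^ (-((n : ℝ) + 1))) volume :=
    (hint.comp_smul (inv_ne_zero hd.ne')).comp_sub_right z
  have hfi : ∫ x : Euc n, (1 + ‖d⁻¹ • (x - z)‖) ^ (-((n : ℝ) + 1)) = d ^ n * K := by
    rw [integral_sub_right_eq_self (fun x : Euc n => (1 + ‖d⁻¹ • x‖) ^ (-((n : ℝ) + 1))) z,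
      Measure.integral_comp_smul volume (fun x : Euc n => (1 + ‖x‖) ^ (-((n : ℝ) + 1))) d⁻¹]
    rw [← hK, finrank_euclideanSpace_fin, inv_pow, inv_inv, abs_of_pos (by positivity), smul_eq_mul]
  have hpt : ∀ x ∈ s, 1 / ‖x - z‖ ^ (n + 1) ≤
      2 ^ (n + 1) / d ^ (n + 1) * (1 + ‖d⁻¹ • (x - z)‖) ^ (-((n : ℝ) + 1)) := by
    intro x hx
    have hxz := hsd x hx
    have hpos : 0 < ‖x - z‖ := hd.trans_le hxz
    rw [norm_smul, norm_inv, Real.norm_of_nonneg hd.le, Real.rpow_neg (by positivity),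
      show (n : ℝ) + 1 = ((n + 1 : ℕ) : ℝ) by push_cast; ring, Real.rpow_natCast,
      ← div_eq_mul_inv, div_div, ← mul_pow, div_le_div_iff₀ (by positivity) (by positivity),
      one_mul, ← mul_pow]
    refine pow_le_pow_left₀ (by positivity) ?_ _
    rw [mul_add, ← mul_assoc, mul_inv_cancel₀ hd.ne']
    linarith
  calc ∫⁻ x in s, ENNReal.ofReal (1 / ‖x - z‖ ^ (n + 1))
      ≤ ∫⁻ x in s, ENNReal.ofReal
          (2 ^ (n + 1) / d ^ (n + 1) * (1 + ‖d⁻¹ • (x - z)‖) ^ (-((n : ℝ) + 1))) :=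
        setLIntegral_mono' hs fun x hx => ENNReal.ofReal_le_ofReal (hpt x hx)
    _ ≤ ∫⁻ x, ENNReal.ofReal
          (2 ^ (n + 1) / d ^ (n + 1) * (1 + ‖d⁻¹ • (x - z)‖) ^ (-((n : ℝ) + 1))) :=
        setLIntegral_le_lintegral _ _
    _ = ENNReal.ofReal (2 ^ (n + 1) / d ^ (n + 1) * (d ^ n * K)) := by
        rw [← ofReal_integral_eq_lintegral_ofReal (hf.const_mul _)
          (Eventually.of_forall fun x => by positivity), integral_const_mul, hfi]
    _ = _ := by
        congr 1
        field_simp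
        ring

end KernelSums

section AverageKernel

variable {n : ℕ}

theorem measureReal_ball_pos (x : Euc n) {r : ℝ} (hr : 0 < r) : 0 < volume.real (ball x r) :=
  ENNReal.toReal_pos (measure_ball_pos volume x hr).ne' measure_ball_lt_top.ne

/-- The averaging kernel over the balls `B(z, dist(z, S) / 2)`. -/
def avgKernel (S : Set (Euc n)) (z y : Euc n) : ℝ :=
  if dist y z < infDist z S / 2 then
    ((infDist z S / 2) ^ n * volume.real (ball (0 : Euc n) 1))⁻¹ else 0

theorem avgKernel_nonneg (S : Set (Euc n)) (z y : Euc n) : 0 ≤ avgKernel S z y := by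
  rw [avgKernel]
  split_ifs
  · have : 0 ≤ infDist z S := infDist_nonneg
    positivity
  · exact le_rfl

theorem measurable_avgKernel (S : Set (Euc n)) :
    Measurable (Function.uncurry (avgKernel S)) := by
  refine Measurable.ite ?_ ?_ measurable_const
  · exact (isOpen_lt (by fun_prop)
      (((continuous_infDist_pt S).comp continuous_fst).div_const 2)).measurableSet
  · exact ((((continuous_infDist_pt S).measurable.comp measurable_fst).div_const 2).pow_const n
      |>.mul_const _).inv

theorem avgKernel_eq_indicator {S : Set (Euc n)} {z : Euc n} :
    avgKernel S z = (ball z (infDist z S / 2)).indicator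
      fun _ => (volume.real (ball z (infDist z S / 2)))⁻¹ := by
  ext y
  classical
  rw [avgKernel, Set.indicator_apply, mem_ball]
  by_cases h : dist y z < infDist z S / 2
  · have hpos : 0 < infDist z S / 2 := dist_nonneg.trans_lt h
    rw [if_pos h, if_pos h, Measure.real, Measure.real, Measure.addHaar_ball_of_pos volume z hpos,
      finrank_euclideanSpace_fin, ENNReal.toReal_mul, ENNReal.toReal_ofReal (by positivity)]
  · rw [if_neg h, if_neg h]

theorem integrable_avgKernel (S : Set (Euc n)) (z : Euc n) :
    Integrable (avgKernel S z) volume := by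
  rw [avgKernel_eq_indicator, integrable_indicator_iff measurableSet_ball]
  exact integrableOn_const measure_ball_lt_top.ne

theorem integral_avgKernel {S : Set (Euc n)} {z : Euc n} (hz : 0 < infDist z S) :
    ∫ y, avgKernel S z y = 1 := by
  rw [avgKernel_eq_indicator, integral_indicator measurableSet_ball, setIntegral_const,
    smul_eq_mul, mul_inv_cancel₀]
  exact (measureReal_ball_pos _ (half_pos hz)).ne'

theorem avgKernel_eq_zero_of_le {S : Set (Euc n)} {z y : Euc n} (h : infDist z S / 2 ≤ dist y z) :
    avgKernel S z y = 0 := if_neg h.not_gt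

theorem avgKernel_ne_zero_imp {S : Set (Euc n)} {z y : Euc n} (h : avgKernel S z y ≠ 0) :
    0 < infDist y S ∧ dist z y ≤ infDist y S ∧
      avgKernel S z y ≤ ((infDist y S / 3) ^ n * volume.real (ball (0 : Euc n) 1))⁻¹ := by
  have h1 : dist y z < infDist z S / 2 := by
    by_contra hc
    exact h (if_neg hc)
  have h2 : infDist z S ≤ infDist y S + dist z y := infDist_le_infDist_add_dist
  have h3 : infDist y S ≤ infDist z S + dist y z := infDist_le_infDist_add_dist
  have h4 : 0 ≤ dist y z := dist_nonneg
  rw [dist_comm z y] at *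
  have h5 : 0 < infDist y S := by linarith
  refine ⟨h5, by linarith, ?_⟩
  rw [avgKernel, if_pos h1]
  have hc : 0 < volume.real (ball (0 : Euc n) 1) := measureReal_ball_pos _ one_pos
  gcongr ((?_) ^ n * _)⁻¹
  linarith

variable {σ : Measure (Euc n)} [IsFiniteMeasure σ] {ρ : Euc n → ℝ}

/-- The smoothing of `ρ σ` outside `S` at scale comparable to the distance to `S`. -/
def avgDensity (σ : Measure (Euc n)) (ρ : Euc n → ℝ) (S : Set (Euc n)) (y : Euc n) : ℝ :=
  ∫ z in Sᶜ, ρ z * avgKernel S z y ∂σ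

theorem integrable_prod_avgKernel (hρ : Measurable ρ) (hρ1 : ∀ z, |ρ z| ≤ 1) (S : Set (Euc n)) :
    Integrable (fun p : Euc n × Euc n => ρ p.1 * avgKernel S p.1 p.2)
      ((σ.restrict Sᶜ).prod volume) := by
  have hm : AEStronglyMeasurable (fun p : Euc n × Euc n => ρ p.1 * avgKernel S p.1 p.2)
      ((σ.restrict Sᶜ).prod volume) :=
    ((hρ.comp measurable_fst).mul (measurable_avgKernel S)).aestronglyMeasurable
  rw [integrable_prod_iff hm]
  refine ⟨Eventually.of_forall fun z => (integrable_avgKernel S z).const_mul (ρ z), ?_⟩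
  refine Integrable.of_bound hm.norm.integral_prod_right' 1 (Eventually.of_forall fun z => ?_)
  rw [Real.norm_of_nonneg (integral_nonneg fun _ => norm_nonneg _)]
  simp only [norm_mul, Real.norm_eq_abs, abs_of_nonneg (avgKernel_nonneg S _ _)]
  rw [integral_const_mul]
  refine mul_le_one₀ (hρ1 z) (integral_nonneg fun _ => avgKernel_nonneg S _ _) ?_
  rcases (infDist_nonneg (x := z) (s := S)).eq_or_lt with h | h
  · rw [integral_congr_ae (Eventually.of_forall fun y => avgKernel_eq_zero_of_le (by
      rw [← h]; simp))]
    simp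
  · exact (integral_avgKernel h).le

theorem integrable_avgDensity (hρ : Measurable ρ) (hρ1 : ∀ z, |ρ z| ≤ 1) (S : Set (Euc n)) :
    Integrable (avgDensity σ ρ S) volume :=
  (integrable_prod_avgKernel hρ hρ1 S).integral_prod_right

theorem exists_avgDensity_bound (hρ1 : ∀ z, |ρ z| ≤ 1) (L : ℕ)
    (hne : (growthSet σ L).Nonempty) :
    ∃ B : ℝ, ∀ y, |avgDensity σ ρ (growthSet σ L) y| ≤ B := by
  set S := growthSet σ L with hS
  set c := volume.real (ball (0 : Euc n) 1) with hc
  have hc0 : 0 < c := measureReal_ball_pos _ one_pos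
  refine ⟨6 ^ n * L / c, fun y => ?_⟩
  rcases (infDist_nonneg (x := y) (s := S)).eq_or_lt with h | h
  · have : avgDensity σ ρ S y = 0 := by
      rw [avgDensity]
      refine integral_eq_zero_of_ae (Eventually.of_forall fun z => ?_)
      have : avgKernel S z y = 0 := by
        by_contra hne
        exact (avgKernel_ne_zero_imp hne).1.ne h
      simp [this]
    rw [this, abs_zero]
    positivity
  · obtain ⟨p, hp, hpy⟩ := (isClosed_growthSet σ L).exists_infDist_eq_dist hne y
    set d := infDist y S with hd
    have hb : ∀ z, ‖ρ z * avgKernel S z y‖ ≤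
        (closedBall p (2 * d)).indicator (fun _ => ((d / 3) ^ n * c)⁻¹) z := fun z => by
      rw [norm_mul, Real.norm_of_nonneg (avgKernel_nonneg S z y)]
      refine (mul_le_of_le_one_left (avgKernel_nonneg S z y) (hρ1 z)).trans ?_
      by_cases hz : avgKernel S z y = 0
      · rw [hz]
        exact Set.indicator_nonneg (fun _ _ => by positivity) _
      · obtain ⟨-, h1, h2⟩ := avgKernel_ne_zero_imp hz
        rw [Set.indicator_of_mem]
        · exact h2
        · rw [mem_closedBall]
          linarith [dist_triangle z y p]
    have hI : Integrable ((closedBall p (2 * d)).indicator (fun _ => ((d / 3) ^ n * c)⁻¹))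
        (σ.restrict Sᶜ) := (integrable_const _).indicator measurableSet_closedBall
    refine (norm_integral_le_of_norm_le hI (Eventually.of_forall hb)).trans ?_
    rw [integral_indicator measurableSet_closedBall, setIntegral_const, smul_eq_mul]
    have h3 : (σ.restrict Sᶜ).real (closedBall p (2 * d)) ≤ L * (2 * d) ^ n := by
      rw [Measure.real]
      refine ENNReal.toReal_le_of_le_ofReal (by positivity)
        ((Measure.restrict_apply_le _ _).trans (hp _ (by positivity)))
    refine (mul_le_mul_of_nonneg_right h3 (by positivity)).trans (le_of_eq ?_)
    rw [mul_pow, div_pow, show (6 : ℝ) = 2 * 3 by norm_num, mul_pow]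
    field_simp

theorem mconv_avgDensity (hρ : Measurable ρ) (hρ1 : ∀ z, |ρ z| ≤ 1) (S : Set (Euc n))
    {g : Euc n → ℝ} (hg : Continuous g) {C : ℝ} (hgC : ∀ x, |g x| ≤ C) (x : Euc n) :
    mconv volume (avgDensity σ ρ S) g x =
      ∫ z in Sᶜ, ρ z * ∫ y, avgKernel S z y * g (x - y) ∂volume ∂σ := by
  have hI : Integrable (Function.uncurry fun z y : Euc n => ρ z * avgKernel S z y * g (x - y))
      ((σ.restrict Sᶜ).prod volume) :=
    (integrable_prod_avgKernel hρ hρ1 S).mul_bdd (c := C)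
      (hg.comp (by fun_prop : Continuous fun p : Euc n × Euc n => x - p.2)).aestronglyMeasurable
      (Eventually.of_forall fun p => hgC _)
  simp only [mconv, avgDensity, smul_eq_mul, ← integral_const_mul, ← integral_mul_const]
  rw [← integral_integral_swap hI]
  simp only [mul_assoc]

theorem abs_sub_integral_avgKernel_le {S : Set (Euc n)} {x z : Euc n} (hx : x ∈ S)
    (hz : 0 < infDist z S) {g : Euc n → ℝ} (hg : ContDiff ℝ 1 g) {B C : ℝ} (hgC : ∀ x, |g x| ≤ C)
    (hB : ∀ ζ, ‖x - z‖ / 2 ≤ ‖ζ‖ → ‖fderiv ℝ g ζ‖ ≤ B) :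
    |g (x - z) - ∫ y, avgKernel S z y * g (x - y)| ≤ B * infDist z S := by
  have hB0 : 0 ≤ B := (norm_nonneg _).trans (hB (x - z) (by linarith [norm_nonneg (x - z)]))
  have hzx : infDist z S ≤ ‖x - z‖ := by
    rw [← dist_eq_norm, dist_comm]; exact infDist_le_dist_of_mem hx
  have hI : Integrable (fun y => avgKernel S z y * g (x - y)) volume :=
    (integrable_avgKernel S z).mul_bdd (c := C)
      (hg.continuous.comp (by fun_prop : Continuous fun y : Euc n => x - y)).aestronglyMeasurable
      (Eventually.of_forall fun p => hgC _)
  have h1 : g (x - z) - ∫ y, avgKernel S z y * g (x - y) =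
      ∫ y, avgKernel S z y * (g (x - z) - g (x - y)) := by
    simp only [mul_sub]
    rw [integral_sub ((integrable_avgKernel S z).mul_const _) hI, integral_mul_const,
      integral_avgKernel hz, one_mul]
  rw [h1, ← Real.norm_eq_abs]
  refine (norm_integral_le_of_norm_le ((integrable_avgKernel S z).mul_const (B * infDist z S))
    (Eventually.of_forall fun y => ?_)).trans (le_of_eq ?_)
  · rw [norm_mul, Real.norm_of_nonneg (avgKernel_nonneg S z y)]
    by_cases hy : dist y z < infDist z S / 2
    · refine mul_le_mul_of_nonneg_left ?_ (avgKernel_nonneg S z y)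
      have hball : ∀ ζ ∈ ball (x - z) (infDist z S / 2), ‖x - z‖ / 2 ≤ ‖ζ‖ := fun ζ hζ => by
        rw [mem_ball, dist_comm, dist_eq_norm] at hζ
        linarith [norm_sub_norm_le (x - z) ζ]
      have hmem : x - y ∈ ball (x - z) (infDist z S / 2) := by
        rw [mem_ball, dist_eq_norm, show x - y - (x - z) = z - y by abel, ← dist_eq_norm, dist_comm]
        exact hy
      have h2 : ‖g (x - z) - g (x - y)‖ ≤ B * ‖x - z - (x - y)‖ :=
        Convex.norm_image_sub_le_of_norm_fderiv_le (𝕜 := ℝ) (s := ball (x - z) (infDist z S / 2))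
          (fun ζ _ => (hg.differentiable one_ne_zero) ζ) (fun ζ hζ => hB ζ (hball ζ hζ))
          (convex_ball _ _) hmem (mem_ball_self (half_pos hz))
      refine h2.trans (mul_le_mul_of_nonneg_left ?_ hB0)
      rw [show x - z - (x - y) = y - z by abel, ← dist_eq_norm]
      linarith
    · rw [avgKernel_eq_zero_of_le (not_lt.1 hy), zero_mul, zero_mul]
  · rw [integral_mul_const, integral_avgKernel hz, one_mul]

end AverageKernel

section CalderonZygmund

variable {n : ℕ}

theorem exists_scaledKernel_zero_abs_bound (η : 𝓢(Euc n, ℝ)) (i : ℕ) :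
    ∃ C : ℝ, ∀ x, |scaledKernel 0 i η x| ≤ C := by
  obtain ⟨C, hC0, hC⟩ := exists_scaledKernel_bound 0 η 0 0
  refine ⟨C * (2 ^ (i * n) * 2 ^ (i * 0) / 2 ^ (i * 0)), fun x => ?_⟩
  have := hC i x
  rwa [norm_iteratedFDeriv_zero, pow_zero, div_one, Real.norm_eq_abs] at this

theorem exists_enorm_mconv_sub_mconv_avgDensity_le (η : 𝓢(Euc n, ℝ)) :
    ∃ C : ℝ, 0 ≤ C ∧ ∀ (σ : Measure (Euc n)) [IsFiniteMeasure σ] (ρ : Euc n → ℝ),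
      Measurable ρ → (∀ z, |ρ z| ≤ 1) → ∀ S : Set (Euc n), IsClosed S → ∀ x ∈ S, ∀ i : ℕ,
      ‖mconv (σ.restrict Sᶜ) ρ (scaledKernel 0 i η) x -
        mconv volume (avgDensity σ ρ S) (scaledKernel 0 i η) x‖ₑ ≤
      ∫⁻ z in Sᶜ, ENNReal.ofReal (C * infDist z S *
        (2 ^ (i * (n + 1)) / (1 + 2 ^ i * ‖x - z‖) ^ (n + 2))) ∂σ := by
  obtain ⟨C, hC0, hC⟩ := exists_scaledKernel_bound 0 η 1 (n + 2)
  refine ⟨C * 2 ^ (n + 2), by positivity, fun σ _ ρ hρ hρ1 S hS x hx i => ?_⟩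
  set g := scaledKernel 0 i η with hg
  have hgs : ContDiff ℝ 1 g := (contDiff_scaledKernel 0 i η).of_le (mod_cast le_top)
  obtain ⟨M, hM⟩ := exists_scaledKernel_zero_abs_bound η i
  have hρi : Integrable ρ (σ.restrict Sᶜ) := integrable_of_abs_le_one _ hρ hρ1
  have h1 : Integrable (fun z => ρ z * g (x - z)) (σ.restrict Sᶜ) :=
    hρi.mul_bdd (c := M) (hgs.continuous.comp
      (by fun_prop : Continuous fun y : Euc n => x - y)).aestronglyMeasurable
      (Eventually.of_forall fun p => hM _)
  have h2 : Integrable (fun z => ρ z * ∫ y, avgKernel S z y * g (x - y)) (σ.restrict Sᶜ) := by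
    have hI : Integrable (Function.uncurry fun z y : Euc n => ρ z * avgKernel S z y * g (x - y))
        ((σ.restrict Sᶜ).prod volume) :=
      (integrable_prod_avgKernel hρ hρ1 S).mul_bdd (c := M)
        (hgs.continuous.comp
          (by fun_prop : Continuous fun p : Euc n × Euc n => x - p.2)).aestronglyMeasurable
        (Eventually.of_forall fun p => hM _)
    have := hI.integral_prod_left
    simpa only [Function.uncurry, mul_assoc, integral_const_mul] using this
  rw [mconv_avgDensity hρ hρ1 S hgs.continuous hM, mconv]
  simp only [smul_eq_mul]
  rw [← integral_sub h1 h2]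
  refine (enorm_integral_le_lintegral_enorm _).trans ?_
  refine setLIntegral_mono_ae' hS.measurableSet.compl (Eventually.of_forall fun z hz => ?_)
  have hd : 0 < infDist z S := (hS.notMem_iff_infDist_pos ⟨x, hx⟩).1 hz
  rw [← mul_sub, ← ofReal_norm]
  refine ENNReal.ofReal_le_ofReal ?_
  rw [norm_mul, Real.norm_eq_abs, Real.norm_eq_abs]
  refine (mul_le_mul_of_nonneg_right (hρ1 z) (abs_nonneg _)).trans ?_
  rw [one_mul]
  refine (abs_sub_integral_avgKernel_le hx hd hgs hM
    (B := C * 2 ^ (n + 2) * (2 ^ (i * (n + 1)) / (1 + 2 ^ i * ‖x - z‖) ^ (n + 2)))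
    fun ζ hζ => ?_).trans (le_of_eq (by ring))
  rw [← norm_iteratedFDeriv_one]
  refine (hC i ζ).trans ?_
  have h3 : (1 + 2 ^ i * ‖x - z‖) ^ (n + 2) ≤ 2 ^ (n + 2) * (1 + 2 ^ i * ‖ζ‖) ^ (n + 2) := by
    rw [← mul_pow]
    refine pow_le_pow_left₀ (by positivity) ?_ _
    have : (2:ℝ) ^ i * ‖x - z‖ ≤ 2 ^ i * (2 * ‖ζ‖) :=
      mul_le_mul_of_nonneg_left (by linarith) (by positivity)
    linarith
  rw [Nat.mul_zero, pow_zero, div_one, mul_one, ← pow_add, ← Nat.mul_succ, Nat.succ_eq_add_one,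
    mul_assoc C, ← mul_div_assoc, ← mul_div_assoc, div_le_div_iff₀ (by positivity) (by positivity)]
  calc C * 2 ^ (i * (n + 1)) * (1 + 2 ^ i * ‖x - z‖) ^ (n + 2)
      ≤ C * 2 ^ (i * (n + 1)) * (2 ^ (n + 2) * (1 + 2 ^ i * ‖ζ‖) ^ (n + 2)) := by gcongr
    _ = _ := by ring

theorem ae_summable_mconv_sub_mconv_avgDensity (σ : Measure (Euc n)) [IsFiniteMeasure σ]
    {ρ : Euc n → ℝ} (hρ : Measurable ρ) (hρ1 : ∀ z, |ρ z| ≤ 1) (η : 𝓢(Euc n, ℝ))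
    {S : Set (Euc n)} (hS : IsClosed S) :
    ∀ᵐ x, x ∈ S → Summable fun i => mconv (σ.restrict Sᶜ) ρ (scaledKernel 0 i η) x -
        mconv volume (avgDensity σ ρ S) (scaledKernel 0 i η) x := by
  obtain ⟨C, hC0, hC⟩ := exists_enorm_mconv_sub_mconv_avgDensity_le η
  obtain ⟨D, hD0, hD⟩ := exists_lintegral_tail_le n
  rw [← ae_restrict_iff' hS.measurableSet]
  set G : Euc n → ℝ≥0∞ := fun x => ∫⁻ z in Sᶜ, ENNReal.ofReal (2 * C * infDist z S) *
    ENNReal.ofReal (1 / ‖x - z‖ ^ (n + 1)) ∂σ with hG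
  have hmeas : Measurable (Function.uncurry fun x z : Euc n =>
      ENNReal.ofReal (2 * C * infDist z S) * ENNReal.ofReal (1 / ‖x - z‖ ^ (n + 1))) := by
    have h1 : Continuous fun p : Euc n × Euc n => 2 * C * infDist p.2 S :=
      continuous_const.mul ((continuous_infDist_pt S).comp continuous_snd)
    have h2 : Measurable fun p : Euc n × Euc n => 1 / ‖p.1 - p.2‖ ^ (n + 1) :=
      measurable_const.div
        ((by fun_prop : Continuous fun p : Euc n × Euc n => ‖p.1 - p.2‖ ^ (n + 1)).measurable)
    exact h1.measurable.ennreal_ofReal.mul h2.ennreal_ofReal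
  have hGm : Measurable G := hmeas.lintegral_prod_right'
  have hGfin : ∫⁻ x in S, G x ≠ ∞ := by
    rw [hG, lintegral_lintegral_swap hmeas.aemeasurable]
    have : ∀ z ∈ Sᶜ, ∫⁻ x in S, ENNReal.ofReal (2 * C * infDist z S) *
        ENNReal.ofReal (1 / ‖x - z‖ ^ (n + 1)) ≤ ENNReal.ofReal (2 * C * D) := fun z hz => by
      rcases S.eq_empty_or_nonempty with rfl | hne
      · simp
      have hd : 0 < infDist z S := (hS.notMem_iff_infDist_pos hne).1 hz
      rw [lintegral_const_mul' _ _ ENNReal.ofReal_ne_top]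
      refine (mul_le_mul_right (hD z _ hd S hS.measurableSet fun x hx => ?_) _).trans ?_
      · rw [← dist_eq_norm, dist_comm]; exact infDist_le_dist_of_mem hx
      · rw [← ENNReal.ofReal_mul (by positivity)]
        refine ENNReal.ofReal_le_ofReal (le_of_eq ?_)
        field_simp
    refine ((setLIntegral_mono_ae' hS.measurableSet.compl (Eventually.of_forall this)).trans_lt
      ?_).ne
    rw [lintegral_const]
    exact ENNReal.mul_lt_top ENNReal.ofReal_lt_top (measure_lt_top _ _)
  filter_upwards [ae_lt_top hGm hGfin, ae_restrict_mem hS.measurableSet] with x hx hxS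
  refine Summable.of_enorm (ne_of_lt (lt_of_le_of_lt ?_ hx))
  refine (ENNReal.tsum_le_tsum fun i => hC σ ρ hρ hρ1 S hS x hxS i).trans ?_
  rw [← lintegral_tsum fun i => ?_]
  · refine setLIntegral_mono_ae' hS.measurableSet.compl (Eventually.of_forall fun z hz => ?_)
    have hd : 0 < infDist z S := (hS.notMem_iff_infDist_pos ⟨x, hxS⟩).1 hz
    have ht : 0 < ‖x - z‖ := by
      refine norm_pos_iff.2 (sub_ne_zero.2 ?_)
      rintro rfl; exact hz hxS
    rw [ENNReal.tsum_eq_iSup_nat]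
    refine iSup_le fun N => ?_
    rw [← ENNReal.ofReal_sum_of_nonneg fun i _ => by positivity,
      ← Finset.mul_sum, ← ENNReal.ofReal_mul (by positivity)]
    refine ENNReal.ofReal_le_ofReal ?_
    refine (mul_le_mul_of_nonneg_left (sum_dyadic_kernel_le N ht) (by positivity)).trans
      (le_of_eq (by ring))
  · refine Measurable.aemeasurable (Measurable.ennreal_ofReal (Continuous.measurable ?_))
    refine (continuous_const.mul (continuous_infDist_pt S)).mul
      (continuous_const.div (by fun_prop) fun z => by positivity)

theorem ae_tendsto_sum_mconv_of_memLp_two (σ : Measure (Euc n)) [IsFiniteMeasure σ]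
    {ρ : Euc n → ℝ} (hρ : Measurable ρ) (hρ1 : ∀ z, |ρ z| ≤ 1) (η : 𝓢(Euc n, ℝ))
    (hη : ∀ g : Euc n → ℝ, Integrable g → MemLp g 2 volume → ∀ᵐ x, ∃ c,
      Tendsto (fun N => ∑ i ∈ Finset.range N, mconv volume g (scaledKernel 0 i η) x)
        atTop (𝓝 c)) :
    ∀ᵐ x, ∃ c, Tendsto (fun N => ∑ i ∈ Finset.range N, mconv σ ρ (scaledKernel 0 i η) x)
      atTop (𝓝 c) := by
  have key : ∀ L : ℕ, ∀ᵐ x, x ∈ growthSet σ L → ∃ c,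
      Tendsto (fun N => ∑ i ∈ Finset.range N, mconv σ ρ (scaledKernel 0 i η) x)
        atTop (𝓝 c) := fun L => by
    rcases (growthSet σ L).eq_empty_or_nonempty with hne | hne
    · exact Eventually.of_forall fun x hx => absurd hx (hne ▸ Set.notMem_empty x)
    set S := growthSet σ L with hS
    have hSc : IsClosed S := isClosed_growthSet σ L
    obtain ⟨h, hh1, hh2, hh⟩ := exists_memLp_two_density σ L hρ hρ1
    obtain ⟨B, hB⟩ := exists_avgDensity_bound (σ := σ) hρ1 L hne
    have ha := integrable_avgDensity (σ := σ) hρ hρ1 S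
    filter_upwards [hη h hh1 hh2, hη _ ha (memLp_two_of_integrable_of_bound ha
      (Eventually.of_forall hB)), ae_summable_mconv_sub_mconv_avgDensity σ hρ hρ1 η hSc]
      with x ⟨c₁, h₁⟩ ⟨c₂, h₂⟩ h₃ hx
    refine ⟨c₁ + c₂ + _, ((h₁.add h₂).add (h₃ hx).hasSum.tendsto_sum_nat).congr fun N => ?_⟩
    rw [← Finset.sum_add_distrib, ← Finset.sum_add_distrib]
    refine Finset.sum_congr rfl fun i _ => ?_
    obtain ⟨M, hM⟩ := exists_scaledKernel_zero_abs_bound η i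
    have hc := (contDiff_scaledKernel 0 i η).continuous
    rw [← hh _ hc M hM x, add_assoc, add_sub_cancel]
    have hi : Integrable (fun z => ρ z • scaledKernel 0 i η (x - z)) σ :=
      (integrable_of_abs_le_one _ hρ hρ1).mul_bdd (c := M) (hc.comp
        (by fun_prop : Continuous fun y : Euc n => x - y)).aestronglyMeasurable
        (Eventually.of_forall fun p => hM _)
    exact integral_add_compl hSc.measurableSet hi
  filter_upwards [ae_all_iff.2 key, ae_exists_mem_growthSet σ] with x hx ⟨L, hL⟩
  exact hx L hL

end CalderonZygmund

open scoped FourierTransform LineDeriv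

section Multiplier

variable {n : ℕ}

theorem exists_schwartzMap_dilation (s : 𝓢(Euc n, ℂ)) (i : ℕ) (x : Euc n) :
    ∃ T : 𝓢(Euc n, ℂ), ∀ z, T z = (2 : ℂ) ^ (i * n) * s ((2 : ℝ) ^ i • (x - z)) := by
  have h2 : (0 : ℝ) < 2 ^ i := by positivity
  have hg : Function.HasTemperateGrowth fun z : Euc n => (2 : ℝ) ^ i • (x - z) := by fun_prop
  have ha : AntilipschitzWith (Real.toNNReal ((2 ^ i)⁻¹)) fun z : Euc n => (2 : ℝ) ^ i • (x - z) := by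
    refine AntilipschitzWith.of_le_mul_dist fun y z => ?_
    rw [dist_eq_norm, dist_eq_norm, ← smul_sub, norm_smul, Real.norm_of_nonneg h2.le,
      Real.coe_toNNReal _ (by positivity), inv_mul_cancel_left₀ h2.ne', sub_sub_sub_cancel_left,
      norm_sub_rev]
  exact ⟨(2 : ℂ) ^ (i * n) • SchwartzMap.compCLMOfAntilipschitz ℂ hg ha s, fun z => rfl⟩

theorem fourierInv_dilation {s T : 𝓢(Euc n, ℂ)} {i : ℕ} {x : Euc n}
    (hT : ∀ z, T z = (2 : ℂ) ^ (i * n) * s ((2 : ℝ) ^ i • (x - z))) (ξ : Euc n) :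
    𝓕⁻ T ξ = Real.fourierChar ⟪x, ξ⟫ • 𝓕 s (((2 : ℝ) ^ i)⁻¹ • ξ) := by
  have h2 : (2 : ℝ) ^ i ≠ 0 := by positivity
  rw [SchwartzMap.fourierInv_coe, SchwartzMap.fourier_coe, Real.fourierInv_eq, Real.fourier_eq]
  set G : Euc n → ℂ := fun w => Real.fourierChar ⟪x - ((2 : ℝ) ^ i)⁻¹ • w, ξ⟫ • s w with hG
  have h1 : ∀ v, Real.fourierChar ⟪v, ξ⟫ • T v = (2 : ℂ) ^ (i * n) * G ((2 : ℝ) ^ i • (x - v)) := by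
    intro v
    rw [hT, hG]
    simp only
    rw [inv_smul_smul₀ h2, sub_sub_cancel, mul_smul_comm]
  simp_rw [h1]
  rw [integral_const_mul, integral_sub_left_eq_self (fun v => G ((2 : ℝ) ^ i • v)) volume x,
    Measure.integral_comp_smul, finrank_euclideanSpace_fin, abs_of_pos (by positivity), ← pow_mul,
    Complex.real_smul, Complex.ofReal_inv, Complex.ofReal_pow, Complex.ofReal_ofNat,
    mul_inv_cancel_left₀ (pow_ne_zero _ two_ne_zero), Circle.smul_def, smul_eq_mul,
    ← integral_const_mul]
  refine integral_congr_ae (Eventually.of_forall fun w => ?_)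
  simp only [hG]
  rw [← smul_eq_mul, ← Circle.smul_def, ← mul_smul, ← AddChar.map_add_eq_mul, inner_sub_left, real_inner_smul_left,
    real_inner_smul_right, sub_eq_add_neg]

theorem integral_mul_dilation_eq (G : Lp (α := Euc n) ℂ 2) (s : 𝓢(Euc n, ℂ)) (i : ℕ) (x : Euc n) :
    ∫ z, ((2 : ℂ) ^ (i * n) * s ((2 : ℝ) ^ i • (x - z))) * G z =
      ∫ ξ, (Real.fourierChar ⟪x, ξ⟫ • 𝓕 s (((2 : ℝ) ^ i)⁻¹ • ξ)) * (𝓕 G : Lp (α := Euc n) ℂ 2) ξ := by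
  obtain ⟨T, hT⟩ := exists_schwartzMap_dilation s i x
  have h1 : Lp.toTemperedDistribution (𝓕 G : Lp (α := Euc n) ℂ 2 volume) (𝓕⁻ T) =
      Lp.toTemperedDistribution G T := by
    rw [← Lp.fourier_toTemperedDistribution_eq, TemperedDistribution.fourier_apply,
      FourierTransform.fourier_fourierInv_eq]
  rw [Lp.toTemperedDistribution_apply, Lp.toTemperedDistribution_apply] at h1
  simp only [hT, fourierInv_dilation hT, smul_eq_mul] at h1
  exact h1.symm

theorem integrable_dilation_fourier_mul (G : Lp (α := Euc n) ℂ 2) (s : 𝓢(Euc n, ℂ)) (i : ℕ)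
    (x : Euc n) : Integrable fun ξ =>
      (Real.fourierChar ⟪x, ξ⟫ • 𝓕 s (((2 : ℝ) ^ i)⁻¹ • ξ)) * G ξ := by
  obtain ⟨T, hT⟩ := exists_schwartzMap_dilation s i x
  have h1 : MemLp (𝓕⁻ T : 𝓢(Euc n, ℂ)) 2 volume := (𝓕⁻ T).memLp 2 volume
  refine (MemLp.integrable_mul h1 (Lp.memLp G)).congr (Eventually.of_forall fun ξ => ?_)
  rw [Pi.mul_apply, fourierInv_dilation hT]

theorem integrable_dilation_mul (G : Lp (α := Euc n) ℂ 2) (s : 𝓢(Euc n, ℂ)) (i : ℕ)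
    (x : Euc n) : Integrable fun z =>
      ((2 : ℂ) ^ (i * n) * s ((2 : ℝ) ^ i • (x - z))) * G z := by
  obtain ⟨T, hT⟩ := exists_schwartzMap_dilation s i x
  refine (MemLp.integrable_mul (T.memLp 2 volume) (Lp.memLp G)).congr
    (Eventually.of_forall fun ξ => ?_)
  rw [Pi.mul_apply, hT]

/-- Approximate identities converge at Lebesgue points of square integrable functions. -/
theorem ae_tendsto_integral_dilation_mul (h : Lp (α := Euc n) ℂ 2) (φ : 𝓢(Euc n, ℂ)) :
    ∀ᵐ x, Tendsto (fun i : ℕ => ∫ z, ((2 : ℂ) ^ (i * n) * φ ((2 : ℝ) ^ i • (x - z))) * h z) atTop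
      (𝓝 ((∫ z, φ z) * h x)) := by
  have hh := Lp.memLp h
  have hloc : LocallyIntegrable h volume := hh.locallyIntegrable (by norm_num)
  obtain ⟨C, hC0, hC⟩ : ∃ C, 0 ≤ C ∧ ∀ x, ‖φ x‖ ≤ C / (1 + ‖x‖) ^ (n + 1) := by
    simpa only [norm_iteratedFDeriv_zero] using exists_schwartz_bound φ 0 (n + 1)
  filter_upwards [ae_tendsto_lebesguePoint hloc] with x hx
  set τ := volume.withDensity fun z => ‖h z - h x‖ₑ with hτ
  have hM : ∃ M : ℝ, ∀ r, 1 ≤ r → τ (ball x r) ≤ ENNReal.ofReal (M * r ^ n) := by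
    have hH : ∫⁻ z, ‖h z‖ₑ ^ 2 ≠ ∞ := by
      have := (hh.integrable_norm_pow two_ne_zero).hasFiniteIntegral.ne
      simpa [enorm_pow] using this
    refine ⟨(1 + ‖h x‖) * volume.real (ball (0 : Euc n) 1) + (∫⁻ z, ‖h z‖ₑ ^ 2).toReal,
      fun r hr => ?_⟩
    have hr0 : 0 ≤ r := zero_le_one.trans hr
    have hpt : ∀ z, ‖h z - h x‖ₑ ≤ ENNReal.ofReal (1 + ‖h x‖) + ‖h z‖ₑ ^ 2 := fun z => by
      have h1 : ‖h z‖ₑ ≤ 1 + ‖h z‖ₑ ^ 2 := by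
        rcases le_total ‖h z‖ₑ 1 with h | h
        · exact h.trans le_self_add
        · exact (le_self_pow h two_ne_zero).trans le_add_self
      rw [ENNReal.ofReal_add zero_le_one (norm_nonneg _), ofReal_norm, ENNReal.ofReal_one]
      calc ‖h z - h x‖ₑ ≤ ‖h z‖ₑ + ‖h x‖ₑ := enorm_sub_le
        _ ≤ (1 + ‖h z‖ₑ ^ 2) + ‖h x‖ₑ := by gcongr
        _ = _ := by ring
    rw [withDensity_apply _ measurableSet_ball]
    calc ∫⁻ z in ball x r, ‖h z - h x‖ₑ
        ≤ ∫⁻ z in ball x r, (ENNReal.ofReal (1 + ‖h x‖) + ‖h z‖ₑ ^ 2) := lintegral_mono hpt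
      _ = ENNReal.ofReal (1 + ‖h x‖) * volume (ball x r) + ∫⁻ z in ball x r, ‖h z‖ₑ ^ 2 := by
        rw [lintegral_add_left measurable_const, setLIntegral_const]
      _ ≤ ENNReal.ofReal (1 + ‖h x‖) * volume (ball x r) + ∫⁻ z, ‖h z‖ₑ ^ 2 :=
        add_le_add le_rfl (setLIntegral_le_lintegral _ _)
      _ ≤ _ := by
        rw [Measure.addHaar_ball_of_pos volume x (zero_lt_one.trans_le hr),
          finrank_euclideanSpace_fin, add_mul, ENNReal.ofReal_add
            (p := (1 + ‖h x‖) * volume.real (ball (0 : Euc n) 1) * r ^ n)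
            (by positivity) (by positivity)]
        refine add_le_add (le_of_eq ?_) ?_
        · rw [ENNReal.ofReal_mul (by positivity), ENNReal.ofReal_mul (by positivity),
            ofReal_measureReal measure_ball_lt_top.ne]
          ring
        · refine le_trans (ENNReal.ofReal_toReal hH).ge (ENNReal.ofReal_le_ofReal ?_)
          exact le_mul_of_one_le_right ENNReal.toReal_nonneg (one_le_pow₀ hr)
  obtain ⟨M, hM⟩ := hM
  obtain ⟨e, -, he0, het, he⟩ := exists_dyadicKernel_bound τ x hx hM
  rw [tendsto_iff_norm_sub_tendsto_zero]
  refine squeeze_zero (fun _ => norm_nonneg _) (fun i => ?_)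
    (show Tendsto (fun i => C * e i) atTop (𝓝 0) by simpa using het.const_mul C)
  have h2 : (2 : ℝ) ^ i ≠ 0 := by positivity
  have h1 : (∫ z, φ z) * h x = ∫ z, ((2 : ℂ) ^ (i * n) * φ ((2 : ℝ) ^ i • (x - z))) * h x := by
    rw [integral_mul_const, integral_const_mul,
      integral_sub_left_eq_self (fun v => φ ((2 : ℝ) ^ i • v)) volume x,
      Measure.integral_comp_smul, finrank_euclideanSpace_fin, abs_of_pos (by positivity), ← pow_mul,
      Complex.real_smul, Complex.ofReal_inv, Complex.ofReal_pow, Complex.ofReal_ofNat,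
      mul_inv_cancel_left₀ (pow_ne_zero _ two_ne_zero)]
  obtain ⟨T, hT⟩ := exists_schwartzMap_dilation φ i x
  have hTi : Integrable fun z => ((2 : ℂ) ^ (i * n) * φ ((2 : ℝ) ^ i • (x - z))) * h x :=
    (T.integrable.mul_const (h x)).congr (Eventually.of_forall fun z => by simp only [hT])
  rw [h1, ← integral_sub (integrable_dilation_mul h φ i x) hTi]
  simp only [← mul_sub]
  have hfin : ‖∫ z, ((2 : ℂ) ^ (i * n) * φ ((2 : ℝ) ^ i • (x - z))) * (h z - h x)‖ₑ ≤
      ENNReal.ofReal (C * e i) := by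
    refine (enorm_integral_le_lintegral_enorm _).trans ?_
    have hm : AEMeasurable fun z => ‖h z - h x‖ₑ :=
      (hh.1.sub aestronglyMeasurable_const).enorm
    have hd : Continuous fun z => dyadicKernel n i x z := continuous_dyadicKernel i x
    calc ∫⁻ z, ‖((2 : ℂ) ^ (i * n) * φ ((2 : ℝ) ^ i • (x - z))) * (h z - h x)‖ₑ
        ≤ ∫⁻ z, ENNReal.ofReal C * (‖h z - h x‖ₑ * ENNReal.ofReal (dyadicKernel n i x z)) := by
          refine lintegral_mono fun z => ?_
          rw [enorm_mul, mul_comm ‖h z - h x‖ₑ, ← mul_assoc, ← ENNReal.ofReal_mul hC0]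
          gcongr
          rw [← ofReal_norm]
          refine ENNReal.ofReal_le_ofReal ?_
          rw [norm_mul, norm_pow, RCLike.norm_ofNat, dyadicKernel]
          have := hC ((2 : ℝ) ^ i • (x - z))
          rw [norm_smul, Real.norm_of_nonneg (by positivity)] at this
          refine (mul_le_mul_of_nonneg_left this (by positivity)).trans (le_of_eq (by ring))
      _ = ENNReal.ofReal C * ∫⁻ z, ENNReal.ofReal (dyadicKernel n i x z) ∂τ := by
          rw [lintegral_const_mul' _ _ ENNReal.ofReal_ne_top, hτ,
            lintegral_withDensity_eq_lintegral_mul₀ hm hd.measurable.ennreal_ofReal.aemeasurable]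
          rfl
      _ ≤ _ := by
          rw [ENNReal.ofReal_mul hC0]
          exact mul_le_mul_right (he i) _
  rw [← ofReal_norm] at hfin
  exact (ENNReal.ofReal_le_ofReal_iff (mul_nonneg hC0 (he0 i))).1 hfin

/-- The real part of a complex-valued Schwartz function. -/
def schwartzRe (s : 𝓢(Euc n, ℂ)) : 𝓢(Euc n, ℝ) := s.postcompCLM Complex.reCLM

theorem schwartzRe_apply (s : 𝓢(Euc n, ℂ)) (x : Euc n) : schwartzRe s x = (s x).re := rfl

theorem ae_tendsto_sum_mconv_of_multiplier {η φ : 𝓢(Euc n, ℂ)} {M : Euc n → ℂ}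
    (hMm : Measurable M) {C : ℝ} (hMb : ∀ ξ, ‖M ξ‖ ≤ C) (hMh : ∀ ξ, M ((2 : ℝ)⁻¹ • ξ) = M ξ)
    (hη : ∀ ξ, 𝓕 η ξ = M ξ * (𝓕 φ ((2 : ℝ)⁻¹ • ξ) - 𝓕 φ ξ)) {g : Euc n → ℝ}
    (hg : MemLp g 2 volume) :
    ∀ᵐ x, ∃ c, Tendsto (fun N => ∑ i ∈ Finset.range N,
      mconv volume g (scaledKernel 0 i (schwartzRe η)) x) atTop (𝓝 c) := by
  set G : Lp (α := Euc n) ℂ 2 volume := (hg.ofReal (K := ℂ)).toLp with hG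
  have hMG : MemLp (fun ξ => M ξ * (𝓕 G : Lp (α := Euc n) ℂ 2 volume) ξ) 2 volume := by
    refine (Lp.memLp (𝓕 G)).of_le_mul (c := C)
      (hMm.aestronglyMeasurable.mul (Lp.aestronglyMeasurable _)) (Eventually.of_forall fun ξ => ?_)
    rw [norm_mul]
    exact mul_le_mul_of_nonneg_right (hMb ξ) (norm_nonneg _)
  set H : Lp (α := Euc n) ℂ 2 volume := hMG.toLp with hH
  set h : Lp (α := Euc n) ℂ 2 volume := 𝓕⁻ H with hh
  have hFh : 𝓕 h = H := FourierTransform.fourier_fourierInv_eq H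
  have hMi : ∀ (i : ℕ) ξ, M (((2 : ℝ) ^ i)⁻¹ • ξ) = M ξ := fun i => by
    induction i with
    | zero => simp
    | succ i ih => intro ξ; rw [pow_succ, mul_inv_rev, mul_smul, hMh, ih]
  have hsum : ∀ N x, ∑ i ∈ Finset.range N, mconv volume g (scaledKernel 0 i (schwartzRe η)) x =
      ((∫ z, ((2 : ℂ) ^ (N * n) * φ ((2 : ℝ) ^ N • (x - z))) * h z) -
        ∫ z, ((2 : ℂ) ^ (0 * n) * φ ((2 : ℝ) ^ 0 • (x - z))) * h z).re := by
    intro N x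
    have h1 : ∀ i, (∫ z, ((2 : ℂ) ^ (i * n) * η ((2 : ℝ) ^ i • (x - z))) * G z) =
        (∫ z, ((2 : ℂ) ^ ((i + 1) * n) * φ ((2 : ℝ) ^ (i + 1) • (x - z))) * h z) -
        ∫ z, ((2 : ℂ) ^ (i * n) * φ ((2 : ℝ) ^ i • (x - z))) * h z := fun i => by
      rw [integral_mul_dilation_eq, integral_mul_dilation_eq, integral_mul_dilation_eq, hFh,
        ← integral_sub (integrable_dilation_fourier_mul _ _ _ _)
          (integrable_dilation_fourier_mul _ _ _ _)]
      refine integral_congr_ae ?_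
      filter_upwards [hMG.coeFn_toLp] with ξ hξ
      rw [← hH] at hξ
      rw [hξ, hη, hMi, pow_succ, mul_inv_rev, mul_smul]
      simp only [Circle.smul_def, smul_eq_mul]
      ring
    have h2 : ∀ i, mconv volume g (scaledKernel 0 i (schwartzRe η)) x =
        (∫ z, ((2 : ℂ) ^ (i * n) * η ((2 : ℝ) ^ i • (x - z))) * G z).re := fun i => by
      rw [← RCLike.re_eq_complex_re, ← integral_re (integrable_dilation_mul G η i x), mconv]
      refine integral_congr_ae ?_
      filter_upwards [(hg.ofReal (K := ℂ)).coeFn_toLp] with z hz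
      rw [← hG] at hz
      rw [hz, RCLike.re_eq_complex_re, scaledKernel, schwartzRe_apply, Nat.mul_zero, pow_zero,
        div_one, smul_eq_mul]
      have : ((2 : ℂ) ^ (i * n)) = (((2 : ℝ) ^ (i * n) : ℝ) : ℂ) := by push_cast; rfl
      rw [this, RCLike.ofReal_eq_complex_ofReal, Complex.re_mul_ofReal, Complex.re_ofReal_mul]
      ring
    simp only [h2, h1]
    rw [← Complex.re_sum, Finset.sum_range_sub
      (fun i => ∫ z, ((2 : ℂ) ^ (i * n) * φ ((2 : ℝ) ^ i • (x - z))) * h z)]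
  filter_upwards [ae_tendsto_integral_dilation_mul h φ] with x hx
  refine ⟨_, ((Complex.continuous_re.tendsto _).comp (hx.sub_const
    (∫ z, ((2 : ℂ) ^ (0 * n) * φ ((2 : ℝ) ^ 0 • (x - z))) * h z))).congr fun N => ?_⟩
  rw [hsum N x, Function.comp_apply]

end Multiplier

section SymbolInverse

variable {n k : ℕ} {V W : Type*}
  [NormedAddCommGroup V] [InnerProductSpace ℝ V] [FiniteDimensional ℝ V]
  [NormedAddCommGroup W] [InnerProductSpace ℝ W] [FiniteDimensional ℝ W]

theorem Ring.inverse_smul_of_ne_zero {𝕜 R : Type*} [Field 𝕜] [Ring R] [Algebra 𝕜 R] {c : 𝕜}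
    (hc : c ≠ 0) (a : R) : Ring.inverse (c • a) = c⁻¹ • Ring.inverse a := by
  have hu : IsUnit (algebraMap 𝕜 R c) := (IsUnit.mk0 c hc).map _
  have h1 : Ring.inverse (algebraMap 𝕜 R c) = algebraMap 𝕜 R c⁻¹ := by
    have h2 := Ring.inverse_mul_cancel _ hu
    calc Ring.inverse (algebraMap 𝕜 R c)
        = Ring.inverse (algebraMap 𝕜 R c) * (algebraMap 𝕜 R c * algebraMap 𝕜 R c⁻¹) := by
          rw [← map_mul, mul_inv_cancel₀ hc, map_one, mul_one]
      _ = _ := by rw [← mul_assoc, h2, one_mul]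
  rw [Algebra.smul_def, Ring.inverse_mul (Or.inl hu), h1, ← Algebra.commutes, ← Algebra.smul_def]

/-- The symbol of `A` as a continuous linear map. -/
def symbolCLM (A : CoeffOp n k V W) (ξ : Euc n) : V →L[ℝ] W :=
  ∑ I : Fin k → Fin n, (∏ i, ξ (I i)) • (A I).toContinuousLinearMap

/-- The adjoint of the symbol of `A` as a continuous linear map. -/
def symbolAdjointCLM (A : CoeffOp n k V W) (ξ : Euc n) : W →L[ℝ] V :=
  ∑ I : Fin k → Fin n, (∏ i, ξ (I i)) • (LinearMap.adjoint (A I)).toContinuousLinearMap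

/-- The left inverse `(S* S)⁻¹ S*` of the symbol `S` of `A`. -/
def symbolLeftInverse (A : CoeffOp n k V W) (ξ : Euc n) : W →L[ℝ] V :=
  (Ring.inverse ((symbolAdjointCLM A ξ).comp (symbolCLM A ξ))).comp (symbolAdjointCLM A ξ)

omit [FiniteDimensional ℝ W] in
theorem symbolCLM_apply (A : CoeffOp n k V W) (ξ : Euc n) (v : V) :
    symbolCLM A ξ v = ∑ I : Fin k → Fin n, (∏ i, ξ (I i)) • A I v := by
  simp [symbolCLM]

theorem inner_symbolAdjointCLM_apply (A : CoeffOp n k V W) (ξ : Euc n) (w : W) (v : V) :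
    ⟪symbolAdjointCLM A ξ w, v⟫ = ⟪w, symbolCLM A ξ v⟫ := by
  simp [symbolCLM_apply, symbolAdjointCLM, sum_inner, inner_sum, inner_smul_left, inner_smul_right,
    LinearMap.adjoint_inner_left]

omit [FiniteDimensional ℝ W] in
theorem symbolCLM_eq_symbolMap (A : CoeffOp n k V W) (ξ : Euc n) (v : V) :
    symbolCLM A ξ v = symbolMap n k A ξ v := by
  simp [symbolCLM_apply, symbolMap, LinearMap.sum_apply]

theorem IsElliptic.isUnit {A : CoeffOp n k V W} (hA : IsElliptic n k A) {ξ : Euc n} (hξ : ξ ≠ 0) :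
    IsUnit ((symbolAdjointCLM A ξ).comp (symbolCLM A ξ)) := by
  have := FiniteDimensional.complete ℝ V
  rw [ContinuousLinearMap.isUnit_iff_isUnit_toLinearMap, LinearMap.isUnit_iff_ker_eq_bot,
    LinearMap.ker_eq_bot']
  intro v hv
  have h1 : ⟪symbolAdjointCLM A ξ (symbolCLM A ξ v), v⟫ = 0 := by
    have : symbolAdjointCLM A ξ (symbolCLM A ξ v) = 0 := hv
    rw [this, inner_zero_left]
  rw [inner_symbolAdjointCLM_apply, inner_self_eq_zero, symbolCLM_eq_symbolMap] at h1
  exact hA ξ hξ (h1.trans (map_zero _).symm)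

theorem IsElliptic.symbolLeftInverse_apply {A : CoeffOp n k V W} (hA : IsElliptic n k A)
    {ξ : Euc n} (hξ : ξ ≠ 0) (v : V) : symbolLeftInverse A ξ (symbolCLM A ξ v) = v :=
  DFunLike.congr_fun (Ring.inverse_mul_cancel _ (hA.isUnit hξ)) v

theorem contDiff_coordProd (I : Fin k → Fin n) {m : WithTop ℕ∞} :
    ContDiff ℝ m fun ξ : Euc n => ∏ i, ξ (I i) :=
  contDiff_prod fun i _ => (EuclideanSpace.proj (𝕜 := ℝ) (I i)).contDiff

theorem coordProd_smul (I : Fin k → Fin n) (t : ℝ) (ξ : Euc n) :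
    ∏ i, (t • ξ) (I i) = t ^ k * ∏ i, ξ (I i) := by
  simp [Finset.prod_mul_distrib]

theorem IsElliptic.contDiffAt_symbolLeftInverse {A : CoeffOp n k V W} (hA : IsElliptic n k A)
    {ξ : Euc n} (hξ : ξ ≠ 0) {m : WithTop ℕ∞} : ContDiffAt ℝ m (symbolLeftInverse A) ξ := by
  have := FiniteDimensional.complete ℝ V
  have hS : ContDiff ℝ m (symbolCLM A) :=
    ContDiff.sum fun I _ => (contDiff_coordProd I).smul contDiff_const
  have hT : ContDiff ℝ m (symbolAdjointCLM A) :=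
    ContDiff.sum fun I _ => (contDiff_coordProd I).smul contDiff_const
  have h1 : ContDiffAt ℝ m (fun ξ => Ring.inverse ((symbolAdjointCLM A ξ).comp (symbolCLM A ξ))) ξ := by
    obtain ⟨u, hu⟩ := hA.isUnit hξ
    have h2 := contDiffAt_ringInverse ℝ (n := m) u
    rw [hu] at h2
    exact h2.comp ξ (hT.clm_comp hS).contDiffAt
  exact h1.clm_comp hT.contDiffAt

theorem symbolLeftInverse_smul (A : CoeffOp n k V W) {t : ℝ} (ht : t ≠ 0) (ξ : Euc n) :
    symbolLeftInverse A (t • ξ) = (t ^ k)⁻¹ • symbolLeftInverse A ξ := by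
  have hS : symbolCLM A (t • ξ) = t ^ k • symbolCLM A ξ := by
    simp only [symbolCLM, coordProd_smul, Finset.smul_sum, mul_smul]
  have hT : symbolAdjointCLM A (t • ξ) = t ^ k • symbolAdjointCLM A ξ := by
    simp only [symbolAdjointCLM, coordProd_smul, Finset.smul_sum, mul_smul]
  have hk : t ^ k ≠ 0 := pow_ne_zero _ ht
  have hTS : (t ^ k • symbolAdjointCLM A ξ).comp (t ^ k • symbolCLM A ξ) =
      (t ^ k * t ^ k) • (symbolAdjointCLM A ξ).comp (symbolCLM A ξ) := by
    rw [ContinuousLinearMap.smul_comp, ContinuousLinearMap.comp_smul, smul_smul]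
  rw [symbolLeftInverse, hS, hT, hTS, Ring.inverse_smul_of_ne_zero (mul_ne_zero hk hk), ContinuousLinearMap.smul_comp,
    ContinuousLinearMap.comp_smul, smul_smul, symbolLeftInverse, mul_inv, mul_assoc,
    inv_mul_cancel₀ hk, mul_one]

/-- Matrix coefficients of the parametrix multiplier. -/
theorem IsElliptic.exists_norm_coordProd_mul_le {A : CoeffOp n k V W} (hA : IsElliptic n k A)
    (hk : 0 < k) (J : Fin k → Fin n) (v : V) (w : W) :
    ∃ C : ℝ, ∀ ξ : Euc n, |(∏ i, ξ (J i)) * ⟪v, symbolLeftInverse A ξ w⟫| ≤ C := by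
  set M : Euc n → ℝ := fun ξ => (∏ i, ξ (J i)) * ⟪v, symbolLeftInverse A ξ w⟫ with hM
  have hc : ContinuousOn M (sphere 0 1) := by
    intro ξ hξ
    have hξ0 : ξ ≠ 0 := by
      rintro rfl
      simp at hξ
    refine ContinuousAt.continuousWithinAt (ContinuousAt.mul ?_ ?_)
    · exact (contDiff_coordProd J (m := 0)).continuous.continuousAt
    · exact continuousAt_const.inner
        ((hA.contDiffAt_symbolLeftInverse hξ0 (m := 0)).continuousAt.clm_apply continuousAt_const)
  obtain ⟨C, hC⟩ := (isCompact_sphere (0 : Euc n) 1).exists_bound_of_continuousOn hc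
  refine ⟨max C 0, fun ξ => ?_⟩
  rcases eq_or_ne ξ 0 with rfl | hξ
  · have : (∏ i, (0 : Euc n) (J i)) = 0 := Finset.prod_eq_zero (Finset.mem_univ ⟨0, hk⟩) (by simp)
    change |_ * _| ≤ _
    rw [this, zero_mul, abs_zero]
    exact le_max_right _ _
  · have h1 : M ξ = M (‖ξ‖⁻¹ • ξ) := by
      have ht : ‖ξ‖⁻¹ ≠ 0 := inv_ne_zero (norm_ne_zero_iff.2 hξ)
      simp only [hM]
      rw [coordProd_smul, symbolLeftInverse_smul A ht, _root_.smul_apply,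
        real_inner_smul_right]
      field_simp
    change |M ξ| ≤ _
    rw [h1]
    exact (hC _ (by simp [norm_smul, norm_ne_zero_iff.2 hξ])).trans (le_max_left _ _)

end SymbolInverse

section Fourier

variable {n : ℕ}

theorem fourier_iteratedLineDerivOp_apply (m : ℕ) (I : Fin m → Fin n) (f : 𝓢(Euc n, ℂ)) (ξ : Euc n) :
    𝓕 (∂^{fun i => stdVec n (I i)} f) ξ =
      (2 * Real.pi * Complex.I) ^ m * ((∏ i, ξ (I i) : ℝ) : ℂ) * 𝓕 f ξ := by
  induction m with
  | zero => simp
  | succ m ih =>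
    have hg : Function.HasTemperateGrowth fun x : Euc n => ⟪x, stdVec n (I 0)⟫ := by fun_prop
    rw [LineDeriv.iteratedLineDerivOp_succ_left, SchwartzMap.fourier_lineDerivOp_eq,
      _root_.smul_apply, SchwartzMap.smulLeftCLM_apply_apply hg]
    have h1 := ih fun i => I i.succ
    have h2 : ⟪ξ, stdVec n (I 0)⟫ = ξ (I 0) := by
      simp [stdVec, EuclideanSpace.inner_single_right]
    rw [h2]
    change _ • ((ξ (I 0)) • 𝓕 (∂^{fun i => stdVec n (I (Fin.succ i))} f) ξ) = _
    rw [h1, Fin.prod_univ_succ]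
    simp only [smul_eq_mul, Complex.real_smul, Complex.ofReal_mul]
    ring

theorem dirDeriv_schwartzRe {m : ℕ} (I : Fin m → Fin n) (s : 𝓢(Euc n, ℂ)) (x : Euc n) :
    dirDeriv n m I (schwartzRe s) x = schwartzRe (∂^{fun i => stdVec n (I i)} s) x := by
  rw [schwartzRe_apply, SchwartzMap.iteratedLineDerivOp_eq_iteratedFDeriv, dirDeriv]
  have : (schwartzRe s : Euc n → ℝ) = Complex.reCLM ∘ s := rfl
  rw [this, ContinuousLinearMap.iteratedFDeriv_comp_left _ (s.smooth ⊤).contDiffAt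
    (natCast_le_smooth m)]
  rfl

theorem fourierInv_sub_dilation (c ψ : 𝓢(Euc n, ℂ))
    (hψ : ∀ ξ, ψ ξ = c ((2 : ℝ)⁻¹ • ξ) - c ξ) (x : Euc n) :
    𝓕⁻ ψ x = 2 ^ n * 𝓕⁻ c ((2 : ℝ) • x) - 𝓕⁻ c x := by
  have hi : ∀ x, Integrable fun v : Euc n => Real.fourierChar ⟪v, x⟫ • c v := fun x => by
    have := c.integrable (μ := volume)
    refine (this.norm).mono' ?_ (Eventually.of_forall fun v => ?_)
    · refine Continuous.aestronglyMeasurable ?_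
      have : Continuous fun v : Euc n => (Real.fourierChar ⟪v, x⟫ : ℂ) :=
        (Real.continuous_fourierChar.subtype_val).comp (by fun_prop)
      exact this.mul c.continuous
    · simp
  have hi2 : Integrable fun v : Euc n => Real.fourierChar ⟪v, x⟫ • c ((2 : ℝ)⁻¹ • v) := by
    refine ((hi ((2 : ℝ) • x)).comp_smul (R := (2 : ℝ)⁻¹) (by norm_num)).congr
      (Eventually.of_forall fun v => ?_)
    simp [real_inner_smul_left, real_inner_smul_right]
  rw [SchwartzMap.fourierInv_coe, SchwartzMap.fourierInv_coe, Real.fourierInv_eq,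
    Real.fourierInv_eq, Real.fourierInv_eq]
  simp only [hψ, smul_sub]
  rw [integral_sub hi2 (hi x)]
  congr 1
  have h1 : ∀ v : Euc n, Real.fourierChar ⟪v, x⟫ • c ((2 : ℝ)⁻¹ • v) =
      (fun w => Real.fourierChar ⟪w, (2 : ℝ) • x⟫ • c w) ((2 : ℝ)⁻¹ • v) := fun v => by
    simp [real_inner_smul_left, real_inner_smul_right]
  simp_rw [h1]
  rw [Measure.integral_comp_smul volume (fun w => Real.fourierChar ⟪w, (2 : ℝ) • x⟫ • c w) (2 : ℝ)⁻¹,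
    finrank_euclideanSpace_fin]
  simp [Complex.real_smul]

end Fourier

section Parametrix

variable {n k : ℕ} {V W : Type*}
  [NormedAddCommGroup V] [InnerProductSpace ℝ V] [FiniteDimensional ℝ V]
  [NormedAddCommGroup W] [InnerProductSpace ℝ W] [FiniteDimensional ℝ W]

theorem IsElliptic.measurable_multiplier {A : CoeffOp n k V W} (hA : IsElliptic n k A)
    (J : Fin k → Fin n) (v : V) (w : W) :
    Measurable fun ξ : Euc n => (∏ i, ξ (J i)) * ⟪v, symbolLeftInverse A ξ w⟫ := by
  refine measurable_of_continuousOn_compl_singleton 0 fun ξ hξ => ContinuousAt.continuousWithinAt ?_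
  exact ((contDiff_coordProd J (m := 0)).continuous.continuousAt).mul (continuousAt_const.inner
    ((hA.contDiffAt_symbolLeftInverse hξ (m := 0)).continuousAt.clm_apply continuousAt_const))

/-- A parametrix for an elliptic operator, given by dyadic pieces of Littlewood-Paley type. -/
theorem IsElliptic.exists_parametrix {A : CoeffOp n k V W} (hA : IsElliptic n k A) (hk : 0 < k)
    {ι ι' : Type*} [Fintype ι'] (v : ι → V) (w : OrthonormalBasis ι' ℝ W) :
    ∃ (φ : 𝓢(Euc n, ℝ)) (κ : ι → ι' → 𝓢(Euc n, ℝ)), ∫ x, φ x = 1 ∧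
      (∀ p y x, ∑ I : Fin k → Fin n, ∑ q, dirDeriv n k I (κ p q) x * ⟪w q, A I y⟫ =
        (2 ^ n * φ ((2 : ℝ) • x) - φ x) * ⟪v p, y⟫) ∧
      ∀ p q (J : Fin k → Fin n), ∃ η : 𝓢(Euc n, ℝ), (∀ x, η x = dirDeriv n k J (κ p q) x) ∧
        ∀ g : Euc n → ℝ, MemLp g 2 volume → ∀ᵐ x, ∃ c, Tendsto (fun N => ∑ i ∈ Finset.range N,
          mconv volume g (scaledKernel 0 i η) x) atTop (𝓝 c) := by
  let f : ContDiffBump (0 : Euc n) := ⟨1, 2, one_pos, one_lt_two⟩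
  have hfs : ContDiff ℝ (⊤ : ℕ∞) f := f.contDiff
  have hfc : HasCompactSupport f := f.hasCompactSupport
  set ψr : Euc n → ℝ := fun ξ => f ((2 : ℝ)⁻¹ • ξ) - f ξ with hψr
  have hψs : ContDiff ℝ (⊤ : ℕ∞) ψr := (hfs.comp (contDiff_const_smul _)).sub hfs
  have hψc : HasCompactSupport ψr := (hfc.comp_smul (by norm_num)).sub hfc
  have hψ0 : ∀ ξ, ‖ξ‖ ≤ 1 → ψr ξ = 0 := fun ξ hξ => by
    have h1 : f ξ = 1 := f.one_of_mem_closedBall (by simpa using hξ)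
    have h2 : f ((2 : ℝ)⁻¹ • ξ) = 1 := f.one_of_mem_closedBall (by
      rw [mem_closedBall_zero_iff, norm_smul, Real.norm_of_nonneg (by norm_num)]
      change _ ≤ (1 : ℝ)
      linarith [norm_nonneg ξ])
    simp [hψr, h1, h2]
  let c : 𝓢(Euc n, ℂ) := HasCompactSupport.toSchwartzMap (f := fun ξ => ((f ξ : ℝ) : ℂ))
    (hfc.comp_left (g := Complex.ofReal) Complex.ofReal_zero)
    (Complex.ofRealCLM.contDiff.comp hfs)
  have hc : ∀ ξ, c ξ = (f ξ : ℂ) := fun ξ => rfl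
  let ψ : 𝓢(Euc n, ℂ) := HasCompactSupport.toSchwartzMap (f := fun ξ => ((ψr ξ : ℝ) : ℂ))
    (hψc.comp_left (g := Complex.ofReal) Complex.ofReal_zero)
    (Complex.ofRealCLM.contDiff.comp hψs)
  have hψ : ∀ ξ, ψ ξ = (ψr ξ : ℂ) := fun ξ => rfl
  set a : ι → ι' → Euc n → ℝ := fun p q ξ => ⟪v p, symbolLeftInverse A ξ (w q)⟫ with ha
  have has : ∀ p q, ContDiff ℝ (⊤ : ℕ∞) fun ξ => ψr ξ * a p q ξ := by
    intro p q
    rw [contDiff_iff_contDiffAt]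
    intro ξ
    rcases eq_or_ne ξ 0 with rfl | hξ
    · refine (contDiffAt_const (c := (0 : ℝ))).congr_of_eventuallyEq ?_
      filter_upwards [ball_mem_nhds (0 : Euc n) one_pos] with ξ hξ
      rw [hψ0 ξ (by simpa using (mem_ball_zero_iff.1 hξ).le), zero_mul]
    · exact hψs.contDiffAt.mul (contDiffAt_const.inner ℝ
        ((hA.contDiffAt_symbolLeftInverse hξ).clm_apply contDiffAt_const))
  let K : ι → ι' → 𝓢(Euc n, ℂ) := fun p q =>
    HasCompactSupport.toSchwartzMap (f := fun ξ => ((ψr ξ * a p q ξ : ℝ) : ℂ))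
      ((hψc.mul_right (f' := a p q)).comp_left (g := Complex.ofReal) Complex.ofReal_zero)
      (Complex.ofRealCLM.contDiff.comp (has p q))
  have hK : ∀ p q ξ, K p q ξ = ((ψr ξ * a p q ξ : ℝ) : ℂ) := fun p q ξ => rfl
  have hpi : (2 * Real.pi * Complex.I) ^ k ≠ 0 :=
    pow_ne_zero _ Complex.two_pi_I_ne_zero
  set κc : ι → ι' → 𝓢(Euc n, ℂ) := fun p q => ((2 * Real.pi * Complex.I) ^ k)⁻¹ • 𝓕⁻ (K p q) with hκc
  have hF : ∀ p q (J : Fin k → Fin n) ξ, 𝓕 (∂^{fun i => stdVec n (J i)} (κc p q)) ξ =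
      ((((∏ i, ξ (J i)) * a p q ξ : ℝ) : ℂ)) * (ψr ξ : ℂ) := by
    intro p q J ξ
    have h1 : 𝓕 (κc p q) ξ = ((2 * Real.pi * Complex.I) ^ k)⁻¹ * K p q ξ := by
      rw [hκc]
      simp only
      rw [FourierTransform.fourier_smul, FourierTransform.fourier_fourierInv_eq]
      rfl
    rw [fourier_iteratedLineDerivOp_apply, h1, hK]
    push_cast
    field_simp
  refine ⟨schwartzRe (𝓕⁻ c), fun p q => schwartzRe (κc p q), ?_, fun p y x => ?_, fun p q J => ?_⟩
  · have h1 : 𝓕 (𝓕⁻ c) (0 : Euc n) = 1 := by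
      rw [FourierTransform.fourier_fourierInv_eq, hc,
        f.one_of_mem_closedBall (mem_closedBall_self zero_le_one), Complex.ofReal_one]
    rw [SchwartzMap.fourier_coe, Real.fourier_eq] at h1
    simp only [inner_zero_right, neg_zero, AddChar.map_zero_eq_one, one_smul] at h1
    have h2 := congrArg Complex.re h1
    rw [← Complex.reCLM_apply, ← ContinuousLinearMap.integral_comp_comm _ (𝓕⁻ c).integrable] at h2
    exact h2
  · set s : 𝓢(Euc n, ℂ) := ∑ I : Fin k → Fin n, ∑ q, ((⟪w q, A I y⟫ : ℝ) : ℂ) •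
      ∂^{fun i => stdVec n (I i)} (κc p q) with hs
    have h1 : 𝓕 s = ((⟪v p, y⟫ : ℝ) : ℂ) • ψ := by
      have h2 : 𝓕 s = ∑ I : Fin k → Fin n, ∑ q, ((⟪w q, A I y⟫ : ℝ) : ℂ) •
          𝓕 (∂^{fun i => stdVec n (I i)} (κc p q)) := by
        change FourierTransform.fourierCLM ℂ 𝓢(Euc n, ℂ) s = _
        simp only [hs, map_sum, map_smul]
        rfl
      rw [h2]
      ext ξ
      simp only [_root_.sum_apply, _root_.smul_apply, hF, smul_eq_mul, hψ]
      rcases eq_or_ne ξ 0 with rfl | hξ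
      · simp [hψ0 0 (by simp)]
      · have h3 : ∑ I : Fin k → Fin n, ∑ q, ⟪w q, A I y⟫ * ((∏ i, ξ (I i)) * a p q ξ) =
            ⟪v p, y⟫ := by
          conv_rhs => rw [← hA.symbolLeftInverse_apply hξ y, symbolCLM_apply, map_sum, inner_sum]
          refine Finset.sum_congr rfl fun I _ => ?_
          rw [map_smul, real_inner_smul_right]
          conv_rhs => rw [← w.sum_repr' (A I y), map_sum, inner_sum, Finset.mul_sum]
          refine Finset.sum_congr rfl fun q _ => ?_
          rw [map_smul, real_inner_smul_right, ha]
          ring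
        rw [← h3]
        push_cast
        simp only [Finset.sum_mul, mul_assoc]
    have h4 : s x = ((⟪v p, y⟫ : ℝ) : ℂ) * (2 ^ n * 𝓕⁻ c ((2 : ℝ) • x) - 𝓕⁻ c x) := by
      have h7 : 𝓕⁻ (𝓕 s) = s := FourierTransform.fourierInv_fourier_eq s
      rw [← h7, h1, FourierTransform.fourierInv_smul,
        _root_.smul_apply, fourierInv_sub_dilation c ψ (fun ξ => by simp [hψ, hψr, hc]) x, smul_eq_mul]
    have h5 := congrArg Complex.re h4
    rw [Complex.re_ofReal_mul, Complex.sub_re] at h5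
    have h6 : (2 ^ n * 𝓕⁻ c ((2 : ℝ) • x)).re = 2 ^ n * (𝓕⁻ c ((2 : ℝ) • x)).re := by
      rw [← Complex.re_ofReal_mul]
      simp
    rw [h6, mul_comm] at h5
    simp only [dirDeriv_schwartzRe, schwartzRe_apply]
    rw [← h5, hs]
    simp only [_root_.sum_apply, _root_.smul_apply, Complex.re_sum, smul_eq_mul,
      Complex.re_ofReal_mul, mul_comm]
  · refine ⟨schwartzRe (∂^{fun i => stdVec n (J i)} (κc p q)),
      fun x => (dirDeriv_schwartzRe J _ x).symm, fun g hg => ?_⟩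
    obtain ⟨C, hC⟩ := hA.exists_norm_coordProd_mul_le hk J (v p) (w q)
    refine ae_tendsto_sum_mconv_of_multiplier (φ := 𝓕⁻ c)
      (M := fun ξ => (((∏ i, ξ (J i)) * a p q ξ : ℝ) : ℂ))
      (Complex.measurable_ofReal.comp (hA.measurable_multiplier J (v p) (w q))) (C := C)
      (fun ξ => ?_) (fun ξ => ?_) (fun ξ => ?_) hg
    · rw [Complex.norm_real]
      exact hC ξ
    · have h2 : ((2 : ℝ)⁻¹) ^ k ≠ 0 := by positivity
      simp only [ha]
      rw [coordProd_smul, symbolLeftInverse_smul A (by norm_num), _root_.smul_apply,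
        real_inner_smul_right]
      congr 1
      field_simp
    · rw [hF, FourierTransform.fourier_fourierInv_eq, hc, hc, hψr]
      push_cast
      rfl

end Parametrix

section Potential

variable {n : ℕ}

theorem exists_mconv_bound {σ : Measure (Euc n)} [IsFiniteMeasure σ] {ρ : Euc n → ℝ}
    (hρ1 : ∀ z, |ρ z| ≤ 1) {F : Type*} [NormedAddCommGroup F] [NormedSpace ℝ F] {g : Euc n → F}
    {C : ℝ} (hg : ∀ x, ‖g x‖ ≤ C) (y : Euc n) : ‖mconv σ ρ g y‖ ≤ C * σ.real Set.univ := by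
  refine norm_integral_le_of_norm_le_const (Eventually.of_forall fun z => ?_)
  rw [norm_smul]
  exact (mul_le_of_le_one_left (norm_nonneg _) (hρ1 z)).trans (hg _)

theorem mconv_restrict {σ : Measure (Euc n)} {ρ : Euc n → ℝ} {F : Type*} [NormedAddCommGroup F]
    [NormedSpace ℝ F] {g : Euc n → F} (hg : tsupport g ⊆ closedBall 0 1) {R : ℝ} {y : Euc n}
    (hy : ‖y‖ < R) : mconv (σ.restrict (ball 0 (R + 1))) ρ g y = mconv σ ρ g y := by
  refine setIntegral_eq_integral_of_forall_compl_eq_zero fun z hz => ?_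
  rw [image_eq_zero_of_notMem_tsupport (f := g) (x := y - z), smul_zero]
  intro h
  have h1 := mem_closedBall_zero_iff.1 (hg h)
  rw [mem_ball_zero_iff, not_lt] at hz
  have h2 : ‖z‖ ≤ ‖y‖ + ‖y - z‖ := by
    calc ‖z‖ = ‖y - (y - z)‖ := by rw [sub_sub_cancel]
      _ ≤ _ := norm_sub_le _ _
  linarith

theorem tsupport_cutoff_subset (k i : ℕ) (κ : 𝓢(Euc n, ℝ)) {χ : Euc n → ℝ} {s : Set (Euc n)}
    (hχs : tsupport χ ⊆ s) : tsupport (fun y => χ y * scaledKernel k i κ y) ⊆ s :=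
  (closure_mono (Function.support_mul_subset_left _ _)).trans hχs

theorem exists_iteratedFDeriv_mconv_cutoff_bound {σ : Measure (Euc n)} [IsFiniteMeasure σ]
    {ρ : Euc n → ℝ} (hρ : Measurable ρ) (hρ1 : ∀ z, |ρ z| ≤ 1) {k : ℕ} (κ : 𝓢(Euc n, ℝ))
    {χ : Euc n → ℝ} (hχ : IsTestFun n χ) {j : ℕ} (hj : n + j < k) :
    ∃ C : ℝ, 0 ≤ C ∧ ∀ i x, ‖iteratedFDeriv ℝ j (mconv σ ρ fun y => χ y * scaledKernel k i κ y) x‖ ≤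
      C * (1 / 2) ^ i := by
  obtain ⟨C, hC0, hC⟩ := exists_cutoff_scaledKernel_bound k κ hχ j 0
  refine ⟨C * σ.real Set.univ, by positivity, fun i x => ?_⟩
  rw [iteratedFDeriv_mconv (integrable_of_abs_le_one σ hρ hρ1).locallyIntegrable
    (isTestFun_cutoff_scaledKernel k i κ hχ) j]
  refine (exists_mconv_bound hρ1 (C := C * (1 / 2) ^ i) (fun x => ?_) x).trans (by nlinarith)
  refine (hC i x).trans ?_
  rw [pow_zero, div_one]
  refine mul_le_mul_of_nonneg_left ?_ hC0
  rw [div_le_iff₀ (by positivity), one_div, inv_pow, ← div_eq_inv_mul, le_div_iff₀ (by positivity),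
    ← pow_add, ← pow_add]
  refine pow_le_pow_right₀ one_le_two ?_
  have : i * (n + j + 1) ≤ i * k := Nat.mul_le_mul_left i hj
  linarith [this, mul_add i (n + j) 1, mul_add i n j]

theorem contDiff_tsum_mconv_of_finite {σ : Measure (Euc n)} [IsFiniteMeasure σ]
    {ρ : Euc n → ℝ} (hρ : Measurable ρ) (hρ1 : ∀ z, |ρ z| ≤ 1) {k : ℕ} (κ : 𝓢(Euc n, ℝ))
    {χ : Euc n → ℝ} (hχ : IsTestFun n χ) {j : ℕ} (hj : n + j < k) :
    ContDiff ℝ j (fun y => ∑' i, mconv σ ρ (fun y => χ y * scaledKernel k i κ y) y) ∧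
    ∀ I : Fin j → Fin n,
      dirDeriv n j I (fun y => ∑' i, mconv σ ρ (fun y => χ y * scaledKernel k i κ y) y) =
      fun y => ∑' i, mconv σ ρ (dirDeriv n j I fun y => χ y * scaledKernel k i κ y) y := by
  have hloc : LocallyIntegrable ρ σ := (integrable_of_abs_le_one σ hρ hρ1).locallyIntegrable
  have hB : ∀ a : ℕ, ∃ C : ℝ, 0 ≤ C ∧ (a ≤ j → ∀ i x,
      ‖iteratedFDeriv ℝ a (mconv σ ρ fun y => χ y * scaledKernel k i κ y) x‖ ≤
      C * (1 / 2) ^ i) := fun a => by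
    by_cases ha : a ≤ j
    · obtain ⟨C, hC0, hC⟩ := exists_iteratedFDeriv_mconv_cutoff_bound (σ := σ) hρ hρ1 κ hχ
        (show n + a < k by omega)
      exact ⟨C, hC0, fun _ => hC⟩
    · exact ⟨0, le_rfl, fun h => absurd h ha⟩
  choose C hC0 hC using hB
  have hs : ∀ a : ℕ, ((a : ℕ∞) ≤ j) → Summable fun i => C a * (1 / 2 : ℝ) ^ i := fun a _ =>
    summable_geometric_two.mul_left _
  have hcd : ∀ i, ContDiff ℝ j (mconv σ ρ fun y => χ y * scaledKernel k i κ y) := fun i =>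
    (contDiff_mconv hloc (isTestFun_cutoff_scaledKernel k i κ hχ)).of_le (natCast_le_smooth j)
  have hb : ∀ (a : ℕ) (i : ℕ) x, ((a : ℕ∞) ≤ j) →
      ‖iteratedFDeriv ℝ a (mconv σ ρ fun y => χ y * scaledKernel k i κ y) x‖ ≤ C a * (1 / 2) ^ i :=
    fun a i x ha => hC a (by exact_mod_cast ha) i x
  refine ⟨contDiff_tsum (N := (j : ℕ∞)) hcd hs hb, fun I => ?_⟩
  ext1 y
  rw [dirDeriv, iteratedFDeriv_tsum_apply (N := (j : ℕ∞)) hcd hs hb le_rfl y]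
  have hsum : Summable fun i => iteratedFDeriv ℝ j (mconv σ ρ fun y => χ y * scaledKernel k i κ y) y :=
    Summable.of_norm_bounded (hs j le_rfl) fun i => hb j i y le_rfl
  have h1 := ((ContinuousMultilinearMap.apply ℝ (fun _ : Fin j => Euc n) ℝ
    (fun i => stdVec n (I i))).hasSum hsum.hasSum).tsum_eq
  refine h1.symm.trans (tsum_congr fun i => ?_)
  rw [← dirDeriv_mconv hloc (isTestFun_cutoff_scaledKernel k i κ hχ)]
  rfl

/-- The dyadic pieces of the `k`-th derivatives of `κ` sum to a singular integral which converges
almost everywhere on square integrable functions. -/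
def IsCalderonZygmundKernel (k : ℕ) (κ : 𝓢(Euc n, ℝ)) : Prop :=
  ∀ J : Fin k → Fin n, ∃ η : 𝓢(Euc n, ℝ), (∀ x, η x = dirDeriv n k J κ x) ∧
    ∀ g : Euc n → ℝ, MemLp g 2 volume → ∀ᵐ x, ∃ c, Tendsto (fun N => ∑ i ∈ Finset.range N,
      mconv volume g (scaledKernel 0 i η) x) atTop (𝓝 c)

theorem IsCalderonZygmundKernel.ae_tendsto {k : ℕ} {κ : 𝓢(Euc n, ℝ)}
    (hκ : IsCalderonZygmundKernel k κ) {σ : Measure (Euc n)} [IsFiniteMeasure σ]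
    {ρ : Euc n → ℝ} (hρ : Measurable ρ) (hρ1 : ∀ z, |ρ z| ≤ 1)
    {χ : Euc n → ℝ} (hχ : IsTestFun n χ) (hχ1 : ∀ x, ‖x‖ < 1 / 2 → χ x = 1) :
    ∀ᵐ x ∂(volume : Measure (Euc n)), ∀ J : Fin k → Fin n,
      ∃ c, Tendsto (fun N => ∑ i ∈ Finset.range N,
        mconv σ ρ (dirDeriv n k J fun y => χ y * scaledKernel k i κ y) x) atTop (𝓝 c) := by
  rw [ae_all_iff]
  intro J
  obtain ⟨η, hη, hη2⟩ := hκ J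
  filter_upwards [ae_tendsto_sum_mconv_of_memLp_two σ hρ hρ1 η fun g _ hg => hη2 g hg] with x hx
  obtain ⟨c, hc⟩ := hx
  obtain ⟨C, hC0, hC⟩ := exists_cutoff_compl_scaledKernel_bound k κ hχ hχ1 k
  have hint : Integrable ρ σ := integrable_of_abs_le_one σ hρ hρ1
  set Z : ℕ → Euc n → ℝ := fun i => dirDeriv n k J fun y => (1 - χ y) * scaledKernel k i κ y with hZ
  have hZs : ∀ i, ContDiff ℝ (⊤ : ℕ∞) fun y => (1 - χ y) * scaledKernel k i κ y := fun i =>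
    (contDiff_const.sub hχ.1).mul (contDiff_scaledKernel k i κ)
  have hZb : ∀ i y, ‖Z i y‖ ≤ C * (1 / 2) ^ i := fun i y => (norm_dirDeriv_le J y).trans (hC i y)
  have hZi : ∀ i, Integrable (fun z => ρ z • Z i (x - z)) σ := fun i => by
    have hcont : Continuous (Z i) := (ContDiff.dirDeriv (hZs i) J).continuous
    exact hint.mul_bdd (c := C * (1 / 2) ^ i) (by fun_prop)
      (Eventually.of_forall fun z => hZb i _)
  have hsum : Summable fun i => mconv σ ρ (Z i) x := by
    refine Summable.of_norm_bounded (g := fun i => C * (1 / 2) ^ i * σ.real Set.univ) ?_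
      fun i => exists_mconv_bound hρ1 (hZb i) x
    exact (summable_geometric_two.mul_left C).mul_right _
  refine ⟨c - ∑' i, mconv σ ρ (Z i) x, ?_⟩
  refine (hc.sub hsum.hasSum.tendsto_sum_nat).congr fun N => ?_
  rw [← Finset.sum_sub_distrib]
  refine Finset.sum_congr rfl fun i _ => ?_
  have hd : ∀ y, dirDeriv n k J (fun y => χ y * scaledKernel k i κ y) y =
      scaledKernel 0 i η y - Z i y := fun y => by
    have e1 : (fun y => χ y * scaledKernel k i κ y) =
        fun y => scaledKernel k i κ y - (1 - χ y) * scaledKernel k i κ y := by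
      ext y
      ring
    have e2 : dirDeriv n k J (scaledKernel k i κ) y = scaledKernel 0 i η y := by
      rw [dirDeriv, iteratedFDeriv_scaledKernel, scaledKernel, hη]
      simp [dirDeriv]
    rw [← e2, e1, hZ, dirDeriv, fun_iteratedFDeriv_sub_apply
      (((contDiff_scaledKernel k i κ).of_le (natCast_le_smooth k)).contDiffAt)
      ((hZs i).of_le (natCast_le_smooth k)).contDiffAt]
    rfl
  have hg := mconv_integrable hint.locallyIntegrable
    ((isTestFun_cutoff_scaledKernel k i κ hχ).dirDeriv J).1.continuous
    ((isTestFun_cutoff_scaledKernel k i κ hχ).dirDeriv J).2 x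
  rw [eq_comm, eq_sub_iff_add_eq, mconv, mconv, ← integral_add hg (hZi i)]
  refine integral_congr_ae (Eventually.of_forall fun z => ?_)
  simp only [hd, smul_eq_mul]
  ring

theorem contDiff_tsum_mconv {σ : Measure (Euc n)} [IsLocallyFiniteMeasure σ]
    {ρ : Euc n → ℝ} (hρ : Measurable ρ) (hρ1 : ∀ z, |ρ z| ≤ 1) {k : ℕ} (κ : 𝓢(Euc n, ℝ))
    {χ : Euc n → ℝ} (hχ : IsTestFun n χ) (hχs : tsupport χ ⊆ closedBall 0 1) {j : ℕ}
    (hj : n + j < k) :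
    ContDiff ℝ j (fun y => ∑' i, mconv σ ρ (fun y => χ y * scaledKernel k i κ y) y) ∧
    ∀ I : Fin j → Fin n,
      dirDeriv n j I (fun y => ∑' i, mconv σ ρ (fun y => χ y * scaledKernel k i κ y) y) =
      fun y => ∑' i, mconv σ ρ (dirDeriv n j I fun y => χ y * scaledKernel k i κ y) y := by
  have key : ∀ R : ℝ, (∀ y, ‖y‖ < R → ContDiffAt ℝ j
      (fun y => ∑' i, mconv σ ρ (fun y => χ y * scaledKernel k i κ y) y) y) ∧
      ∀ (I : Fin j → Fin n) y, ‖y‖ < R →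
      dirDeriv n j I (fun y => ∑' i, mconv σ ρ (fun y => χ y * scaledKernel k i κ y) y) y =
      ∑' i, mconv σ ρ (dirDeriv n j I fun y => χ y * scaledKernel k i κ y) y := by
    intro R
    have hfin : IsFiniteMeasure (σ.restrict (ball 0 (R + 1))) :=
      ⟨by rw [Measure.restrict_apply_univ]; exact measure_ball_lt_top⟩
    obtain ⟨h1, h2⟩ := contDiff_tsum_mconv_of_finite (σ := σ.restrict (ball 0 (R + 1))) hρ hρ1 κ hχ hj
    have he : ∀ y, ‖y‖ < R →
        (fun y => ∑' i, mconv σ ρ (fun y => χ y * scaledKernel k i κ y) y) =ᶠ[𝓝 y]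
        (fun y => ∑' i, mconv (σ.restrict (ball 0 (R + 1))) ρ
          (fun y => χ y * scaledKernel k i κ y) y) := fun y hy => by
      filter_upwards [isOpen_ball.mem_nhds (mem_ball_zero_iff.2 hy)] with z hz
      exact tsum_congr fun i => (mconv_restrict (tsupport_cutoff_subset k i κ hχs)
        (mem_ball_zero_iff.1 hz)).symm
    refine ⟨fun y hy => h1.contDiffAt.congr_of_eventuallyEq (he y hy), fun I y hy => ?_⟩
    rw [dirDeriv, (he y hy).iteratedFDeriv ℝ j |>.eq_of_nhds]
    refine (congrFun (h2 I) y).trans (tsum_congr fun i => mconv_restrict ?_ hy)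
    exact (tsupport_dirDeriv_subset _ I).trans (tsupport_cutoff_subset k i κ hχs)
  refine ⟨contDiff_iff_contDiffAt.2 fun y => (key (‖y‖ + 1)).1 y (lt_add_one _), fun I => ?_⟩
  ext1 y
  exact (key (‖y‖ + 1)).2 I y (lt_add_one _)

theorem tendsto_sum_mconv {σ : Measure (Euc n)} [IsLocallyFiniteMeasure σ]
    {ρ : Euc n → ℝ} (hρ : Measurable ρ) (hρ1 : ∀ z, |ρ z| ≤ 1) {k : ℕ} (hk : n < k)
    (κ : 𝓢(Euc n, ℝ)) {χ : Euc n → ℝ} (hχ : IsTestFun n χ) (hχs : tsupport χ ⊆ closedBall 0 1)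
    (y : Euc n) :
    Tendsto (fun N => ∑ i ∈ Finset.range N, mconv σ ρ (fun y => χ y * scaledKernel k i κ y) y) atTop
      (𝓝 (∑' i, mconv σ ρ (fun y => χ y * scaledKernel k i κ y) y)) := by
  have hfin : IsFiniteMeasure (σ.restrict (ball 0 (‖y‖ + 1 + 1))) :=
    ⟨by rw [Measure.restrict_apply_univ]; exact measure_ball_lt_top⟩
  obtain ⟨C, -, hC⟩ := exists_iteratedFDeriv_mconv_cutoff_bound
    (σ := σ.restrict (ball 0 (‖y‖ + 1 + 1))) hρ hρ1 κ hχ (j := 0) hk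
  refine (Summable.of_norm_bounded (summable_geometric_two.mul_left C) fun i => ?_).hasSum.tendsto_sum_nat
  rw [← mconv_restrict (tsupport_cutoff_subset k i κ hχs) (lt_add_one ‖y‖)]
  simpa only [norm_iteratedFDeriv_zero] using hC i y

theorem IsCalderonZygmundKernel.ae_hasTaylor {k : ℕ} {κ : 𝓢(Euc n, ℝ)}
    (hκ : IsCalderonZygmundKernel k κ) {σ : Measure (Euc n)} [IsLocallyFiniteMeasure σ]
    {ρ : Euc n → ℝ} (hρ : Measurable ρ) (hρ1 : ∀ z, |ρ z| ≤ 1)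
    {χ : Euc n → ℝ} (hχ : IsTestFun n χ) (hχs : tsupport χ ⊆ closedBall 0 1)
    (hχ1 : ∀ x, ‖x‖ < 1 / 2 → χ x = 1) {m : ℕ} (hm : m ≤ k) (hnk : n < k - m) (I : Fin m → Fin n) :
    ∀ᵐ x ∂(volume : Measure (Euc n)), HasTaylor (k - m)
      (fun y => ∑' i, mconv σ ρ (dirDeriv n m I fun y => χ y * scaledKernel k i κ y) y) x := by
  have key : ∀ R : ℕ, ∀ᵐ x ∂(volume : Measure (Euc n)), ‖x‖ < R → HasTaylor (k - m)
      (fun y => ∑' i, mconv σ ρ (dirDeriv n m I fun y => χ y * scaledKernel k i κ y) y) x := by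
    intro R
    have hfin : IsFiniteMeasure (σ.restrict (ball 0 (R + 1 : ℝ))) :=
      ⟨by rw [Measure.restrict_apply_univ]; exact measure_ball_lt_top⟩
    filter_upwards [ae_hasTaylor_tsum_mconv (σ := σ.restrict (ball 0 (R + 1 : ℝ))) hρ hρ1 hm hnk κ hχ
      hχs I (hκ.ae_tendsto hρ hρ1 hχ hχ1)] with x hx hxR
    refine hx.congr_of_eventuallyEq ?_
    filter_upwards [isOpen_ball.mem_nhds (mem_ball_zero_iff.2 hxR)] with z hz
    exact tsum_congr fun i => (mconv_restrict ((tsupport_dirDeriv_subset _ I).trans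
      (tsupport_cutoff_subset k i κ hχs)) (mem_ball_zero_iff.1 hz)).symm
  filter_upwards [ae_all_iff.2 key] with x hx
  obtain ⟨R, hR⟩ := exists_nat_gt ‖x‖
  exact hx R hR

end Potential

section Representation

variable {n : ℕ}

theorem dirDeriv_comp_const_sub {F : Type*} [NormedAddCommGroup F] [NormedSpace ℝ F]
    {g : Euc n → F} (hg : ContDiff ℝ (⊤ : ℕ∞) g) {k : ℕ} (I : Fin k → Fin n) (x z : Euc n) :
    dirDeriv n k I (fun z => g (x - z)) z = (-1 : ℝ) ^ k • dirDeriv n k I g (x - z) := by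
  have h1 : ContDiff ℝ (⊤ : ℕ∞) fun y => g (x + y) := hg.comp (contDiff_const.add contDiff_id)
  have h2 : (fun z => g (x - z)) = fun z => (fun y => g (x + y)) ((-1 : ℝ) • z) := by
    ext z
    simp [sub_eq_add_neg]
  rw [dirDeriv, h2, iteratedFDeriv_comp_smul_left h1, iteratedFDeriv_comp_add_left]
  simp [dirDeriv, sub_eq_add_neg]

theorem IsTestFun.comp_const_sub {F : Type*} [NormedAddCommGroup F] [NormedSpace ℝ F]
    {g : Euc n → F} (hg : IsTestFun n g) (x : Euc n) : IsTestFun n fun z => g (x - z) :=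
  ⟨hg.1.comp (contDiff_const.sub contDiff_id), hg.2.comp_homeomorph (Homeomorph.subLeft x)⟩

theorem IsTestFun.sum {F : Type*} [NormedAddCommGroup F] [NormedSpace ℝ F] {ι : Type*}
    {s : Finset ι} {g : ι → Euc n → F} (hg : ∀ q ∈ s, IsTestFun n (g q)) :
    IsTestFun n fun z => ∑ q ∈ s, g q z := by
  classical
  induction s using Finset.induction_on with
  | empty => exact ⟨by simpa using contDiff_const, by simpa only [Finset.sum_empty] using! HasCompactSupport.zero⟩
  | insert a s ha ih =>
    simp only [Finset.sum_insert ha]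
    have h1 := ih fun q hq => hg q (Finset.mem_insert_of_mem hq)
    have h2 := hg a (Finset.mem_insert_self a s)
    exact ⟨h2.1.add h1.1, h2.2.add h1.2⟩

theorem IsTestFun.smul_const {F : Type*} [NormedAddCommGroup F] [NormedSpace ℝ F]
    {g : Euc n → ℝ} (hg : IsTestFun n g) (w : F) : IsTestFun n fun z => g z • w :=
  ⟨hg.1.smul contDiff_const, hg.2.smul_right⟩

theorem dirDeriv_smul_const {F : Type*} [NormedAddCommGroup F] [NormedSpace ℝ F]
    {g : Euc n → ℝ} {k : ℕ} (hg : ContDiff ℝ k g) (w : F) (I : Fin k → Fin n) (x : Euc n) :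
    dirDeriv n k I (fun z => g z • w) x = dirDeriv n k I g x • w := by
  have h1 := ((ContinuousLinearMap.id ℝ ℝ).smulRight w).iteratedFDeriv_comp_left (x := x)
    hg.contDiffAt le_rfl
  rw [dirDeriv]
  change iteratedFDeriv ℝ k (((ContinuousLinearMap.id ℝ ℝ).smulRight w) ∘ g) x _ = _
  rw [h1]
  rfl

theorem dirDeriv_sum {F : Type*} [NormedAddCommGroup F] [NormedSpace ℝ F] {ι : Type*}
    {s : Finset ι} {g : ι → Euc n → F} {k : ℕ} (hg : ∀ q ∈ s, ContDiff ℝ k (g q))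
    (I : Fin k → Fin n) (x : Euc n) :
    dirDeriv n k I (fun z => ∑ q ∈ s, g q z) x = ∑ q ∈ s, dirDeriv n k I (g q) x := by
  rw [dirDeriv, iteratedFDeriv_fun_sum_apply
    (fun q hq => (hg q hq).contDiffAt)]
  simp [dirDeriv]

section Operator

variable {k : ℕ} {V W : Type*}
  [NormedAddCommGroup V] [InnerProductSpace ℝ V] [FiniteDimensional ℝ V]
  [NormedAddCommGroup W] [InnerProductSpace ℝ W] [FiniteDimensional ℝ W]

theorem locallyIntegrable_inner {E : Type*} [NormedAddCommGroup E] [InnerProductSpace ℝ E]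
    {μ : Measure (Euc n)} {u : Euc n → E} (hu : LocallyIntegrable u μ) (v : E) :
    LocallyIntegrable (fun z => ⟪v, u z⟫) μ := fun x => by
  obtain ⟨s, hs, h⟩ := hu x
  exact ⟨s, hs, h.const_inner v⟩

/-- The distributional identity `𝒜 u = f σ` tested against translates. -/
theorem HasDistribA.sum_mconv_eq {A : CoeffOp n k V W} {u : Euc n → V} (hu : LocallyIntegrable u volume)
    {σ : Measure (Euc n)} {f : Euc n → W} (hf : LocallyIntegrable f σ) (h : HasDistribA n k A u σ f)
    {ι ι' : Type*} [Fintype ι] [Fintype ι'] (v : OrthonormalBasis ι ℝ V)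
    (w : ι' → W) {g : ι' → Euc n → ℝ} (hg : ∀ q, IsTestFun n (g q)) (x : Euc n) :
    ∑ r, mconv volume (fun z => ⟪v r, u z⟫)
      (fun y => ∑ I : Fin k → Fin n, ∑ q, dirDeriv n k I (g q) y * ⟪w q, A I (v r)⟫) x =
    ∑ q, mconv σ (fun z => ⟪w q, f z⟫) (g q) x := by
  have hφ : IsTestFun n fun z => ∑ q, g q (x - z) • w q :=
    IsTestFun.sum fun q _ => ((hg q).comp_const_sub x).smul_const (w q)
  have hd : ∀ (I : Fin k → Fin n) z, dirDeriv n k I (fun z => ∑ q, g q (x - z) • w q) z =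
      ∑ q, ((-1 : ℝ) ^ k * dirDeriv n k I (g q) (x - z)) • w q := fun I z => by
    rw [dirDeriv_sum fun q _ => (((hg q).comp_const_sub x).smul_const (w q)).1.of_le
      (natCast_le_smooth k)]
    refine Finset.sum_congr rfl fun q _ => ?_
    rw [dirDeriv_smul_const (((hg q).comp_const_sub x).1.of_le (natCast_le_smooth k)),
      dirDeriv_comp_const_sub (hg q).1, smul_eq_mul]
  have h1 := h _ hφ
  have hR : ∫ z, ⟪f z, ∑ q, g q (x - z) • w q⟫ ∂σ = ∑ q, mconv σ (fun z => ⟪w q, f z⟫) (g q) x := by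
    simp only [inner_sum, real_inner_smul_right]
    rw [integral_finsetSum]
    · refine Finset.sum_congr rfl fun q _ => integral_congr_ae (Eventually.of_forall fun z => ?_)
      simp only [smul_eq_mul]
      rw [mul_comm, real_inner_comm]
    · intro q _
      refine (mconv_integrable (locallyIntegrable_inner hf (w q)) (hg q).1.continuous (hg q).2 x).congr
        (Eventually.of_forall fun z => ?_)
      simp only [smul_eq_mul]
      rw [mul_comm, real_inner_comm]
  have hint : ∀ (I : Fin k → Fin n) q r, Integrable fun z =>
      ⟪v r, u z⟫ * (dirDeriv n k I (g q) (x - z) * ⟪w q, A I (v r)⟫) := fun I q r => by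
    refine ((mconv_integrable (locallyIntegrable_inner hu (v r)) ((hg q).dirDeriv I).1.continuous
      ((hg q).dirDeriv I).2 x).mul_const ⟪w q, A I (v r)⟫).congr (Eventually.of_forall fun z => ?_)
    simp only [smul_eq_mul]
    ring
  have hL : ∀ I : Fin k → Fin n, ∫ z, ⟪u z, LinearMap.adjoint (A I)
      (dirDeriv n k I (fun z => ∑ q, g q (x - z) • w q) z)⟫ =
      (-1 : ℝ) ^ k * ∑ r, ∑ q, ∫ z, ⟪v r, u z⟫ * (dirDeriv n k I (g q) (x - z) * ⟪w q, A I (v r)⟫) := by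
    intro I
    have e1 : ∀ z, ⟪u z, LinearMap.adjoint (A I)
        (dirDeriv n k I (fun z => ∑ q, g q (x - z) • w q) z)⟫ =
        (-1 : ℝ) ^ k * ∑ r, ∑ q, ⟪v r, u z⟫ * (dirDeriv n k I (g q) (x - z) * ⟪w q, A I (v r)⟫) := by
      intro z
      rw [LinearMap.adjoint_inner_right, hd]
      conv_lhs => rw [← v.sum_repr' (u z), map_sum, sum_inner]
      rw [Finset.mul_sum]
      refine Finset.sum_congr rfl fun r _ => ?_
      rw [map_smul, real_inner_smul_left, inner_sum, Finset.mul_sum, Finset.mul_sum]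
      refine Finset.sum_congr rfl fun q _ => ?_
      rw [real_inner_smul_right, real_inner_comm, real_inner_comm (w q)]
      ring
    simp only [e1]
    rw [integral_const_mul, integral_finsetSum _ fun r _ => integrable_finsetSum _ fun q _ => hint I q r]
    congr 1
    exact Finset.sum_congr rfl fun r _ => integral_finsetSum _ fun q _ => hint I q r
  rw [hR] at h1
  rw [← h1]
  simp only [hL]
  rw [← Finset.mul_sum, ← mul_assoc, ← mul_pow, neg_one_mul, neg_neg, one_pow, one_mul,
    Finset.sum_comm]
  refine Finset.sum_congr rfl fun r _ => ?_
  rw [mconv]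
  simp only [smul_eq_mul, Finset.mul_sum]
  rw [integral_finsetSum _ fun I _ => integrable_finsetSum _ fun q _ => hint I q r]
  exact Finset.sum_congr rfl fun I _ => integral_finsetSum _ fun q _ => hint I q r

end Operator

theorem tendsto_mconv_cutoff_approx {u : Euc n → ℝ} (hu : LocallyIntegrable u volume)
    (φ : 𝓢(Euc n, ℝ)) {χ : Euc n → ℝ} (hχ : IsTestFun n χ) (hχ0 : χ 0 = 1)
    (hχs : tsupport χ ⊆ closedBall 0 2) :
    ∀ᵐ x ∂(volume : Measure (Euc n)), Tendsto (fun i => mconv volume u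
      (fun y => χ y * scaledKernel 0 i φ y) x) atTop (𝓝 ((∫ y, φ y) * u x)) := by
  obtain ⟨C, hC0, hC⟩ := exists_cutoff_scaledKernel_bound 0 φ hχ 0 (n + 1)
  filter_upwards [ae_tendsto_lebesguePoint hu] with x hx
  set G : ℕ → Euc n → ℝ := fun i y => χ y * scaledKernel 0 i φ y with hG
  have hGt : ∀ i, IsTestFun n (G i) := fun i => isTestFun_cutoff_scaledKernel 0 i φ hχ
  set τ := (volume.restrict (ball x 3)).withDensity fun z => ‖u z - u x‖ₑ with hτ
  have hux : LocallyIntegrable (fun z => u z - u x) volume := hu.sub (locallyIntegrable_const _)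
  have hτfin : τ Set.univ ≠ ⊤ := by
    rw [hτ, withDensity_apply _ MeasurableSet.univ, Measure.restrict_univ]
    exact ((hux.integrableOn_isCompact (isCompact_closedBall x 3)).mono_set
      ball_subset_closedBall).2.ne
  have h0 : Tendsto (fun r => τ (ball x r) / ENNReal.ofReal (r ^ n)) (𝓝[>] (0 : ℝ)) (𝓝 0) := by
    refine hx.congr' ?_
    filter_upwards [Ioo_mem_nhdsGT (show (0 : ℝ) < 3 by norm_num)] with r hr
    rw [hτ, withDensity_apply _ measurableSet_ball, withDensity_apply _ measurableSet_ball,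
      Measure.restrict_restrict measurableSet_ball,
      Set.inter_eq_left.2 (ball_subset_ball hr.2.le)]
  obtain ⟨e, -, he0, het, he⟩ := exists_dyadicKernel_bound τ x h0 (M := (τ Set.univ).toReal)
    fun r hr => by
      refine (measure_mono (Set.subset_univ _)).trans ?_
      rw [← ENNReal.ofReal_toReal hτfin]
      refine ENNReal.ofReal_le_ofReal ?_
      rw [ENNReal.toReal_ofReal ENNReal.toReal_nonneg]
      exact le_mul_of_one_le_right ENNReal.toReal_nonneg (one_le_pow₀ hr)
  have hmass : Tendsto (fun i => u x * ∫ z, G i z) atTop (𝓝 (u x * ∫ z, φ z)) := by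
    refine Tendsto.const_mul _ ?_
    have e1 : ∀ i, ∫ z, G i z = ∫ y, χ (((2 : ℝ) ^ i)⁻¹ • y) * φ y := fun i => by
      have h2 : (2 : ℝ) ^ i ≠ 0 := by positivity
      have := Measure.integral_comp_smul volume (fun y => χ (((2 : ℝ) ^ i)⁻¹ • y) * φ y) ((2 : ℝ) ^ i)
      rw [finrank_euclideanSpace_fin, abs_of_pos (by positivity), smul_eq_mul,
        eq_inv_mul_iff_mul_eq₀ (by positivity), ← integral_const_mul] at this
      rw [← this]
      refine integral_congr_ae (Eventually.of_forall fun z => ?_)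
      simp only [hG, scaledKernel, inv_smul_smul₀ h2, mul_zero, pow_zero, div_one, ← pow_mul]
      ring
    simp only [e1]
    obtain ⟨D, hD⟩ := hχ.2.exists_bound_of_continuous hχ.1.continuous
    refine tendsto_integral_of_dominated_convergence (fun y => D * ‖φ y‖) (fun i => ?_)
      (φ.integrable.norm.const_mul D) (fun i => Eventually.of_forall fun y => ?_)
      (Eventually.of_forall fun y => ?_)
    · have := hχ.1.continuous
      have := φ.continuous
      exact Continuous.aestronglyMeasurable (by fun_prop)
    · rw [norm_mul]
      exact mul_le_mul_of_nonneg_right (hD _) (norm_nonneg _)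
    · have h3 : Tendsto (fun i : ℕ => ((2 : ℝ) ^ i)⁻¹ • y) atTop (𝓝 0) := by
        rw [← zero_smul ℝ y]
        refine Tendsto.smul_const ?_ y
        exact tendsto_inv_atTop_zero.comp (tendsto_pow_atTop_atTop_of_one_lt one_lt_two)
      have h4 := (hχ.1.continuous.tendsto 0).comp h3
      rw [hχ0] at h4
      simpa using h4.mul_const (φ y)
  rw [mul_comm]
  refine (hmass.add (show Tendsto (fun i => mconv volume (fun z => u z - u x) (G i) x) atTop (𝓝 0) from
    ?_)).congr (fun i => ?_) |>.trans (by rw [add_zero])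
  · refine squeeze_zero_norm (fun i => ?_)
      (show Tendsto (fun i => C * e i) atTop (𝓝 0) by simpa using het.const_mul C)
    have hm : AEMeasurable (fun z => ‖u z - u x‖ₑ) (volume.restrict (ball x 3)) :=
      hux.aestronglyMeasurable.enorm.restrict
    have hd : Continuous fun z => dyadicKernel n i x z := continuous_dyadicKernel i x
    have hfin : ‖mconv volume (fun z => u z - u x) (G i) x‖ₑ ≤ ENNReal.ofReal (C * e i) := by
      calc ‖mconv volume (fun z => u z - u x) (G i) x‖ₑ
          ≤ ∫⁻ z, ‖(u z - u x) • G i (x - z)‖ₑ := enorm_integral_le_lintegral_enorm _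
        _ = ∫⁻ z in ball x 3, ‖(u z - u x) • G i (x - z)‖ₑ := by
          refine (setLIntegral_eq_of_support_subset fun z hz => ?_).symm
          rw [Function.mem_support, Ne, enorm_eq_zero] at hz
          have h5 : x - z ∈ tsupport χ := by
            by_contra hn
            refine hz ?_
            simp only [hG]
            rw [image_eq_zero_of_notMem_tsupport hn, zero_mul, smul_zero]
          have h6 := mem_closedBall_zero_iff.1 (hχs h5)
          rw [mem_ball_iff_norm']
          linarith
        _ ≤ ∫⁻ z in ball x 3, ENNReal.ofReal C *
            (‖u z - u x‖ₑ * ENNReal.ofReal (dyadicKernel n i x z)) := by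
          refine lintegral_mono fun z => ?_
          simp only
          rw [smul_eq_mul, enorm_mul, mul_left_comm, ← ENNReal.ofReal_mul hC0]
          gcongr
          rw [← ofReal_norm]
          refine ENNReal.ofReal_le_ofReal ?_
          have := hC i (x - z)
          rw [norm_iteratedFDeriv_zero] at this
          refine this.trans (le_of_eq ?_)
          rw [dyadicKernel]
          simp only [mul_zero, pow_zero, mul_one, div_one]
          ring
        _ = ENNReal.ofReal C * ∫⁻ z, ENNReal.ofReal (dyadicKernel n i x z) ∂τ := by
          rw [lintegral_const_mul' _ _ ENNReal.ofReal_ne_top, hτ,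
            lintegral_withDensity_eq_lintegral_mul₀ hm hd.measurable.ennreal_ofReal.aemeasurable]
          rfl
        _ ≤ _ := by
          rw [ENNReal.ofReal_mul hC0]
          exact mul_le_mul_right (he i) _
    rw [← ofReal_norm] at hfin
    exact (ENNReal.ofReal_le_ofReal_iff (mul_nonneg hC0 (he0 i))).1 hfin
  · rw [← mconv_const (u x) (G i) x, ← mconv_add_left (locallyIntegrable_const _) hux (hGt i)]
    simp only [add_sub_cancel]
    rfl

theorem isTestFun_and_hasSum_mconv_of_bound {u : Euc n → ℝ} (hu : LocallyIntegrable u volume)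
    {χ : Euc n → ℝ} (hχ : IsTestFun n χ) {Z : ℕ → Euc n → ℝ}
    (hZ : ∀ i, ContDiff ℝ (⊤ : ℕ∞) (Z i))
    (hZb : ∀ j, ∃ C : ℝ, ∀ i x, ‖iteratedFDeriv ℝ j (Z i) x‖ ≤ C * (1 / 2) ^ i) :
    IsTestFun n (fun y => χ y * ∑' i, Z i y) ∧
    ∀ x, Tendsto (fun N => ∑ i ∈ Finset.range N, mconv volume u (fun y => χ y * Z i y) x) atTop
      (𝓝 (mconv volume u (fun y => χ y * ∑' i, Z i y) x)) := by
  choose C hC using hZb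
  have hsm : ContDiff ℝ (⊤ : ℕ∞) fun y => ∑' i, Z i y :=
    contDiff_tsum (N := (⊤ : ℕ∞)) hZ (fun j _ => summable_geometric_two.mul_left (C j))
      fun j i x _ => hC j i x
  have hC0 : ∀ i x, ‖Z i x‖ ≤ C 0 * (1 / 2) ^ i := fun i x => by
    simpa only [norm_iteratedFDeriv_zero] using hC 0 i x
  have hsum : ∀ y, Summable fun i => Z i y := fun y =>
    Summable.of_norm_bounded (summable_geometric_two.mul_left (C 0)) fun i => hC0 i y
  have hCC : 0 ≤ C 0 := by simpa using (norm_nonneg _).trans (hC0 0 0)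
  refine ⟨⟨hχ.1.mul hsm, hχ.2.mul_right⟩, fun x => ?_⟩
  have hI : Integrable (fun z => u z • χ (x - z)) := mconv_integrable hu hχ.1.continuous hχ.2 x
  have hi : ∀ i, Integrable (fun z => u z • (χ (x - z) * Z i (x - z))) := fun i =>
    mconv_integrable (g := fun y => χ y * Z i y) hu (hχ.1.continuous.mul (hZ i).continuous)
      hχ.2.mul_right x
  have h1 := hasSum_integral_of_summable_integral_norm hi (by
    refine Summable.of_nonneg_of_le (fun i => integral_nonneg fun z => norm_nonneg _) (fun i => ?_)
      (summable_geometric_two.mul_left (C 0 * ∫ z, ‖u z • χ (x - z)‖))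
    rw [show C 0 * (∫ z, ‖u z • χ (x - z)‖) * (1 / 2) ^ i =
      ∫ z, (C 0 * (1 / 2) ^ i) * ‖u z • χ (x - z)‖ by rw [integral_const_mul]; ring]
    refine integral_mono (hi i).norm (hI.norm.const_mul _) fun z => ?_
    simp only [smul_eq_mul, norm_mul]
    have := hC0 i (x - z)
    have h3 : 0 ≤ ‖u z‖ * ‖χ (x - z)‖ := by positivity
    calc _ = ‖u z‖ * ‖χ (x - z)‖ * ‖Z i (x - z)‖ := by ring
      _ ≤ ‖u z‖ * ‖χ (x - z)‖ * (C 0 * (1 / 2) ^ i) := mul_le_mul_of_nonneg_left this h3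
      _ = _ := by ring)
  have h2 : mconv volume u (fun y => χ y * ∑' i, Z i y) x =
      ∫ z, ∑' i, u z • (χ (x - z) * Z i (x - z)) := by
    rw [mconv]
    refine integral_congr_ae (Eventually.of_forall fun z => ?_)
    simp only [smul_eq_mul, tsum_mul_left]
  rw [h2]
  exact h1.tendsto_sum_nat

end Representation

section Representation

variable {n : ℕ}

theorem dirDeriv_scaledKernel (k i : ℕ) (κ : 𝓢(Euc n, ℝ)) (I : Fin k → Fin n) (x : Euc n) :
    dirDeriv n k I (scaledKernel k i κ) x = 2 ^ (i * n) * dirDeriv n k I κ ((2 : ℝ) ^ i • x) := by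
  rw [dirDeriv, iteratedFDeriv_scaledKernel, mul_div_cancel_right₀ _ (by positivity)]
  rfl

theorem dirDeriv_cutoff_add (k i : ℕ) (κ : 𝓢(Euc n, ℝ)) {χ : Euc n → ℝ} (hχ : IsTestFun n χ)
    (I : Fin k → Fin n) (x : Euc n) :
    dirDeriv n k I (fun y => χ y * scaledKernel k i κ y) x +
      dirDeriv n k I (fun y => (1 - χ y) * scaledKernel k i κ y) x =
      2 ^ (i * n) * dirDeriv n k I κ ((2 : ℝ) ^ i • x) := by
  have h1 := (hχ.1.mul (contDiff_scaledKernel k i κ)).of_le (natCast_le_smooth k)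
  have h2 := ((contDiff_const (c := (1 : ℝ)).sub hχ.1).mul (contDiff_scaledKernel k i κ)).of_le
    (natCast_le_smooth k)
  have h3 : scaledKernel k i κ = fun y =>
      χ y * scaledKernel k i κ y + (1 - χ y) * scaledKernel k i κ y := by
    ext y
    ring
  rw [← dirDeriv_scaledKernel]
  conv_rhs => rw [h3]
  simp only [dirDeriv]
  rw [fun_iteratedFDeriv_add_apply h1.contDiffAt h2.contDiffAt]
  rfl

theorem mconv_sub_right {μ : Measure (Euc n)} {ρ : Euc n → ℝ} (hρ : LocallyIntegrable ρ μ)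
    {g h : Euc n → ℝ} (hg : IsTestFun n g) (hh : IsTestFun n h) (x : Euc n) :
    mconv μ ρ (fun y => g y - h y) x = mconv μ ρ g x - mconv μ ρ h x := by
  simp only [mconv, smul_sub]
  exact integral_sub (mconv_integrable hρ hg.1.continuous hg.2 x)
    (mconv_integrable hρ hh.1.continuous hh.2 x)

theorem mconv_mul_const {μ : Measure (Euc n)} {ρ : Euc n → ℝ} (g : Euc n → ℝ) (c : ℝ) (x : Euc n) :
    mconv μ ρ (fun y => g y * c) x = mconv μ ρ g x * c := by
  simp only [mconv, smul_eq_mul, ← mul_assoc]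
  exact integral_mul_const _ _

theorem exists_sum_geometric_bound {ι : Type*} [Fintype ι] {Z : ι → ℕ → Euc n → ℝ}
    (hZ : ∀ a i, ContDiff ℝ (⊤ : ℕ∞) (Z a i))
    (hZb : ∀ a j, ∃ C : ℝ, ∀ i x, ‖iteratedFDeriv ℝ j (Z a i) x‖ ≤ C * (1 / 2) ^ i) (c : ι → ℝ)
    (j : ℕ) : ∃ C : ℝ, ∀ i x,
      ‖iteratedFDeriv ℝ j (fun y => ∑ a, c a • Z a i y) x‖ ≤ C * (1 / 2) ^ i := by
  choose C hC using fun a => hZb a j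
  refine ⟨∑ a, |c a| * C a, fun i x => ?_⟩
  have hd : ∀ a, ContDiffAt ℝ j (Z a i) x := fun a =>
    ((hZ a i).of_le (natCast_le_smooth j)).contDiffAt
  rw [iteratedFDeriv_fun_sum_apply fun a _ => (hd a).const_smul (c a), Finset.sum_mul]
  refine (norm_sum_le _ _).trans (Finset.sum_le_sum fun a _ => ?_)
  rw [iteratedFDeriv_const_smul_apply' (hd a), norm_smul, Real.norm_eq_abs, mul_assoc]
  exact mul_le_mul_of_nonneg_left (hC a i x) (abs_nonneg _)

theorem exists_sum_cutoff_compl_bound {k : ℕ} {χ : Euc n → ℝ} (hχ : IsTestFun n χ)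
    (hχ1 : ∀ x, ‖x‖ < 1 / 2 → χ x = 1) {ι : Type*} [Fintype ι] (κ : ι → 𝓢(Euc n, ℝ))
    (I : ι → Fin k → Fin n) (c : ι → ℝ) :
    (∀ i, ContDiff ℝ (⊤ : ℕ∞) fun y => ∑ a, c a •
      dirDeriv n k (I a) (fun y => (1 - χ y) * scaledKernel k i (κ a) y) y) ∧
    ∀ j, ∃ C : ℝ, ∀ i x, ‖iteratedFDeriv ℝ j (fun y => ∑ a, c a •
      dirDeriv n k (I a) (fun y => (1 - χ y) * scaledKernel k i (κ a) y) y) x‖ ≤ C * (1 / 2) ^ i := by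
  have hsm : ∀ a i, ContDiff ℝ (⊤ : ℕ∞) fun y => (1 - χ y) * scaledKernel k i (κ a) y :=
    fun a i => (contDiff_const.sub hχ.1).mul (contDiff_scaledKernel k i _)
  refine ⟨fun i => ContDiff.sum fun a _ => ((hsm a i).dirDeriv (I a)).const_smul _,
    exists_sum_geometric_bound (Z := fun a i =>
      dirDeriv n k (I a) fun y => (1 - χ y) * scaledKernel k i (κ a) y)
      (fun a i => (hsm a i).dirDeriv (I a)) (fun a j => ?_) c⟩
  obtain ⟨C, -, hC⟩ := exists_cutoff_compl_scaledKernel_bound k (κ a) hχ hχ1 (k + j)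
  exact ⟨C, fun i x => (norm_iteratedFDeriv_dirDeriv_le (hsm a i) j (I a) x).trans (hC i x)⟩

theorem IsTestFun.mul_smooth {χ g : Euc n → ℝ} (hχ : IsTestFun n χ) (hg : ContDiff ℝ (⊤ : ℕ∞) g) :
    IsTestFun n fun y => χ y * g y :=
  ⟨hχ.1.mul hg, hχ.2.mul_right⟩

theorem exists_cutoff (n : ℕ) {r R : ℝ} (hr : 0 < r) (hR : r < R) : ∃ χ : Euc n → ℝ,
    IsTestFun n χ ∧ tsupport χ ⊆ closedBall 0 R ∧ ∀ x, ‖x‖ ≤ r → χ x = 1 := by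
  let b : ContDiffBump (0 : Euc n) := ⟨r, R, hr, hR⟩
  exact ⟨b, ⟨b.contDiff, b.hasCompactSupport⟩, b.tsupport_eq.subset, fun x hx =>
    b.one_of_mem_closedBall (mem_closedBall_zero_iff.2 hx)⟩

variable {k : ℕ} {V W : Type*}
  [NormedAddCommGroup V] [InnerProductSpace ℝ V] [FiniteDimensional ℝ V]
  [NormedAddCommGroup W] [InnerProductSpace ℝ W] [FiniteDimensional ℝ W]

omit [FiniteDimensional ℝ W] in
theorem exists_measurable_density {σ : Measure (Euc n)} {f : Euc n → W}
    (hf : AEStronglyMeasurable f σ) (hf1 : ∀ᵐ x ∂σ, ‖f x‖ = 1) {w : W} (hw : ‖w‖ = 1) :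
    ∃ ρ : Euc n → ℝ, Measurable ρ ∧ (∀ z, |ρ z| ≤ 1) ∧ ρ =ᵐ[σ] fun z => ⟪w, f z⟫ := by
  have hm : AEStronglyMeasurable (fun z => ⟪w, f z⟫) σ := hf.const_inner
  refine ⟨fun z => max (-1) (min 1 (hm.mk _ z)),
    measurable_const.max (measurable_const.min hm.stronglyMeasurable_mk.measurable),
    fun z => abs_le.2 ⟨le_max_left _ _, max_le (by norm_num) (min_le_left _ _)⟩, ?_⟩
  filter_upwards [hf1, hm.ae_eq_mk] with z hz hz'
  rw [← hz']
  have := abs_le.1 ((abs_real_inner_le_norm w (f z)).trans_eq (by rw [hw, hz, one_mul]))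
  rw [min_eq_right this.2, max_eq_right this.1]

/-- An elliptic operator admits a representation formula through dyadic potentials of its
measure. -/
theorem IsElliptic.exists_representation {A : CoeffOp n k V W} (hA : IsElliptic n k A)
    (hnk : n < k) {u : Euc n → V} (hu : LocallyIntegrable u volume) {σ : Measure (Euc n)}
    [IsLocallyFiniteMeasure σ] {f : Euc n → W} (hf : LocallyIntegrable f σ)
    (hf1 : ∀ᵐ x ∂σ, ‖f x‖ = 1) (h : HasDistribA n k A u σ f) {ι ι' : Type*} [Fintype ι]
    [Fintype ι'] (v : OrthonormalBasis ι ℝ V) (w : OrthonormalBasis ι' ℝ W) {χ : Euc n → ℝ}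
    (hχ : IsTestFun n χ) (hχs : tsupport χ ⊆ closedBall 0 1) (hχ1 : ∀ x, ‖x‖ < 1 / 2 → χ x = 1) :
    ∃ (κ : ι → ι' → 𝓢(Euc n, ℝ)) (ρ : ι' → Euc n → ℝ) (S : ι → Euc n → ℝ),
      (∀ p q, IsCalderonZygmundKernel k (κ p q)) ∧ (∀ q, Measurable (ρ q)) ∧
      (∀ q z, |ρ q z| ≤ 1) ∧ (∀ p, ContDiff ℝ (⊤ : ℕ∞) (S p)) ∧
      ∀ᵐ x ∂(volume : Measure (Euc n)), ∀ p, ⟪v p, u x⟫ = S p x +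
        ∑ q, ∑' i, mconv σ (ρ q) (fun y => χ y * scaledKernel k i (κ p q) y) x := by
  classical
  obtain ⟨φ, κ, hφ, hid, hcz⟩ := hA.exists_parametrix (by omega) (fun p => v p) w
  obtain ⟨χ₁, hχ₁, hχ₁s, hχ₁1⟩ := exists_cutoff n one_pos one_lt_two
  choose ρ hρ hρ1 hρf using fun q =>
    exists_measurable_density hf.aestronglyMeasurable hf1 (w.norm_eq_one q)
  have hup : ∀ p, LocallyIntegrable (fun z => ⟪v p, u z⟫) volume := fun p =>
    locallyIntegrable_inner hu (v p)
  let Z : ι → ι → ℕ → Euc n → ℝ := fun p r i y => ∑ a : (Fin k → Fin n) × ι', ⟪w a.2, A a.1 (v r)⟫ •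
    dirDeriv n k a.1 (fun y => (1 - χ y) * scaledKernel k i (κ p a.2) y) y
  have hZ : ∀ p r i, ContDiff ℝ (⊤ : ℕ∞) (Z p r i) := fun p r =>
    (exists_sum_cutoff_compl_bound hχ hχ1 _ _ _).1
  have hZb : ∀ p r j, ∃ C : ℝ, ∀ i x, ‖iteratedFDeriv ℝ j (Z p r i) x‖ ≤ C * (1 / 2) ^ i :=
    fun p r => (exists_sum_cutoff_compl_bound hχ hχ1 _ _ _).2
  let Φ : ℕ → Euc n → ℝ := fun i y => χ₁ y * scaledKernel 0 i φ y
  have hΦ : ∀ i, IsTestFun n (Φ i) := fun i => hχ₁.mul_smooth (contDiff_scaledKernel 0 i φ)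
  have hG : ∀ p r i y, ∑ I : Fin k → Fin n, ∑ q,
      dirDeriv n k I (fun y => χ y * scaledKernel k i (κ p q) y) y * ⟪w q, A I (v r)⟫ =
      (Φ (i + 1) y - Φ i y) * ⟪v p, v r⟫ - χ₁ y * Z p r i y := by
    intro p r i y
    have e1 : ∀ (I : Fin k → Fin n) q, dirDeriv n k I (fun y => χ y * scaledKernel k i (κ p q) y) y =
        χ₁ y * dirDeriv n k I (fun y => χ y * scaledKernel k i (κ p q) y) y := by
      intro I q
      by_cases hy : ‖y‖ ≤ 1
      · rw [hχ₁1 y hy, one_mul]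
      · rw [image_eq_zero_of_notMem_tsupport (f := dirDeriv n k I _), mul_zero]
        exact fun hy' => hy (mem_closedBall_zero_iff.1
          (tsupport_cutoff_subset k i _ hχs (tsupport_dirDeriv_subset _ I hy')))
    have e2 : ∀ (I : Fin k → Fin n) q, dirDeriv n k I (fun y => χ y * scaledKernel k i (κ p q) y) y *
        ⟪w q, A I (v r)⟫ = χ₁ y * (2 ^ (i * n) * (dirDeriv n k I (κ p q) ((2 : ℝ) ^ i • y) *
          ⟪w q, A I (v r)⟫)) - χ₁ y * (⟪w q, A I (v r)⟫ •
          dirDeriv n k I (fun y => (1 - χ y) * scaledKernel k i (κ p q) y) y) := by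
      intro I q
      rw [e1, smul_eq_mul]
      linear_combination (χ₁ y * ⟪w q, A I (v r)⟫) * dirDeriv_cutoff_add k i (κ p q) hχ I y
    have e3 : χ₁ y * Z p r i y = ∑ I : Fin k → Fin n, ∑ q, χ₁ y * (⟪w q, A I (v r)⟫ •
          dirDeriv n k I (fun y => (1 - χ y) * scaledKernel k i (κ p q) y) y) := by
      simp only [Z, Finset.mul_sum]
      exact Fintype.sum_prod_type _
    simp only [e2, Finset.sum_sub_distrib]
    rw [e3]
    congr 1
    simp only [← Finset.mul_sum]
    rw [hid]
    simp only [Φ, scaledKernel, smul_smul, ← pow_succ']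
    rw [show (i + 1) * n = i * n + n by ring, pow_add]
    ring
  have hχκ : ∀ p q i, IsTestFun n (fun y => χ y * scaledKernel k i (κ p q) y) := fun p q i =>
    isTestFun_cutoff_scaledKernel k i (κ p q) hχ
  have hpart : ∀ p x i, ∑ q, mconv σ (ρ q) (fun y => χ y * scaledKernel k i (κ p q) y) x =
      (mconv volume (fun z => ⟪v p, u z⟫) (Φ (i + 1)) x - mconv volume (fun z => ⟪v p, u z⟫) (Φ i) x) -
      ∑ r, mconv volume (fun z => ⟪v r, u z⟫) (fun y => χ₁ y * Z p r i y) x := by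
    intro p x i
    have e1 := h.sum_mconv_eq hu hf v (fun q => w q) (fun q => hχκ p q i) x
    have e2 : ∀ q, mconv σ (ρ q) (fun y => χ y * scaledKernel k i (κ p q) y) x =
        mconv σ (fun z => ⟪w q, f z⟫) (fun y => χ y * scaledKernel k i (κ p q) y) x := fun q =>
      integral_congr_ae (by filter_upwards [hρf q] with z hz; rw [hz])
    simp only [e2, ← e1, hG]
    have e3 : ∀ r, IsTestFun n fun y => (Φ (i + 1) y - Φ i y) * ⟪v p, v r⟫ := fun r =>
      ⟨((hΦ (i + 1)).1.sub (hΦ i).1).mul contDiff_const, ((hΦ (i + 1)).2.sub (hΦ i).2).mul_right⟩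
    have e4 : ∀ r, mconv volume (fun z => ⟪v r, u z⟫)
        (fun y => (Φ (i + 1) y - Φ i y) * ⟪v p, v r⟫ - χ₁ y * Z p r i y) x =
        (mconv volume (fun z => ⟪v r, u z⟫) (Φ (i + 1)) x -
          mconv volume (fun z => ⟪v r, u z⟫) (Φ i) x) * ⟪v p, v r⟫ -
        mconv volume (fun z => ⟪v r, u z⟫) (fun y => χ₁ y * Z p r i y) x := fun r => by
      rw [mconv_sub_right (hup r) (e3 r) (hχ₁.mul_smooth (hZ p r i)), mconv_mul_const,
        mconv_sub_right (hup r) (hΦ (i + 1)) (hΦ i)]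
    simp only [e4]
    simp [Finset.sum_sub_distrib, OrthonormalBasis.inner_eq_ite]
  refine ⟨κ, ρ, fun p => fun x => mconv volume (fun z => ⟪v p, u z⟫) (Φ 0) x +
    ∑ r, mconv volume (fun z => ⟪v r, u z⟫) (fun y => χ₁ y * ∑' i, Z p r i y) x,
    fun p q => hcz p q, hρ, hρ1, fun p => (contDiff_mconv (hup p) (hΦ 0)).add
      (ContDiff.sum fun r _ => contDiff_mconv (hup r)
        (isTestFun_and_hasSum_mconv_of_bound (hup r) hχ₁ (hZ p r) (hZb p r)).1), ?_⟩
  filter_upwards [ae_all_iff.2 fun p => tendsto_mconv_cutoff_approx (hup p) φ hχ₁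
    (hχ₁1 0 (by simp)) hχ₁s] with x hx p
  have h1 : Tendsto (fun N => ∑ i ∈ Finset.range N,
      ∑ q, mconv σ (ρ q) (fun y => χ y * scaledKernel k i (κ p q) y) x) atTop
      (𝓝 (∑ q, ∑' i, mconv σ (ρ q) (fun y => χ y * scaledKernel k i (κ p q) y) x)) := by
    simp only [Finset.sum_comm (s := Finset.range _)]
    exact tendsto_finsetSum _ fun q _ => tendsto_sum_mconv (hρ q) (hρ1 q) hnk (κ p q) hχ hχs x
  have h2 : Tendsto (fun N => ∑ i ∈ Finset.range N,
      ∑ r, mconv volume (fun z => ⟪v r, u z⟫) (fun y => χ₁ y * Z p r i y) x) atTop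
      (𝓝 (∑ r, mconv volume (fun z => ⟪v r, u z⟫) (fun y => χ₁ y * ∑' i, Z p r i y) x)) := by
    simp only [Finset.sum_comm (s := Finset.range _)]
    exact tendsto_finsetSum _ fun r _ =>
      (isTestFun_and_hasSum_mconv_of_bound (hup r) hχ₁ (hZ p r) (hZb p r)).2 x
  simp only [hpart, Finset.sum_sub_distrib (f := fun i => mconv _ _ (Φ (i + 1)) x - _),
    Finset.sum_range_sub fun i => mconv volume (fun z => ⟪v p, u z⟫) (Φ i) x] at h1
  have h3 := tendsto_nhds_unique h1 (((hx p).sub_const _).sub h2)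
  rw [hφ, one_mul] at h3
  linarith

end Representation

section WeakDerivatives

variable {n : ℕ} {F : Type*} [NormedAddCommGroup F] [NormedSpace ℝ F]

theorem ContDiff.fderiv_apply_comm {g : Euc n → F} (hg : ContDiff ℝ (⊤ : ℕ∞) g) (x a b : Euc n) :
    fderiv ℝ (fun y => fderiv ℝ g y a) x b = fderiv ℝ (fun y => fderiv ℝ g y b) x a := by
  have h1 : DifferentiableAt ℝ (fderiv ℝ g) x :=
    (((hg.of_le (natCast_le_smooth 2)).fderiv_right (m := 1) (by norm_num)).differentiable
      one_ne_zero) x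
  have h2 : IsSymmSndFDerivAt ℝ g x :=
    hg.contDiffAt.isSymmSndFDerivAt (by rw [minSmoothness_of_isRCLikeNormedField]; exact natCast_le_smooth 2)
  rw [fderiv_clm_apply h1 (by fun_prop), fderiv_clm_apply h1 (by fun_prop)]
  simpa using h2 b a

theorem dirDeriv_fderiv_apply {g : Euc n → F} (hg : ContDiff ℝ (⊤ : ℕ∞) g) {m : ℕ}
    (I : Fin m → Fin n) (e : Euc n) :
    dirDeriv n m I (fun x => fderiv ℝ g x e) = fun x => fderiv ℝ (dirDeriv n m I g) x e := by
  have hsm : ContDiff ℝ (⊤ : ℕ∞) fun x => fderiv ℝ g x e :=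
    (hg.fderiv_right (m := (⊤ : ℕ∞)) (mod_cast le_top)).clm_apply contDiff_const
  induction m with
  | zero => simp only [dirDeriv_zero]
  | succ m ih =>
    rw [dirDeriv_succ hsm, dirDeriv_succ hg, ih]
    ext x
    exact (hg.dirDeriv _).fderiv_apply_comm x _ _

theorem dirDeriv_succ_of_contDiff {m : ℕ} {g : Euc n → F} (hg : ContDiff ℝ (m + 1 : ℕ) g)
    (I : Fin (m + 1) → Fin n) : dirDeriv n (m + 1) I g =
      fun x => fderiv ℝ (dirDeriv n m (fun i => I i.succ) g) x (stdVec n (I 0)) := by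
  ext x
  have h1 : DifferentiableAt ℝ (iteratedFDeriv ℝ m g) x :=
    (hg.iteratedFDeriv_right (m := 1) (by rw [add_comm]; exact mod_cast le_rfl)).differentiable
      one_ne_zero x
  have h2 := ((ContinuousMultilinearMap.apply ℝ (fun _ : Fin m => Euc n) F
    (fun i => stdVec n (I i.succ))).hasFDerivAt.comp x h1.hasFDerivAt).fderiv
  change _ = fderiv ℝ (ContinuousMultilinearMap.apply ℝ (fun _ : Fin m => Euc n) F
    (fun i => stdVec n (I i.succ)) ∘ iteratedFDeriv ℝ m g) x _
  rw [h2, dirDeriv, iteratedFDeriv_succ_apply_left]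
  rfl

theorem contDiff_dirDeriv_of_add_le {N : ℕ} {g : Euc n → F} (hg : ContDiff ℝ N g) {m j : ℕ}
    (h : j + m ≤ N) (I : Fin m → Fin n) : ContDiff ℝ j (dirDeriv n m I g) :=
  (ContinuousMultilinearMap.apply ℝ (fun _ : Fin m => Euc n) F
    (fun i => stdVec n (I i))).contDiff.comp (hg.iteratedFDeriv_right (mod_cast h))

theorem integral_fderiv_smul_eq_neg {φ : Euc n → ℝ} (hφ : IsTestFun n φ) {U : Euc n → F}
    (hU : ContDiff ℝ 1 U) (e : Euc n) :
    ∫ x, fderiv ℝ φ x e • U x = -∫ x, φ x • fderiv ℝ U x e := by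
  have hφ1 : ContDiff ℝ 1 φ := hφ.1.of_le (mod_cast le_top)
  have c1 : Continuous fun x => fderiv ℝ φ x e :=
    (hφ1.continuous_fderiv one_ne_zero).clm_apply continuous_const
  have c2 : Continuous fun x => fderiv ℝ U x e :=
    (hU.continuous_fderiv one_ne_zero).clm_apply continuous_const
  rw [integral_smul_fderiv_eq_neg_fderiv_smul_of_integrable, neg_neg]
  · exact (c1.smul hU.continuous).integrable_of_hasCompactSupport
      ((hφ.2.fderiv_apply (𝕜 := ℝ) e).smul_right)
  · exact (hφ1.continuous.smul c2).integrable_of_hasCompactSupport hφ.2.smul_right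
  · exact (hφ1.continuous.smul hU.continuous).integrable_of_hasCompactSupport hφ.2.smul_right
  · exact fun x _ => hφ1.differentiable one_ne_zero x
  · exact fun x _ => hU.differentiable one_ne_zero x

/-- Iterated integration by parts against a test function. -/
theorem integral_dirDeriv_smul {m : ℕ} {U : Euc n → F} (hU : ContDiff ℝ m U) (I : Fin m → Fin n)
    {φ : Euc n → ℝ} (hφ : IsTestFun n φ) :
    ∫ x, dirDeriv n m I φ x • U x = (-1 : ℝ) ^ m • ∫ x, φ x • dirDeriv n m I U x := by
  induction m generalizing φ with
  | zero => simp only [dirDeriv_zero, pow_zero, one_smul]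
  | succ m ih =>
    have hφ' : IsTestFun n fun x => fderiv ℝ φ x (stdVec n (I 0)) :=
      ⟨(hφ.1.fderiv_right (m := (⊤ : ℕ∞)) (mod_cast le_top)).clm_apply contDiff_const,
        hφ.2.fderiv_apply (𝕜 := ℝ) _⟩
    have h1 := ih (hU.of_le (mod_cast Nat.le_succ m)) (fun i => I i.succ) hφ'
    rw [dirDeriv_fderiv_apply hφ.1, ← dirDeriv_succ hφ.1 I, integral_fderiv_smul_eq_neg hφ
      (contDiff_dirDeriv_of_add_le hU (j := 1) (by omega) _)] at h1
    rw [h1, dirDeriv_succ_of_contDiff hU, pow_succ]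
    simp

theorem isWeakDerivFamily_dirDeriv {V : Type*} [NormedAddCommGroup V] [InnerProductSpace ℝ V]
    {m : ℕ} {u U : Euc n → V} (hU : ContDiff ℝ m U) (h : u =ᵐ[volume] U) :
    IsWeakDerivFamily n m u fun I => dirDeriv n m I U := by
  refine ⟨fun I => (contDiff_dirDeriv_of_add_le hU (j := 0) (by omega) I).continuous.locallyIntegrable,
    fun I φ hφ => ?_⟩
  rw [← integral_dirDeriv_smul hU I hφ]
  refine integral_congr_ae ?_
  filter_upwards [h] with x hx
  rw [hx]

end WeakDerivatives

section Elliptic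

variable {n k : ℕ} {V W : Type*}
  [NormedAddCommGroup V] [InnerProductSpace ℝ V] [FiniteDimensional ℝ V]
  [NormedAddCommGroup W] [InnerProductSpace ℝ W] [FiniteDimensional ℝ W]

/-- For elliptic `A` of order `k > n`, the maps in `BV^A_loc` have a representative whose
derivatives of order `m < k - n` have Taylor expansions of order `k - m` almost everywhere. -/
theorem IsElliptic.exists_representative {A : CoeffOp n k V W} (hA : IsElliptic n k A)
    (hnk : n < k) {u : Euc n → V} (hu : MemBVAloc n k A u) :
    ∃ U : Euc n → V, u =ᵐ[volume] U ∧ ∀ m, n + m < k → ContDiff ℝ m U ∧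
      ∀ᵐ x ∂(volume : Measure (Euc n)), ∀ I : Fin m → Fin n, HasTaylor (k - m) (dirDeriv n m I U) x := by
  obtain ⟨hu, σ, f, _, hf, hf1, h⟩ := hu
  obtain ⟨χ, hχ, hχs, hχ1⟩ := exists_cutoff n (one_half_pos (α := ℝ)) one_half_lt_one
  have hχ1' : ∀ x, ‖x‖ < 1 / 2 → χ x = 1 := fun x hx => hχ1 x hx.le
  let v := stdOrthonormalBasis ℝ V
  obtain ⟨κ, ρ, S, hκ, hρ, hρ1, hS, hrep⟩ :=
    hA.exists_representation hnk hu hf hf1 h v (stdOrthonormalBasis ℝ W) hχ hχs hχ1'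
  refine ⟨fun x => ∑ p, (S p x + ∑ q, ∑' i, mconv σ (ρ q)
    (fun y => χ y * scaledKernel k i (κ p q) y) x) • v p, ?_, fun m hm => ?_⟩
  · filter_upwards [hrep] with x hx
    simp only [← hx]
    exact (v.sum_repr' (u x)).symm
  have hT := fun p q => contDiff_tsum_mconv (σ := σ) (hρ q) (hρ1 q) (κ p q) hχ hχs hm
  have hSm : ∀ p, ContDiff ℝ m (S p) := fun p => (hS p).of_le (natCast_le_smooth m)
  have hTs : ∀ p, ContDiff ℝ m fun x => ∑ q, ∑' i, mconv σ (ρ q)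
      (fun y => χ y * scaledKernel k i (κ p q) y) x := fun p => ContDiff.sum fun q _ => (hT p q).1
  have hUp := fun p => (hSm p).add (hTs p)
  refine ⟨ContDiff.sum fun p _ => (hUp p).smul contDiff_const, ?_⟩
  have h1 := ae_all_iff.2 fun p => ae_all_iff.2 fun q => ae_all_iff.2 fun I : Fin m → Fin n =>
    (hκ p q).ae_hasTaylor (σ := σ) (hρ q) (hρ1 q) hχ hχs hχ1' (by omega) (by omega) I
  filter_upwards [h1] with x hx I
  have h2 : dirDeriv n m I (fun x => ∑ p, (S p x + ∑ q, ∑' i, mconv σ (ρ q)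
      (fun y => χ y * scaledKernel k i (κ p q) y) x) • v p) = fun x => ∑ p,
      (dirDeriv n m I (S p) x + ∑ q, ∑' i, mconv σ (ρ q)
        (dirDeriv n m I fun y => χ y * scaledKernel k i (κ p q) y) x) • v p := by
    ext x
    rw [dirDeriv_sum (g := fun p x => (S p x + ∑ q, ∑' i, mconv σ (ρ q)
      (fun y => χ y * scaledKernel k i (κ p q) y) x) • v p)
      fun p _ => (hUp p).smul contDiff_const]
    refine Finset.sum_congr rfl fun p _ => ?_
    rw [dirDeriv_smul_const (hUp p)]
    congr 1
    rw [dirDeriv, fun_iteratedFDeriv_add_apply (hSm p).contDiffAt (hTs p).contDiffAt]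
    change dirDeriv n m I (S p) x + dirDeriv n m I _ x = _
    rw [dirDeriv_sum fun q _ => (hT p q).1]
    simp only [(hT p _).2]
  rw [h2]
  exact HasTaylor.sum _ fun p _ => (((hS p).dirDeriv I).hasTaylor (k - m) x |>.add
    (HasTaylor.sum _ fun q _ => hx p q I)).smul_const (v p)

end Elliptic

section PlaneWaves

variable {n k : ℕ} {V W : Type*}
  [NormedAddCommGroup V] [InnerProductSpace ℝ V] [FiniteDimensional ℝ V]
  [NormedAddCommGroup W] [InnerProductSpace ℝ W] [FiniteDimensional ℝ W]

theorem dirDeriv_planeWave {g : ℝ → ℝ} (hg : ContDiff ℝ (⊤ : ℕ∞) g) (ξ : Euc n) {m : ℕ}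
    (I : Fin m → Fin n) (x : Euc n) :
    dirDeriv n m I (fun x => g ⟪ξ, x⟫) x = (∏ i, ξ (I i)) * iteratedDeriv m g ⟪ξ, x⟫ := by
  have h := (innerSL ℝ ξ).iteratedFDeriv_comp_right hg x (natCast_le_smooth m)
  have h2 : (g ∘ innerSL ℝ ξ) = fun x => g ⟪ξ, x⟫ := rfl
  rw [h2] at h
  rw [dirDeriv, h]
  simp [stdVec, iteratedFDeriv_apply_eq_iteratedDeriv_mul_prod, EuclideanSpace.inner_single_right]

omit [FiniteDimensional ℝ W] in
theorem dirDeriv_inner_left {φ : Euc n → W} (hφ : ContDiff ℝ (⊤ : ℕ∞) φ) (w : W) {m : ℕ}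
    (I : Fin m → Fin n) (x : Euc n) :
    dirDeriv n m I (fun x => ⟪w, φ x⟫) x = ⟪w, dirDeriv n m I φ x⟫ := by
  have h := (innerSL ℝ w).iteratedFDeriv_comp_left (hφ.contDiffAt (x := x)) (natCast_le_smooth m)
  have h2 : (innerSL ℝ w ∘ φ) = fun x => ⟪w, φ x⟫ := rfl
  rw [h2] at h
  rw [dirDeriv, h]
  simp [dirDeriv]

omit [FiniteDimensional ℝ W] in
theorem IsTestFun.inner_left {φ : Euc n → W} (hφ : IsTestFun n φ) (w : W) :
    IsTestFun n fun x => ⟪w, φ x⟫ :=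
  ⟨contDiff_const.inner ℝ hφ.1, hφ.2.comp_left (g := fun y => ⟪w, y⟫) (inner_zero_right w)⟩

theorem sum_integral_planeWave_eq_zero {A : CoeffOp n k V W} {ξ : Euc n} {v : V}
    (hv : symbolMap n k A ξ v = 0) {g : ℝ → ℝ} (hg : ContDiff ℝ (⊤ : ℕ∞) g) {φ : Euc n → W}
    (hφ : IsTestFun n φ) :
    ∑ I : Fin k → Fin n,
      ∫ x, g ⟪ξ, x⟫ * ⟪v, LinearMap.adjoint (A I) (dirDeriv n k I φ x)⟫ = 0 := by
  have hG : ContDiff ℝ (⊤ : ℕ∞) fun x : Euc n => g ⟪ξ, x⟫ :=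
    hg.comp (contDiff_const.inner ℝ contDiff_id)
  have h1 : ∀ I : Fin k → Fin n,
      ∫ x, g ⟪ξ, x⟫ * ⟪v, LinearMap.adjoint (A I) (dirDeriv n k I φ x)⟫ =
        (-1) ^ k * ∫ x, ⟪(∏ i, ξ (I i)) • A I v, φ x⟫ * iteratedDeriv k g ⟪ξ, x⟫ := by
    intro I
    have := integral_dirDeriv_smul (hG.of_le (natCast_le_smooth k)) I (hφ.inner_left (A I v))
    simp only [smul_eq_mul] at this
    calc _ = ∫ x, dirDeriv n k I (fun x => ⟪A I v, φ x⟫) x * g ⟪ξ, x⟫ := by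
          congr 1 with x
          rw [dirDeriv_inner_left hφ.1, LinearMap.adjoint_inner_right, mul_comm]
      _ = _ := by
          rw [this]
          congr 2 with x
          rw [dirDeriv_planeWave hg, real_inner_smul_left]; ring
  have hint : ∀ w : W, Integrable fun x : Euc n => ⟪w, φ x⟫ * iteratedDeriv k g ⟪ξ, x⟫ := by
    intro w
    refine Continuous.integrable_of_hasCompactSupport ?_ (hφ.inner_left w).2.mul_right
    exact (hφ.inner_left w).1.continuous.mul
      ((hg.continuous_iteratedDeriv k (natCast_le_smooth k)).comp (by fun_prop))
  rw [Finset.sum_congr rfl fun I _ => h1 I, ← Finset.mul_sum, ← integral_finsetSum _ fun I _ => hint _]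
  have h2 : ∑ I : Fin k → Fin n, (∏ i, ξ (I i)) • A I v = 0 := by
    simpa [symbolMap] using hv
  have h3 : ∀ x : Euc n, ∑ I : Fin k → Fin n,
      ⟪(∏ i, ξ (I i)) • A I v, φ x⟫ * iteratedDeriv k g ⟪ξ, x⟫ = 0 := fun x => by
    rw [← Finset.sum_mul, ← sum_inner, h2, inner_zero_left, zero_mul]
  simp [h3]

theorem exists_smooth_approx_indicator {U : Set ℝ} (hU : IsOpen U) :
    ∃ g : ℕ → ℝ → ℝ, (∀ N, ContDiff ℝ (⊤ : ℕ∞) (g N)) ∧ (∀ N t, |g N t| ≤ 1) ∧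
      ∀ t, Tendsto (fun N => g N t) atTop (𝓝 (U.indicator (fun _ => 1) t)) := by
  obtain ⟨f, hf, hfs, hfr⟩ := hU.exists_contDiff_support_eq (n := ⊤)
  refine ⟨fun N t => Real.smoothTransition (N * f t), fun N =>
    Real.smoothTransition.contDiff.comp (contDiff_const.mul hfs), fun N t => ?_, fun t => ?_⟩
  · rw [abs_of_nonneg (Real.smoothTransition.nonneg _)]
    exact Real.smoothTransition.le_one _
  · by_cases ht : t ∈ U
    · have hpos : 0 < f t := by
        rw [← hf] at ht
        exact lt_of_le_of_ne (hfr ⟨t, rfl⟩).1 (Ne.symm ht)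
      rw [Set.indicator_of_mem ht]
      refine tendsto_const_nhds.congr' ?_
      filter_upwards [(tendsto_natCast_atTop_atTop.atTop_mul_const hpos).eventually_ge_atTop 1]
        with N hN
      exact (Real.smoothTransition.one_of_one_le hN).symm
    · have h0 : f t = 0 := by
        rw [← hf] at ht
        simpa using ht
      simp [Set.indicator_of_notMem ht, h0]

theorem memBVAloc_indicator {A : CoeffOp n k V W} {ξ : Euc n} {v : V}
    (hv : symbolMap n k A ξ v = 0) {U : Set ℝ} (hU : IsOpen U) :
    MemBVAloc n k A (((fun x : Euc n => ⟪ξ, x⟫) ⁻¹' U).indicator fun _ => v) := by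
  have hL : Continuous fun x : Euc n => (⟪ξ, x⟫ : ℝ) := by fun_prop
  refine ⟨(locallyIntegrable_const v).indicator (hU.preimage hL).measurableSet, 0, 0,
    inferInstance, locallyIntegrable_zero, by simp, fun φ hφ => ?_⟩
  obtain ⟨g, hg, hg1, hgt⟩ := exists_smooth_approx_indicator hU
  suffices h : ∑ I : Fin k → Fin n, ∫ x, ⟪((fun x : Euc n => (⟪ξ, x⟫ : ℝ)) ⁻¹' U).indicator
      (fun _ => v) x, LinearMap.adjoint (A I) (dirDeriv n k I φ x)⟫ = 0 by
    rw [h]; simp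
  refine tendsto_nhds_unique (f := fun N : ℕ => ∑ I : Fin k → Fin n,
      ∫ x, g N ⟪ξ, x⟫ * ⟪v, LinearMap.adjoint (A I) (dirDeriv n k I φ x)⟫) (l := atTop)
    (tendsto_finsetSum _ fun I _ => ?_) ?_
  · have hint : Integrable fun x => ⟪v, LinearMap.adjoint (A I) (dirDeriv n k I φ x)⟫ := by
      simp only [LinearMap.adjoint_inner_right, ← dirDeriv_inner_left hφ.1]
      have := (hφ.inner_left (A I v)).dirDeriv I
      exact this.1.continuous.integrable_of_hasCompactSupport this.2
    refine tendsto_integral_of_dominated_convergence _ (fun N => ?_) hint.norm (fun N => ?_) ?_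
    · exact (((hg N).continuous.comp hL).aestronglyMeasurable).mul hint.1
    · refine .of_forall fun x => ?_
      rw [norm_mul]
      exact mul_le_of_le_one_left (norm_nonneg _) (hg1 N _)
    · refine .of_forall fun x => ?_
      convert (hgt ⟪ξ, x⟫).mul_const _ using 2
      by_cases hx : ⟪ξ, x⟫ ∈ U
      · simp [Set.indicator, hx]
      · simp [Set.indicator, hx]
  · simp [sum_integral_planeWave_eq_zero hv (hg _) hφ]

theorem surjective_innerSL {ξ : Euc n} (hξ : ξ ≠ 0) :
    Function.Surjective (innerSL ℝ ξ : Euc n →ₗ[ℝ] ℝ) := fun t =>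
  ⟨(t / ⟪ξ, ξ⟫) • ξ, by
    have : (⟪ξ, ξ⟫ : ℝ) ≠ 0 := inner_self_ne_zero.2 hξ
    simp only [ContinuousLinearMap.coe_coe, innerSL_apply_apply, real_inner_smul_right]
    field_simp⟩

theorem volume_inner_preimage_eq_zero_iff {ξ : Euc n} (hξ : ξ ≠ 0) {S : Set ℝ}
    (hS : MeasurableSet S) :
    volume ((fun x : Euc n => (⟪ξ, x⟫ : ℝ)) ⁻¹' S) = 0 ↔ volume S = 0 := by
  obtain ⟨c, hc, h⟩ := (innerSL ℝ ξ : Euc n →ₗ[ℝ] ℝ).exists_map_addHaar_eq_smul_addHaar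
    (volume : Measure (Euc n)) (volume : Measure ℝ) (surjective_innerSL hξ)
  have hm : Measurable (innerSL ℝ ξ : Euc n →ₗ[ℝ] ℝ) := (innerSL ℝ ξ).continuous.measurable
  have h2 := congrArg (fun μ => μ S) h
  simp only [Measure.map_apply hm hS] at h2
  change volume ((innerSL ℝ ξ : Euc n →ₗ[ℝ] ℝ) ⁻¹' S) = 0 ↔ _
  rw [h2]
  simp [hc.ne']

end PlaneWaves

section Counterexamples

variable {n k : ℕ} {V W : Type*}
  [NormedAddCommGroup V] [InnerProductSpace ℝ V] [FiniteDimensional ℝ V]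
  [NormedAddCommGroup W] [InnerProductSpace ℝ W] [FiniteDimensional ℝ W]

theorem MemTInf.exists_continuous_eq {F : Type*} [NormedAddCommGroup F] [NormedSpace ℝ F]
    {j : ℕ} (hj : 1 ≤ j) {f : Euc n → F} {x : Euc n} (hf : MemTInf n j f x) :
    ∃ a : F, ∀ c, (∀ r > 0, volume ({y | f y = c} ∩ ball x r) ≠ 0) → a = c := by
  obtain ⟨P, hP, hs⟩ := hf
  refine ⟨P x, fun c hc => ?_⟩
  by_contra hne
  have hδ : 0 < ‖P x - c‖ := norm_pos_iff.2 (sub_ne_zero.2 hne)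
  set δ := ‖P x - c‖ with hδdef
  have e1 : ∀ᶠ r : ℝ in 𝓝[>] 0, essSup (fun y => (‖f y - P y‖₊ : ℝ≥0∞))
      (volume.restrict (ball x r)) / ENNReal.ofReal (r ^ (j : ℝ)) < 1 :=
    hs.eventually (gt_mem_nhds one_pos)
  obtain ⟨ε, hε, hPε⟩ := Metric.continuous_iff.1 hP.1.continuous x (δ / 2) (by positivity)
  have e2 : ∀ᶠ r : ℝ in 𝓝[>] 0, r < min ε (min 1 (δ / 2)) :=
    mem_nhdsWithin_of_mem_nhds (gt_mem_nhds (by positivity))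
  obtain ⟨r, ⟨hr1, hr2⟩, hr0⟩ := ((e1.and e2).and self_mem_nhdsWithin).exists
  have hr0 : 0 < r := hr0
  obtain ⟨hrε, hr1', hrδ⟩ := by simpa only [lt_min_iff] using hr2
  have hrj : r ^ (j : ℝ) ≤ r := by
    rw [Real.rpow_natCast]
    exact pow_le_of_le_one hr0.le hr1'.le (by omega)
  have hsup : essSup (fun y => (‖f y - P y‖₊ : ℝ≥0∞)) (volume.restrict (ball x r)) ≤
      ENNReal.ofReal (r ^ (j : ℝ)) := by
    have h1 : ENNReal.ofReal (r ^ (j : ℝ)) ≠ 0 := by simpa using pow_pos hr0 j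
    rw [ENNReal.div_lt_iff (.inl h1) (.inl ENNReal.ofReal_ne_top), one_mul] at hr1
    exact hr1.le
  have hae : ∀ᵐ y ∂volume.restrict (ball x r), f y ≠ c := by
    filter_upwards [ENNReal.ae_le_essSup (μ := volume.restrict (ball x r))
      fun y => (‖f y - P y‖₊ : ℝ≥0∞), ae_restrict_mem measurableSet_ball] with y hy hyb hyc
    have h1 : ‖f y - P y‖ ≤ r := by
      have := (hy.trans hsup).trans (ENNReal.ofReal_le_ofReal hrj)
      rw [← ENNReal.ofReal_coe_nnreal, coe_nnnorm] at this
      exact (ENNReal.ofReal_le_ofReal_iff hr0.le).1 this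
    have h2 : ‖P y - P x‖ < δ / 2 := by
      rw [← dist_eq_norm]
      exact hPε y ((mem_ball.1 hyb).trans hrε)
    have h3 : δ ≤ ‖f y - P y‖ + ‖P y - P x‖ := by
      rw [hδdef, ← hyc, norm_sub_rev]
      simpa using norm_add_le (f y - P y) (P y - P x)
    linarith
  refine hc r hr0 ?_
  rw [ae_iff, Measure.restrict_apply₀' measurableSet_ball.nullMeasurableSet] at hae
  simpa using hae

theorem exists_isOpen_dense_volume_compl_ne_zero :
    ∃ U : Set ℝ, IsOpen U ∧ Dense U ∧ volume Uᶜ ≠ 0 := by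
  obtain ⟨U, hU, hUo, hlt⟩ := (Set.range ((↑) : ℚ → ℝ)).exists_isOpen_lt_of_lt (μ := volume) 1 (by
    rw [(Set.countable_range _).measure_zero]; exact one_pos)
  refine ⟨U, hUo, Rat.denseRange_cast.mono hU, fun h => ?_⟩
  have := measure_union_le (μ := (volume : Measure ℝ)) U Uᶜ
  rw [Set.union_compl_self, h, Real.volume_univ, add_zero] at this
  exact (hlt.trans ENNReal.one_lt_top).not_ge this

theorem exists_memBVAloc_not_memTInf {A : CoeffOp n k V W} {ξ : Euc n} (hξ : ξ ≠ 0) {v : V}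
    (hv0 : v ≠ 0) (hv : symbolMap n k A ξ v = 0) {j : ℕ} (hj : 1 ≤ j) :
    ∃ u : Euc n → V, MemBVAloc n k A u ∧
      ∀ w, w =ᵐ[volume] u → ¬ ∀ᵐ x ∂volume, MemTInf n j w x := by
  obtain ⟨U, hUo, hUd, hUc⟩ := exists_isOpen_dense_volume_compl_ne_zero
  refine ⟨_, memBVAloc_indicator hv hUo, fun w hw hT => ?_⟩
  set L : Euc n → ℝ := fun x => ⟪ξ, x⟫ with hL
  have hLc : Continuous L := by fun_prop
  set E : Set (Euc n) := L ⁻¹' Uᶜ with hE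
  have hEm : MeasurableSet E := hUo.measurableSet.compl.preimage hLc.measurable
  have hE0 : volume E ≠ 0 := by
    rw [hE, Ne, volume_inner_preimage_eq_zero_iff hξ hUo.measurableSet.compl]
    exact hUc
  have hsupp : ∀ᵐ x ∂volume.restrict E, x ∈ (volume.restrict E).support := by
    rw [ae_iff]; exact Measure.measure_compl_support
  have hfalse : ∀ᵐ x ∂volume.restrict E, False := by
    filter_upwards [ae_restrict_of_ae hT, hsupp] with x hx hxs
    obtain ⟨a, ha⟩ := hx.exists_continuous_eq hj
    refine hv0 ((ha v fun r hr h => ?_).symm.trans (ha 0 fun r hr h => ?_))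
    · have hcong : volume ({y | w y = v} ∩ ball x r) = 0 := h
      have hopen : IsOpen (L ⁻¹' U ∩ ball x r) := (hUo.preimage hLc).inter isOpen_ball
      have hne : (L ⁻¹' U ∩ ball x r).Nonempty := by
        have : Dense (L ⁻¹' U) := hUd.preimage
          (LinearMap.isOpenMap_of_finiteDimensional _ (surjective_innerSL hξ))
        exact (this.inter_open_nonempty _ isOpen_ball ⟨x, mem_ball_self hr⟩).mono
          fun y hy => ⟨hy.2, hy.1⟩
      refine (hopen.measure_pos volume hne).ne' ?_
      refine measure_mono_null_ae ?_ hcong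
      filter_upwards [hw] with y hy hyU
      exact ⟨by simp [hy, Set.indicator, show L y ∈ U from hyU.1], hyU.2⟩
    · have h1 : 0 < volume.restrict E (ball x r) :=
        (nhds_basis_ball.mem_measureSupport.1 hxs) r hr
      rw [Measure.restrict_apply measurableSet_ball] at h1
      refine h1.ne' (measure_mono_null_ae ?_ h)
      filter_upwards [hw] with y hy hyU
      have : L y ∉ U := hyU.2
      exact ⟨by simp [hy, Set.indicator, this], hyU.1⟩
  rw [ae_iff, Measure.restrict_apply (by simp)] at hfalse
  exact hE0 (by simpa using hfalse)

end Counterexamples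

section HalfSpace

variable {n : ℕ} {V : Type*} [NormedAddCommGroup V] [InnerProductSpace ℝ V] [FiniteDimensional ℝ V]

theorem integral_dirDeriv_eq_zero {m : ℕ} (hm : m ≠ 0) (I : Fin m → Fin n) {φ : Euc n → ℝ}
    (hφ : IsTestFun n φ) : ∫ x, dirDeriv n m I φ x = 0 := by
  have h := integral_dirDeriv_smul (U := fun _ : Euc n => (1 : ℝ)) contDiff_const I hφ
  simpa [dirDeriv, iteratedFDeriv_const_of_ne hm] using h

/-- The weak derivatives of a piecewise constant function vanish where it is locally constant. -/
theorem IsWeakDerivFamily.ae_eq_zero_of_isOpen {m : ℕ} (hm : m ≠ 0) {u : Euc n → V}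
    {v : (Fin m → Fin n) → Euc n → V} (h : IsWeakDerivFamily n m u v) {O : Set (Euc n)}
    (hO : IsOpen O) {c : V} (hu : ∀ x ∈ O, u x = c) (I : Fin m → Fin n) :
    ∀ᵐ x ∂volume, x ∈ O → v I x = 0 := by
  refine hO.ae_eq_zero_of_integral_contDiff_smul_eq_zero ((h.1 I).locallyIntegrableOn O)
    fun φ hφ hφs hφO => ?_
  have h1 := h.2 I φ ⟨hφ, hφs⟩
  have h2 : ∫ x, dirDeriv n m I φ x • u x = 0 := by
    calc ∫ x, dirDeriv n m I φ x • u x = ∫ x, dirDeriv n m I φ x • c := by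
          congr 1 with x
          by_cases hx : x ∈ O
          · rw [hu x hx]
          · rw [image_eq_zero_of_notMem_tsupport fun hx' =>
              hx (hφO (tsupport_dirDeriv_subset φ I hx')), zero_smul, zero_smul]
      _ = 0 := by rw [integral_smul_const, integral_dirDeriv_eq_zero hm I ⟨hφ, hφs⟩, zero_smul]
  rw [h2] at h1
  exact (smul_eq_zero.1 h1.symm).resolve_left (by simp)

theorem volume_inner_eq_zero {ξ : Euc n} (hξ : ξ ≠ 0) :
    volume {x : Euc n | ⟪ξ, x⟫ = (0 : ℝ)} = 0 :=
  (volume_inner_preimage_eq_zero_iff hξ (measurableSet_singleton (0 : ℝ))).2 (by simp)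

theorem eq_zero_of_fderiv_eq_zero_of_tsupport {ψ : Euc n → ℝ} (hψ : ContDiff ℝ (⊤ : ℕ∞) ψ)
    {ξ e : Euc n} (he : ⟪ξ, e⟫ ≠ (0 : ℝ)) {R : ℝ} (hs : tsupport ψ ⊆ {x | R ≤ ⟪ξ, x⟫})
    (h : ∀ x, fderiv ℝ ψ x e = 0) (x : Euc n) : ψ x = 0 := by
  have hd : ∀ s : ℝ, HasDerivAt (fun s : ℝ => ψ (x + s • e)) 0 s := fun s => by
    have h1 : HasDerivAt (fun s : ℝ => x + s • e) e s := by
      simpa using ((hasDerivAt_id s).smul_const e).const_add x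
    have h2 := ((hψ.differentiable (by simp)) (x + s • e)).hasFDerivAt.comp_hasDerivAt s h1
    rwa [h] at h2
  have hc := is_const_of_deriv_eq_zero (fun s => (hd s).differentiableAt) fun s => (hd s).deriv
  set s : ℝ := (R - 1 - ⟪ξ, x⟫) / ⟪ξ, e⟫
  have h1 := hc 0 s
  simp only [zero_smul, add_zero] at h1
  rw [h1]
  refine image_eq_zero_of_notMem_tsupport fun hx => ?_
  have h2 : R ≤ ⟪ξ, x + s • e⟫ := hs hx
  rw [inner_add_right, real_inner_smul_right, div_mul_cancel₀ _ he] at h2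
  linarith

theorem eq_zero_of_dirDeriv_eq_zero_of_tsupport {w : Euc n → ℝ} (hw : ContDiff ℝ (⊤ : ℕ∞) w)
    {ξ : Euc n} {i : Fin n} (hi : ξ i ≠ 0) {R : ℝ} (hs : tsupport w ⊆ {x | R ≤ ⟪ξ, x⟫}) {m : ℕ}
    (h : ∀ x, dirDeriv n m (fun _ => i) w x = 0) (x : Euc n) : w x = 0 := by
  induction m with
  | zero => simpa [dirDeriv_zero] using h x
  | succ m ih =>
    refine ih (eq_zero_of_fderiv_eq_zero_of_tsupport (hw.dirDeriv _) (ξ := ξ) (e := stdVec n i) ?_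
      ((tsupport_dirDeriv_subset _ _).trans hs) fun x => ?_)
    · simpa [stdVec, EuclideanSpace.inner_single_right] using hi
    · rw [← h x, dirDeriv_succ hw]

theorem exists_integral_dirDeriv_ne_zero {ξ : Euc n} {i : Fin n} (hi : ξ i ≠ 0) (m : ℕ) :
    ∃ φ : Euc n → ℝ, IsTestFun n φ ∧
      ∫ x in {x : Euc n | 0 < (⟪ξ, x⟫ : ℝ)}, dirDeriv n m (fun _ => i) φ x ≠ 0 := by
  by_contra! hcon
  have hξ : ξ ≠ 0 := by rintro rfl; simp at hi
  set H : Set (Euc n) := {x | 0 < (⟪ξ, x⟫ : ℝ)}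
  have hH : MeasurableSet H := (isOpen_lt continuous_const (by fun_prop)).measurableSet
  let b : ContDiffBump (0 : Euc n) := ⟨1 / 2, 1, by norm_num, by norm_num⟩
  have hb : IsTestFun n b := ⟨b.contDiff, b.hasCompactSupport⟩
  have hρ : LocallyIntegrable (H.indicator fun _ => (1 : ℝ)) (volume : Measure (Euc n)) :=
    (locallyIntegrable_const 1).indicator hH
  set w := mconv volume (H.indicator fun _ => (1 : ℝ)) b
  have hval : ∀ (g : Euc n → ℝ) y, mconv volume (H.indicator fun _ => (1 : ℝ)) g y =
      ∫ z in H, g (y - z) := fun g y => by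
    rw [mconv, ← integral_indicator hH]
    congr 1 with z
    by_cases hz : z ∈ H <;> simp [hz]
  have hsupp : ∀ y, b y ≠ 0 → |(⟪ξ, y⟫ : ℝ)| ≤ ‖ξ‖ := fun y hy => by
    have : y ∈ ball (0 : Euc n) 1 := by
      rw [← b.support_eq]; exact hy
    exact (abs_real_inner_le_norm _ _).trans
      (mul_le_of_le_one_right (norm_nonneg _) (mem_ball_zero_iff.1 this).le)
  have hdir : ∀ y, dirDeriv n m (fun _ => i) w y = 0 := fun y => by
    rw [dirDeriv_mconv hρ hb, hval]
    have h1 := hcon _ (hb.comp_const_sub y)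
    have h2 : ∀ z, dirDeriv n m (fun _ => i) b (y - z) =
        (-1) ^ m * dirDeriv n m (fun _ => i) (fun z => b (y - z)) z := fun z => by
      rw [dirDeriv_comp_const_sub hb.1, smul_eq_mul, ← mul_assoc, ← mul_pow]
      simp
    simp only [h2, integral_const_mul, h1, mul_zero]
  have hts : tsupport w ⊆ {x | -‖ξ‖ ≤ (⟪ξ, x⟫ : ℝ)} := by
    refine closure_minimal (fun y hy => ?_) (isClosed_le continuous_const (by fun_prop))
    by_contra hlt
    refine hy ?_
    refine (hval b y).trans ?_
    refine setIntegral_eq_zero_of_forall_eq_zero fun z hz => ?_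
    by_contra hne
    have h1 := (abs_le.1 (hsupp _ hne)).1
    have hz : (0 : ℝ) < ⟪ξ, z⟫ := hz
    rw [inner_sub_right] at h1
    exact hlt (show -‖ξ‖ ≤ (⟪ξ, y⟫ : ℝ) by linarith)
  have hn : 0 < ‖ξ‖ := norm_pos_iff.2 hξ
  have h0 := eq_zero_of_dirDeriv_eq_zero_of_tsupport (contDiff_mconv hρ hb) hi hts hdir
    ((2 / ‖ξ‖) • ξ)
  rw [hval] at h0
  have h3 : ∫ z in H, b ((2 / ‖ξ‖) • ξ - z) = ∫ z, b ((2 / ‖ξ‖) • ξ - z) := by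
    refine setIntegral_eq_integral_of_forall_compl_eq_zero fun z hz => ?_
    by_contra hne
    have h1 := (abs_le.1 (hsupp _ hne)).2
    have hz : ¬ (0 : ℝ) < ⟪ξ, z⟫ := hz
    rw [inner_sub_right, real_inner_smul_right, real_inner_self_eq_norm_sq] at h1
    have h4 : 2 / ‖ξ‖ * ‖ξ‖ ^ 2 = 2 * ‖ξ‖ := by field_simp
    linarith
  rw [h3, integral_sub_left_eq_self (fun z => b z)] at h0
  exact b.integral_pos.ne' h0

theorem not_isWeakDerivFamily_indicator {m : ℕ} (hm : m ≠ 0) {ξ : Euc n} (hξ : ξ ≠ 0) {c : V}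
    (hc : c ≠ 0) (v : (Fin m → Fin n) → Euc n → V) :
    ¬ IsWeakDerivFamily n m (((fun x : Euc n => (⟪ξ, x⟫ : ℝ)) ⁻¹' Set.Ioi 0).indicator
      fun _ => c) v := by
  intro h
  obtain ⟨i, hi⟩ : ∃ i, ξ i ≠ 0 := by
    by_contra! hcon
    exact hξ (by ext i; simpa using hcon i)
  obtain ⟨φ, hφ, hne⟩ := exists_integral_dirDeriv_ne_zero hi m
  have hLc : Continuous fun x : Euc n => (⟪ξ, x⟫ : ℝ) := by fun_prop
  have hv : v (fun _ => i) =ᵐ[volume] 0 := by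
    filter_upwards [h.ae_eq_zero_of_isOpen hm (isOpen_Ioi.preimage hLc) (c := c)
        (fun x hx => Set.indicator_of_mem hx _) fun _ => i,
      h.ae_eq_zero_of_isOpen hm ((isOpen_Iio (a := (0 : ℝ))).preimage hLc) (c := 0)
        (fun x hx => by
          have : ¬ 0 < (⟪ξ, x⟫ : ℝ) := not_lt_of_gt hx
          simp [Set.indicator, this]) fun _ => i,
      measure_eq_zero_iff_ae_notMem.1 (volume_inner_eq_zero hξ)] with x h1 h2 h3
    rcases lt_trichotomy (⟪ξ, x⟫ : ℝ) 0 with h4 | h4 | h4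
    · exact h2 h4
    · exact absurd h4 h3
    · exact h1 h4
  have h1 := h.2 (fun _ => i) φ hφ
  have h2 : ∫ x, φ x • v (fun _ => i) x = 0 := by
    rw [integral_congr_ae (g := fun _ => 0) (hv.mono fun x hx => by simp [hx])]
    simp
  have h3 : ∫ x, dirDeriv n m (fun _ => i) φ x • ((fun x : Euc n => (⟪ξ, x⟫ : ℝ)) ⁻¹'
      Set.Ioi 0).indicator (fun _ => c) x =
        (∫ x in {x : Euc n | 0 < (⟪ξ, x⟫ : ℝ)}, dirDeriv n m (fun _ => i) φ x) • c := by
    rw [← integral_indicator (isOpen_lt continuous_const hLc).measurableSet,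
      ← integral_smul_const]
    congr 1 with x
    by_cases hx : 0 < (⟪ξ, x⟫ : ℝ) <;> simp [Set.indicator, hx]
  rw [h3, h2, smul_zero] at h1
  exact (smul_ne_zero hne hc) h1

end HalfSpace

section Characterization

variable {n k : ℕ} {V W : Type*}
  [NormedAddCommGroup V] [InnerProductSpace ℝ V] [FiniteDimensional ℝ V]
  [NormedAddCommGroup W] [InnerProductSpace ℝ W] [FiniteDimensional ℝ W]

theorem IsWeakDerivFamily.ae_eq {u : Euc n → V} {v : (Fin 0 → Fin n) → Euc n → V}
    (hu : LocallyIntegrable u volume) (h : IsWeakDerivFamily n 0 u v) (I : Fin 0 → Fin n) :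
    v I =ᵐ[volume] u := by
  refine ae_eq_of_integral_contDiff_smul_eq (h.1 I) hu fun φ hφ hφs => ?_
  have h1 := h.2 I φ ⟨hφ, hφs⟩
  rw [dirDeriv_zero] at h1
  simpa using h1.symm

theorem isElliptic_of_forall_memTInf {A : CoeffOp n k V W} {m j : ℕ} (hj : 1 ≤ j)
    (h : ∀ u : Euc n → V, MemBVAloc n k A u →
      ∃ v : (Fin m → Fin n) → Euc n → V, IsWeakDerivFamily n m u v ∧
        ∀ᵐ x ∂(volume : Measure (Euc n)), ∀ I, MemTInf n j (v I) x) : IsElliptic n k A := by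
  intro ξ hξ
  refine (injective_iff_map_eq_zero _).2 fun v hv => ?_
  by_contra hv0
  rcases eq_or_ne m 0 with rfl | hm
  · obtain ⟨u, hu, hnot⟩ := exists_memBVAloc_not_memTInf hξ hv0 hv hj
    obtain ⟨w, hw, hT⟩ := h u hu
    exact hnot _ (hw.ae_eq hu.1 Fin.elim0) (hT.mono fun x hx => hx _)
  · obtain ⟨w, hw, -⟩ := h _ (memBVAloc_indicator hv isOpen_Ioi)
    exact not_isWeakDerivFamily_indicator hm hξ hv0 w hw

theorem IsElliptic.exists_isWeakDerivFamily {A : CoeffOp n k V W} (hA : IsElliptic n k A)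
    (hnk : n < k) {u : Euc n → V} (hu : MemBVAloc n k A u) {m : ℕ} (hm : n + m < k) :
    ∃ v : (Fin m → Fin n) → Euc n → V, IsWeakDerivFamily n m u v ∧
      ∀ᵐ x ∂(volume : Measure (Euc n)), ∀ I, MemTInf n (k - m) (v I) x := by
  obtain ⟨U, hU, h⟩ := hA.exists_representative hnk hu
  obtain ⟨hUm, hT⟩ := h m hm
  exact ⟨_, isWeakDerivFamily_dirDeriv hUm hU,
    hT.mono fun x hx I => (hx I).memTInf .rfl⟩

theorem IsElliptic.ae_memTInf {A : CoeffOp n k V W} (hA : IsElliptic n k A) (hnk : n < k)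
    {u : Euc n → V} (hu : MemBVAloc n k A u) :
    ∀ᵐ x ∂(volume : Measure (Euc n)), MemTInf n k u x := by
  obtain ⟨U, hU, h⟩ := hA.exists_representative hnk hu
  refine (h 0 hnk).2.mono fun x hx => ?_
  have h0 := hx Fin.elim0
  rw [dirDeriv_zero] at h0
  exact h0.memTInf hU

end Characterization

end

/-- Theorem 1.4(3): for `k > n`, `𝒜` is elliptic iff
`D^{k-n-1} u ∈ t^{n+1,∞}(x)` a.e. for every `u ∈ BV^𝒜_loc`; in particular, in that case
every `u ∈ BV^𝒜_loc` is `k` times classically differentiable a.e.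
(i.e. `u ∈ t^{k,∞}(x)` for a.e. `x`). -/
theorem statement7 (n k : ℕ) (hn : 1 ≤ n) (hnk : n < k) {V W : Type*}
    [NormedAddCommGroup V] [InnerProductSpace ℝ V] [FiniteDimensional ℝ V]
    [NormedAddCommGroup W] [InnerProductSpace ℝ W] [FiniteDimensional ℝ W]
    (A : CoeffOp n k V W) (hA : IsSymmetricOp n k A) :
    (IsElliptic n k A ↔
      ∀ u : Euc n → V, MemBVAloc n k A u →
        ∃ v : (Fin (k - n - 1) → Fin n) → Euc n → V, IsWeakDerivFamily n (k - n - 1) u v ∧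
          ∀ᵐ x ∂(volume : Measure (Euc n)), ∀ I, MemTInf n (n + 1) (v I) x) ∧
    (IsElliptic n k A →
      ∀ u : Euc n → V, MemBVAloc n k A u →
        ∀ᵐ x ∂(volume : Measure (Euc n)), MemTInf n k u x) := by
  have hm : n + (k - n - 1) < k := by omega
  have hj : k - (k - n - 1) = n + 1 := by omega
  refine ⟨⟨fun hA u hu => ?_, isElliptic_of_forall_memTInf (by omega)⟩,
    fun hA u hu => hA.ae_memTInf hnk hu⟩
  obtain ⟨v, hv, hT⟩ := hA.exists_isWeakDerivFamily hnk hu hm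
  rw [hj] at hT
  exact ⟨v, hv, hT⟩
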